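/- Let n ≥ 4 be a natural number. Then for every continuous map f ∈ C(S^{4n+3}, Γ_{2n+2}⁺), the homotopy group π₄(C(S^{4n+3}, Γ_{2n+2}⁺), f) contains an element of infinite order; equivalently, it contains an infinite cyclic subgroup. -/

import Mathlib

open Topology

/-- The unit sphere `S^m ⊆ ℝ^{m+1}` centered at the origin. -/
noncomputable def Sph (m : ℕ) : Set (EuclideanSpace ℝ (Fin (m + 1))) :=
  Metric.sphere (0 : EuclideanSpace ℝ (Fin (m + 1))) 1

/-- The north pole `N = (0, …, 0, 1) ∈ S^m`. -/
noncomputable def northPole (m : ℕ) : Sph m :=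
  ⟨EuclideanSpace.single (Fin.last m) (1 : ℝ), by
    simp [Sph, EuclideanSpace.norm_single]⟩

/-- The space `Γ_n` of orthogonal complex structures on `ℝ^{2n}`: real `(2n) × (2n)` matrices
`J` (with `Fin (2n)` identified with `Fin n ⊕ Fin n`) such that `Jᵀ * J = 1` and `J * J = -1`,
with the subspace topology. -/
def Gamma (n : ℕ) : Set (Matrix (Fin n ⊕ Fin n) (Fin n ⊕ Fin n) ℝ) :=
  {J | J.transpose * J = 1 ∧ J * J = -1}

/-- The standard complex structure `J₀` on `ℝ^{2n}`, given by the block matrix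
`[[0, -1], [1, 0]]`. -/
def J0 (n : ℕ) : Matrix (Fin n ⊕ Fin n) (Fin n ⊕ Fin n) ℝ :=
  Matrix.fromBlocks 0 (-1) 1 0

theorem J0_mem (n : ℕ) : J0 n ∈ Gamma n := by
  constructor
  · simp [J0, Matrix.fromBlocks_transpose, Matrix.fromBlocks_multiply, ← Matrix.fromBlocks_one]
  · have h : (-1 : Matrix (Fin n ⊕ Fin n) (Fin n ⊕ Fin n) ℝ)
        = Matrix.fromBlocks (-1) (-0) (-0) (-1) := by
      rw [← Matrix.fromBlocks_neg, Matrix.fromBlocks_one]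
    simp [J0, Matrix.fromBlocks_multiply, h]

/-- `Γ_n⁺`: the path component of the standard complex structure `J₀` in `Γ_n`
(the homogeneous space `SO(2n)/U(n)`). -/
noncomputable def GammaPlus (n : ℕ) : Set (Gamma n) :=
  pathComponent (⟨J0 n, J0_mem n⟩ : Gamma n)

/-- `Γ_n⁺` pointed at `J₀`. -/
noncomputable def J0plus (n : ℕ) : GammaPlus n :=
  ⟨⟨J0 n, J0_mem n⟩, mem_pathComponent_self _⟩

section Auxiliary

open scoped TensorProduct ContDiff
open MeasureTheory
set_option linter.unusedSectionVars false

/-- A ring with a parity involution and a square-zero graded derivation. -/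
structure GradedDiff (M : Type*) [Ring M] where
  d : M →+ M
  par : M →+* M
  d_mul : ∀ x y, d (x * y) = d x * y + par x * d y
  d_d : ∀ x, d (d x) = 0
  par_d : ∀ x, par (d x) = -d (par x)

namespace GradedDiff

section Ring
variable {M B : Type*} [Ring M] [Ring B] (G : GradedDiff M)

theorem d_one : G.d 1 = 0 := by
  have h := G.d_mul 1 1
  simpa using h

/-- The defining properties of the trace with respect to an idempotent `e`. -/
structure IsTracial (e : M) (tr : M →+ B) : Prop where
  idem : e * e = e
  even : G.par e = e
  comm : ∀ x, tr (e * x) = tr (x * e)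

variable {G} {e : M} {tr : M →+ B}

theorem IsTracial.flip (h : G.IsTracial e tr) {x : M} (hx : e * x = x * (1 - e)) : tr x = 0 := by
  have h1 : tr (e * x) = 0 := by
    have : e * x = e * (x * (1 - e)) := by rw [← hx, ← mul_assoc, h.idem]
    rw [this, h.comm, mul_assoc, sub_mul, h.idem, one_mul, sub_self]
    simp
  have h2 : tr (x * e) = 0 := by rw [← h.comm, h1]
  have h3 : x = e * x + x * e := by rw [hx]; noncomm_ring
  rw [h3, map_add, h1, h2, add_zero]

theorem IsTracial.mul_d (h : G.IsTracial e tr) : e * G.d e = G.d e * (1 - e) := by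
  have h1 := G.d_mul e e
  rw [h.idem, h.even] at h1
  rw [mul_sub, mul_one]
  nth_rewrite 2 [h1]
  noncomm_ring

/-- `x` exchanges `e` and `1 - e`, or preserves them, according to the parity of `n`. -/
def Flips (e x : M) (n : ℕ) : Prop :=
  if Even n then e * x = x * e else e * x = x * (1 - e)

theorem Flips.mul {x y : M} {m n : ℕ} (hx : Flips e x m) (hy : Flips e y n) :
    Flips e (x * y) (m + n) := by
  unfold Flips at *
  have key : e * (x * y) = (e * x) * y := by noncomm_ring
  have key2 : x * (1 - e) * y = x * y - x * (e * y) := by noncomm_ring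
  by_cases h1 : Even m <;> by_cases h2 : Even n
  · simp only [h1, h2, if_true, Nat.even_add] at *
    rw [key, hx, mul_assoc, hy, mul_assoc]
  · simp only [h1, h2, if_true, if_false, Nat.even_add, iff_false, not_true] at *
    rw [key, hx, mul_assoc, hy, mul_assoc]
  · simp only [h1, h2, if_true, if_false, Nat.even_add, iff_true] at *
    rw [key, hx, key2, hy]; noncomm_ring
  · simp only [h1, h2, if_true, if_false, Nat.even_add] at *
    rw [key, hx, key2, hy]; noncomm_ring

theorem Flips.one : Flips e (1 : M) 0 := by simp [Flips]

theorem Flips.pow {x : M} {m : ℕ} (hx : Flips e x m) (k : ℕ) : Flips e (x ^ k) (k * m) := by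
  induction k with
  | zero => simpa using Flips.one
  | succ k ih => rw [pow_succ, add_mul, one_mul]; exact ih.mul hx

theorem IsTracial.flips_d (h : G.IsTracial e tr) (k : ℕ) : Flips e (G.d e ^ k) k := by
  have : Flips e (G.d e) 1 := by simpa [Flips] using h.mul_d
  simpa using this.pow k

theorem IsTracial.tr_eq_zero (h : G.IsTracial e tr) {x : M} {n : ℕ} (hx : Flips e x n)
    (hn : ¬ Even n) : tr x = 0 := h.flip (by simpa [Flips, hn] using hx)

theorem IsTracial.par_d_pow (h : G.IsTracial e tr) (k : ℕ) :
    G.par (G.d e ^ k) = (-1) ^ k * G.d e ^ k := by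
  rw [map_pow, G.par_d, h.even, neg_pow]

theorem IsTracial.d_d_pow (_ : G.IsTracial e tr) (k : ℕ) : G.d (G.d e ^ k) = 0 := by
  induction k with
  | zero => simp [G.d_one]
  | succ k ih => rw [pow_succ, G.d_mul, ih, G.d_d]; simp

theorem IsTracial.closed (h : G.IsTracial e tr) (k : ℕ) :
    tr (G.d (e * G.d e ^ (2 * k))) = 0 := by
  rw [G.d_mul, h.d_d_pow, mul_zero, add_zero, ← pow_succ']
  exact h.tr_eq_zero (h.flips_d _) (by simp)

/-- The transgression form. -/
def xi (G : GradedDiff M) (D : M →+ M) (e : M) (k : ℕ) : M :=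
  ∑ a ∈ Finset.range (2 * k), (-1) ^ a * (e * G.d e ^ a * D e * G.d e ^ (2 * k - 1 - a))

theorem der_pow (D : M →+ M) (hD : ∀ x y, D (x * y) = D x * y + x * D y) (x : M) (n : ℕ) :
    D (x ^ n) = ∑ a ∈ Finset.range n, x ^ a * D x * x ^ (n - 1 - a) := by
  induction n with
  | zero => have := hD 1 1; simpa using this
  | succ n ih =>
    rw [pow_succ, hD, ih, Finset.sum_range_succ, Finset.sum_mul]
    congr 1
    · refine Finset.sum_congr rfl fun a ha => ?_
      have : n + 1 - 1 - a = (n - 1 - a) + 1 := by have := Finset.mem_range.1 ha; omega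
      rw [this, pow_succ, mul_assoc]
    · simp

theorem IsTracial.transgression (h : G.IsTracial e tr) (D : M →+ M)
    (hD : ∀ x y, D (x * y) = D x * y + x * D y) (hDd : ∀ x, D (G.d x) = G.d (D x)) (k : ℕ) :
    tr (D (e * G.d e ^ (2 * k))) = tr (G.d (xi G D e k)) := by
  have hDe : Flips e (D e) 1 := by
    have h1 := hD e e
    rw [h.idem] at h1
    simp only [Flips, Nat.not_even_one, if_false, mul_sub, mul_one]
    nth_rewrite 2 [h1]
    noncomm_ring
  rw [hD, map_add, h.tr_eq_zero (hDe.mul (h.flips_d (2 * k))) (by simp),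
    zero_add, der_pow D hD, xi, map_sum, Finset.mul_sum, map_sum, map_sum]
  refine Finset.sum_congr rfl fun a ha => ?_
  have ha := Finset.mem_range.1 ha
  have hpm : ∀ x : M, G.d ((-1) ^ a * x) = (-1) ^ a * G.d x := by
    intro x
    rcases Nat.even_or_odd a with h | h <;> simp [h.neg_one_pow]
  rw [hpm, G.d_mul, h.d_d_pow, mul_zero, add_zero, G.d_mul, G.d_mul, h.d_d_pow, mul_zero, add_zero,
    map_mul G.par, h.par_d_pow, h.even, ← hDd, ← pow_succ', add_mul, mul_add, map_add]
  have hz : tr ((-1) ^ a * (G.d e ^ (a + 1) * D e * G.d e ^ (2 * k - 1 - a))) = 0 := by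
    have hf := (((h.flips_d (a + 1)).mul hDe).mul (h.flips_d (2 * k - 1 - a)))
    have hodd : ¬ Even (a + 1 + 1 + (2 * k - 1 - a)) := by
      rw [show a + 1 + 1 + (2 * k - 1 - a) = 2 * k + 1 by omega]; simp
    have := h.tr_eq_zero hf hodd
    rcases Nat.even_or_odd a with h | h <;> simp [h.neg_one_pow, this]
  rw [hz, zero_add]
  congr 1
  rcases Nat.even_or_odd a with h | h <;> simp [h.neg_one_pow, mul_assoc]

end Ring

section Matrix
variable {B : Type*} [Ring B] (G : GradedDiff B) {r : Type*} [Fintype r] [DecidableEq r]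

/-- The entrywise graded differential on matrices. -/
def matrix : GradedDiff (Matrix r r B) where
  d := G.d.mapMatrix
  par := G.par.mapMatrix
  d_mul x y := by
    ext i j
    simp [Matrix.mul_apply, G.d_mul, Finset.sum_add_distrib]
  d_d x := by ext i j; simp [G.d_d]
  par_d x := by ext i j; simp [G.par_d]

theorem isTracial_matrix {e : Matrix r r B} (he : e * e = e) (heven : ∀ i j, G.par (e i j) = e i j)
    (hc : ∀ i j x, e i j * x = x * e i j) :
    (G.matrix (r := r)).IsTracial e (Matrix.traceAddMonoidHom r B) where
  idem := he
  even := by ext i j; simp [matrix, heven]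
  comm x := by
    simp only [Matrix.traceAddMonoidHom_apply, Matrix.trace, Matrix.diag, Matrix.mul_apply]
    rw [Finset.sum_comm]
    exact Finset.sum_congr rfl fun i _ => Finset.sum_congr rfl fun j _ => hc _ _ _

end Matrix

end GradedDiff

open Polynomial in
theorem Matrix.derivative_det {n R : Type*} [Fintype n] [DecidableEq n] [CommRing R]
    (M : Matrix n n R[X]) :
    derivative M.det = (M.adjugate * M.map derivative).trace := by
  have h : ∀ i, (M.adjugate * M.map derivative) i i
      = (M.updateCol i fun k => derivative (M k i)).det := by
    intro i
    rw [← Matrix.cramer_apply, Matrix.cramer_eq_adjugate_mulVec]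
    rfl
  simp only [Matrix.trace, Matrix.diag, h, Matrix.det_apply, map_sum]
  rw [Finset.sum_comm]
  refine Finset.sum_congr rfl fun σ _ => ?_
  rw [← Finset.smul_sum, Units.smul_def, derivative_smul, Units.smul_def, derivative_prod_finset]
  congr 1
  refine Finset.sum_congr rfl fun i _ => ?_
  rw [← Finset.mul_prod_erase _ _ (Finset.mem_univ i), mul_comm]
  simp only [Matrix.updateCol_self]
  congr 1
  refine Finset.prod_congr rfl fun j hj => ?_
  rw [Matrix.updateCol_ne (Finset.ne_of_mem_erase hj)]

/-- The elementary symmetric functions, up to sign, in terms of the power sums `p`. -/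
noncomputable def newtonCoeff {R : Type*} [Ring R] [Algebra ℂ R] (p : ℕ → R) : ℕ → R
  | 0 => 1
  | l + 1 => -((l + 1 : ℂ)⁻¹ • ∑ i : Fin (l + 1), p (l + 1 - i) * newtonCoeff p i)

open Polynomial in
theorem Matrix.coeff_charpolyRev_eq {n R : Type*} [Fintype n] [DecidableEq n] [CommRing R]
    [Algebra ℂ R] (X : Matrix n n R) (l : ℕ) :
    X.charpolyRev.coeff l = newtonCoeff (fun k => (X ^ k).trace) l := by
  set A := (1 - (Polynomial.X : R[X]) • X.map C).adjugate with hA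
  have hP : X.charpolyRev = (1 - (Polynomial.X : R[X]) • X.map C).det := rfl
  have hAP : A = X.charpolyRev • (1 : Matrix n n R[X]) + (Polynomial.X : R[X]) • (A * X.map C) := by
    have := Matrix.adjugate_mul (1 - (Polynomial.X : R[X]) • X.map C)
    rw [← hA, ← hP, mul_sub, mul_one, Matrix.mul_smul] at this
    rw [← this]; abel
  have hmul : ∀ l, (A * X.map C).map (fun p => p.coeff l) = A.map (fun p => p.coeff l) * X := by
    intro l; ext i j
    simp [Matrix.mul_apply]
  have hA0 : A.map (fun p => p.coeff 0) = X.charpolyRev.coeff 0 • (1 : Matrix n n R) := by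
    rw [hAP]; ext i j
    by_cases hij : i = j <;> simp [hij]
  have hAs : ∀ l, A.map (fun p => p.coeff (l + 1)) = X.charpolyRev.coeff (l + 1) • (1 : Matrix n n R)
      + A.map (fun p => p.coeff l) * X := by
    intro l
    rw [← hmul]
    nth_rewrite 1 [hAP]; ext i j
    by_cases hij : i = j <;> simp [hij]
  have hAl : ∀ l, A.map (fun p => p.coeff l)
      = ∑ i ∈ Finset.range (l + 1), X.charpolyRev.coeff i • X ^ (l - i) := by
    intro l
    induction l with
    | zero => simp [hA0]
    | succ l ih =>
      rw [hAs, ih, Finset.sum_range_succ _ (l + 1), Finset.sum_mul, add_comm]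
      congr 1
      · refine Finset.sum_congr rfl fun i hi => ?_
        have : l + 1 - i = (l - i) + 1 := by have := Finset.mem_range.1 hi; omega
        rw [this, pow_succ, Matrix.smul_mul]
      · simp
  have hder : ∀ l : ℕ, X.charpolyRev.coeff (l + 1) * (l + 1)
      = -(A.map (fun p => p.coeff l) * X).trace := by
    intro l
    have h1 := Matrix.derivative_det (1 - (Polynomial.X : R[X]) • X.map C)
    have h2 : (1 - (Polynomial.X : R[X]) • X.map C).map derivative = -X.map C := by
      ext i j : 2
      by_cases hij : i = j <;> simp [hij]
    rw [← hA, ← hP, h2, mul_neg, Matrix.trace_neg] at h1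
    have h3 := congrArg (fun p => p.coeff l) h1
    simp only [coeff_derivative] at h3
    rw [h3, ← hmul]
    simp [Matrix.trace]
  induction l using Nat.strong_induction_on with
  | _ l ih =>
  cases l with
  | zero => rw [coeff_zero_eq_eval_zero, Matrix.eval_charpolyRev, newtonCoeff]
  | succ l =>
    rw [newtonCoeff]
    have h1 := hder l
    have h2 : X.charpolyRev.coeff (l + 1)
        = (l + 1 : ℂ)⁻¹ • (X.charpolyRev.coeff (l + 1) * (l + 1)) := by
      have h0 : (l + 1 : ℂ) ≠ 0 := Nat.cast_add_one_ne_zero l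
      have h3 : X.charpolyRev.coeff (l + 1) * ((l : R) + 1)
          = (l + 1 : ℂ) • X.charpolyRev.coeff (l + 1) := by
        rw [Algebra.smul_def]; simp [mul_comm]
      rw [h3, smul_smul, inv_mul_cancel₀ h0, one_smul]
    rw [h2, h1, hAl, smul_neg, Finset.sum_mul, Matrix.trace_sum, Finset.sum_range]
    congr 2
    refine Finset.sum_congr rfl fun i _ => ?_
    rw [← ih i i.2, Matrix.smul_mul, Matrix.trace_smul, ← pow_succ, smul_eq_mul, mul_comm]
    congr 3
    omega

theorem Matrix.newtonCoeff_eq_zero {n R : Type*} [Fintype n] [DecidableEq n] [CommRing R]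
    [Algebra ℂ R] (X : Matrix n n R) {l : ℕ} (hl : Fintype.card n < l) :
    newtonCoeff (fun k => (X ^ k).trace) l = 0 := by
  rw [← Matrix.coeff_charpolyRev_eq]
  rcases subsingleton_or_nontrivial R with h | h
  · exact Subsingleton.elim _ _
  · rw [← Matrix.reverse_charpoly]
    refine Polynomial.coeff_eq_zero_of_natDegree_lt (lt_of_le_of_lt ?_ hl)
    exact (Polynomial.reverse_natDegree_le _).trans (Matrix.charpoly_natDegree_eq_dim _).le

theorem map_newtonCoeff {R S : Type*} [Ring R] [Algebra ℂ R] [Ring S] [Algebra ℂ S] (g : R →ₐ[ℂ] S)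
    (p : ℕ → R) (l : ℕ) : g (newtonCoeff p l) = newtonCoeff (fun k => g (p k)) l := by
  induction l using Nat.strong_induction_on with
  | _ l ih =>
  cases l with
  | zero => simp [newtonCoeff]
  | succ l =>
    rw [newtonCoeff, newtonCoeff, map_neg, map_smul, map_sum]
    congr 2
    exact Finset.sum_congr rfl fun i _ => by rw [map_mul, ih i i.2]

/-- Smooth complex-valued functions. -/
def Smo (E : Type*) [NormedAddCommGroup E] [NormedSpace ℝ E] : Subalgebra ℂ (E → ℂ) where
  carrier := {f | ContDiff ℝ ∞ f}
  mul_mem' := fun {f g} (hf : ContDiff ℝ ∞ f) (hg : ContDiff ℝ ∞ g) => hf.mul hg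
  add_mem' := fun {f g} (hf : ContDiff ℝ ∞ f) (hg : ContDiff ℝ ∞ g) => hf.add hg
  algebraMap_mem' c := (contDiff_const : ContDiff ℝ ∞ fun _ : E => c)

namespace Smo

variable {E E' E'' : Type*} [NormedAddCommGroup E] [NormedSpace ℝ E]
  [NormedAddCommGroup E'] [NormedSpace ℝ E'] [NormedAddCommGroup E''] [NormedSpace ℝ E'']

theorem contDiff (a : Smo E) : ContDiff ℝ ∞ a.1 := a.2

theorem continuous (a : Smo E) : Continuous a.1 :=
  (Smo.contDiff a).continuous

theorem differentiable (a : Smo E) : Differentiable ℝ a.1 :=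
  (Smo.contDiff a).differentiable (by simp)

@[ext] theorem ext {a b : Smo E} (h : ∀ x, a.1 x = b.1 x) : a = b := Subtype.ext (funext h)

@[simp] theorem add_apply (a b : Smo E) (x : E) : (a + b).1 x = a.1 x + b.1 x := rfl
@[simp] theorem mul_apply (a b : Smo E) (x : E) : (a * b).1 x = a.1 x * b.1 x := rfl
@[simp] theorem zero_apply (x : E) : (0 : Smo E).1 x = 0 := rfl

/-- The directional derivative. -/
noncomputable def D (v : E) : Smo E →ₗ[ℂ] Smo E where
  toFun a := ⟨fun x => fderiv ℝ a.1 x v,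
    ((Smo.contDiff a).fderiv_right (m := ∞) (by simp)).clm_apply contDiff_const⟩
  map_add' a b := by
    ext x
    change fderiv ℝ (a.1 + b.1) x v = _
    rw [fderiv_add (Smo.differentiable a x) (Smo.differentiable b x)]
    rfl
  map_smul' c a := by
    ext x
    change fderiv ℝ (c • a.1) x v = _
    rw [fderiv_const_smul (Smo.differentiable a x)]
    rfl

theorem D_apply (v : E) (a : Smo E) (x : E) : (D v a).1 x = fderiv ℝ a.1 x v := rfl

theorem D_mul (v : E) (a b : Smo E) : D v (a * b) = D v a * b + a * D v b := by
  ext x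
  change fderiv ℝ (a.1 * b.1) x v = _
  rw [fderiv_mul (Smo.differentiable a x) (Smo.differentiable b x)]
  simp [D_apply]
  ring

theorem D_one (v : E) : D v (1 : Smo E) = 0 := by
  have := D_mul v (1 : Smo E) 1
  simpa using this

theorem D_comm (v w : E) (a : Smo E) : D v (D w a) = D w (D v a) := by
  ext x
  have h2 : ContDiffAt ℝ ∞ a.1 x := (Smo.contDiff a).contDiffAt
  have hs := h2.isSymmSndFDerivAt (by simp; exact WithTop.coe_le_coe.2 le_top)
  have hd : DifferentiableAt ℝ (fderiv ℝ a.1) x :=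
    ((Smo.contDiff a).fderiv_right (m := ∞) (by simp)).differentiable (by simp) x
  have key : ∀ v w : E, (D v (D w a)).1 x = fderiv ℝ (fderiv ℝ a.1) x v w := by
    intro v w
    change fderiv ℝ (fun y => fderiv ℝ a.1 y w) x v = _
    rw [fderiv_clm_apply hd (differentiableAt_const _)]
    simp
  rw [key, key]
  exact hs v w

/-- Pullback along a smooth map. -/
def pull (g : E' → E) (hg : ContDiff ℝ ∞ g) : Smo E →ₐ[ℂ] Smo E' where
  toFun a := ⟨a.1 ∘ g, (Smo.contDiff a).comp hg⟩
  map_one' := rfl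
  map_mul' _ _ := rfl
  map_zero' := rfl
  map_add' _ _ := rfl
  commutes' _ := rfl

/-- Translation by a vector. -/
def tau (v : E) : Smo E →ₐ[ℂ] Smo E := pull (fun x => x + v) (by fun_prop)

@[simp] theorem tau_apply (v : E) (a : Smo E) (x : E) : (tau v a).1 x = a.1 (x + v) := rfl

theorem D_pull_affine (L : E' →L[ℝ] E) (z : E) (v : E') (a : Smo E) :
    D v (pull (fun x => z + L x) (by fun_prop) a)
      = pull (fun x => z + L x) (by fun_prop) (D (L v) a) := by
  ext x
  change fderiv ℝ (fun x => a.1 (z + L x)) x v = fderiv ℝ a.1 (z + L x) (L v)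
  have h1 : HasFDerivAt (fun x => z + L x) L x := L.hasFDerivAt.const_add z
  exact congrArg (· v) ((Smo.differentiable a (z + L x)).hasFDerivAt.comp x h1).fderiv

/-- Evaluation at a point. -/
def ev (x : E) : Smo E →ₐ[ℂ] ℂ where
  toFun a := a.1 x
  map_one' := rfl
  map_mul' _ _ := rfl
  map_zero' := rfl
  map_add' _ _ := rfl
  commutes' _ := rfl

@[simp] theorem ev_apply (x : E) (a : Smo E) : ev x a = a.1 x := rfl

end Smo

/-- The exterior algebra with generators indexed by `κ`. -/
abbrev Lam (κ : Type*) := ExteriorAlgebra ℂ (κ → ℂ)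

namespace Lam
variable {κ : Type*} [DecidableEq κ]

/-- The generators. -/
noncomputable def θ (l : κ) : Lam κ := ExteriorAlgebra.ι ℂ (Pi.single l 1)

/-- The parity automorphism. -/
noncomputable def par : Lam κ →ₐ[ℂ] Lam κ := CliffordAlgebra.involute

theorem θ_sq (l : κ) : θ l * θ l = 0 := ExteriorAlgebra.ι_sq_zero _

theorem θ_anticomm (l m : κ) : θ l * θ m = -(θ m * θ l) :=
  eq_neg_of_add_eq_zero_left (ExteriorAlgebra.ι_add_mul_swap _ _)

theorem par_θ (l : κ) : par (θ l) = -θ l := CliffordAlgebra.involute_ι _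

theorem θ_mul (l : κ) (x : Lam κ) : θ l * x = par x * θ l := by
  induction x using ExteriorAlgebra.induction with
  | algebraMap r => rw [AlgHom.commutes]; exact (Algebra.commutes r _).symm
  | ι v =>
    rw [par, show CliffordAlgebra.involute (ExteriorAlgebra.ι ℂ v) = -ExteriorAlgebra.ι ℂ v from
      CliffordAlgebra.involute_ι _, neg_mul]
    exact eq_neg_of_add_eq_zero_left (ExteriorAlgebra.ι_add_mul_swap _ _)
  | mul a b ha hb => rw [map_mul, ← mul_assoc, ha, mul_assoc, hb, mul_assoc]
  | add a b ha hb => rw [map_add, mul_add, add_mul, ha, hb]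

end Lam

/-- Differential forms with smooth coefficients on `E`, generated by `κ` one-forms. -/
abbrev Form (E κ : Type*) [NormedAddCommGroup E] [NormedSpace ℝ E] := Smo E ⊗[ℂ] Lam κ

namespace Form

section Instances
variable (E κ : Type*) [NormedAddCommGroup E] [NormedSpace ℝ E]

noncomputable instance : Ring (Form E κ) := inferInstance
noncomputable instance : AddCommGroup (Form E κ) := Ring.toAddCommGroup
noncomputable instance : SubtractionCommMonoid (Form E κ) :=
  AddCommGroup.toDivisionAddCommMonoid
noncomputable instance : NegZeroClass (Form E κ) := SubNegZeroMonoid.toNegZeroClass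

end Instances

variable {E E' κ : Type*} [NormedAddCommGroup E] [NormedSpace ℝ E]
  [NormedAddCommGroup E'] [NormedSpace ℝ E'] [DecidableEq κ]

/-- Apply a linear operator to the coefficients. -/
noncomputable def op {V : Type*} [AddCommGroup V] [Module ℂ V] (T : Smo E →ₗ[ℂ] V) :
    Form E κ →ₗ[ℂ] V ⊗[ℂ] Lam κ := T.rTensor (Lam κ)

@[simp] theorem op_tmul {V : Type*} [AddCommGroup V] [Module ℂ V] (T : Smo E →ₗ[ℂ] V) (a : Smo E)
    (x : Lam κ) : op T (a ⊗ₜ x) = T a ⊗ₜ x := rfl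

/-- Apply a functional to the coefficients. -/
noncomputable def fn (J : Smo E →ₗ[ℂ] ℂ) : Form E κ →ₗ[ℂ] Lam κ :=
  (TensorProduct.lid ℂ (Lam κ)).toLinearMap ∘ₗ op J

@[simp] theorem fn_tmul (J : Smo E →ₗ[ℂ] ℂ) (a : Smo E) (x : Lam κ) :
    fn J (a ⊗ₜ x) = J a • x := by simp [fn]

/-- Evaluation at a point. -/
noncomputable def ev (x : E) : Form E κ →ₐ[ℂ] Lam κ :=
  (Algebra.TensorProduct.lid ℂ (Lam κ)).toAlgHom.comp
    (Algebra.TensorProduct.map (Smo.ev x) (AlgHom.id ℂ _))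

@[simp] theorem ev_tmul (x : E) (a : Smo E) (y : Lam κ) : ev x (a ⊗ₜ y) = a.1 x • y := by
  simp [ev]

/-- Translation. -/
noncomputable def tau (v : E) : Form E κ →ₐ[ℂ] Form E κ :=
  Algebra.TensorProduct.map (Smo.tau v) (AlgHom.id ℂ _)

@[simp] theorem tau_tmul (v : E) (a : Smo E) (y : Lam κ) :
    tau v (a ⊗ₜ y) = Smo.tau v a ⊗ₜ y := by simp [tau]

/-- Functions as forms of degree zero. -/
noncomputable def incl : Smo E →ₐ[ℂ] Form E κ := Algebra.TensorProduct.includeLeft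

theorem incl_eq (a : Smo E) : (incl a : Form E κ) = a ⊗ₜ 1 := rfl

theorem incl_comm (a : Smo E) (α : Form E κ) : incl a * α = α * incl a := by
  induction α using TensorProduct.induction_on with
  | zero => simp
  | tmul b x => simp [incl_eq, mul_comm]
  | add x y hx hy => rw [mul_add, add_mul, hx, hy]

/-- Directional derivative of a form. -/
noncomputable def D (v : E) : Form E κ →ₗ[ℂ] Form E κ := op (Smo.D v)

theorem D_tmul (v : E) (a : Smo E) (x : Lam κ) : D v (a ⊗ₜ[ℂ] x) = Smo.D v a ⊗ₜ x := rfl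

theorem D_mul (v : E) (α η : Form E κ) : D v (α * η) = D v α * η + α * D v η := by
  induction α using TensorProduct.induction_on with
  | zero => simp
  | add x y hx hy => rw [add_mul, map_add, map_add, hx, hy, add_mul, add_mul]; abel
  | tmul a x =>
    induction η using TensorProduct.induction_on with
    | zero => simp
    | add x y hx hy => rw [mul_add, map_add, map_add, hx, hy, mul_add, mul_add]; abel
    | tmul b y => simp [D_tmul, Smo.D_mul, TensorProduct.add_tmul]

variable [Fintype κ]

/-- The exterior derivative along the directions `b`. -/
noncomputable def d (b : κ → E) : Form E κ →ₗ[ℂ] Form E κ :=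
  ∑ l, TensorProduct.map (Smo.D (b l)) (LinearMap.mulLeft ℂ (Lam.θ l))

theorem d_tmul (b : κ → E) (a : Smo E) (x : Lam κ) :
    d b (a ⊗ₜ x) = ∑ l, Smo.D (b l) a ⊗ₜ[ℂ] (Lam.θ l * x) := by
  simp [d]

/-- The parity automorphism of forms. -/
noncomputable def par : Form E κ →ₐ[ℂ] Form E κ :=
  Algebra.TensorProduct.map (AlgHom.id ℂ _) Lam.par

theorem par_tmul (a : Smo E) (x : Lam κ) : par (a ⊗ₜ[ℂ] x) = a ⊗ₜ Lam.par x := by simp [par]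

theorem d_mul (b : κ → E) (α η : Form E κ) : d b (α * η) = d b α * η + par α * d b η := by
  induction α using TensorProduct.induction_on with
  | zero => simp
  | add x y hx hy => rw [add_mul, map_add, map_add, hx, hy, add_mul, map_add, add_mul]; abel
  | tmul a x =>
    induction η using TensorProduct.induction_on with
    | zero => simp
    | add x y hx hy => rw [mul_add, map_add, map_add, hx, hy, mul_add, mul_add]; abel
    | tmul c y =>
      simp only [Algebra.TensorProduct.tmul_mul_tmul, d_tmul, par_tmul, Finset.sum_mul,
        Finset.mul_sum, ← Finset.sum_add_distrib]
      refine Finset.sum_congr rfl fun l _ => ?_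
      rw [Smo.D_mul, TensorProduct.add_tmul, mul_assoc, ← mul_assoc (Lam.par x), ← Lam.θ_mul,
        mul_assoc]

theorem d_d (b : κ → E) (α : Form E κ) : d b (d b α) = 0 := by
  induction α using TensorProduct.induction_on with
  | zero => simp
  | add x y hx hy => rw [map_add, map_add, hx, hy, add_zero]
  | tmul a x =>
    simp only [d_tmul, map_sum]
    set S := ∑ l, ∑ m, Smo.D (b m) (Smo.D (b l) a) ⊗ₜ[ℂ] (Lam.θ m * (Lam.θ l * x)) with hS
    have : S = -S := by
      conv_lhs => rw [hS, Finset.sum_comm]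
      rw [hS, ← Finset.sum_neg_distrib]
      refine Finset.sum_congr rfl fun l _ => ?_
      rw [← Finset.sum_neg_distrib]
      refine Finset.sum_congr rfl fun m _ => ?_
      rw [Smo.D_comm, ← mul_assoc, Lam.θ_anticomm, neg_mul, TensorProduct.tmul_neg, mul_assoc]
    have h2 : (2 : ℂ) • S = 0 := by rw [two_smul]; nth_rewrite 2 [this]; exact add_neg_cancel S
    exact (smul_eq_zero.1 h2).resolve_left two_ne_zero

theorem par_d (b : κ → E) (α : Form E κ) : par (d b α) = -d b (par α) := by
  induction α using TensorProduct.induction_on with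
  | zero => simp
  | add x y hx hy => rw [map_add, map_add, hx, hy, map_add, map_add, neg_add]
  | tmul a x =>
    simp [d_tmul, par_tmul, Lam.par_θ, TensorProduct.tmul_neg]

theorem D_d (b : κ → E) (v : E) (α : Form E κ) : D v (d b α) = d b (D v α) := by
  induction α using TensorProduct.induction_on with
  | zero => simp
  | add x y hx hy => simp only [map_add, hx, hy]
  | tmul a x => simp [d_tmul, D_tmul, Smo.D_comm v]

/-- The differential graded structure on forms. -/
noncomputable def diff (b : κ → E) : GradedDiff (Form E κ) where
  d := (d b).toAddMonoidHom
  par := par.toRingHom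
  d_mul := d_mul b
  d_d := d_d b
  par_d := par_d b

theorem ext_ev {α : Form E κ} (h : ∀ x, ev x α = 0) : α = 0 := by
  let B := Module.Free.chooseBasis ℂ (Lam κ)
  let BF := B.baseChange (Smo E)
  have hrep : ∀ (β : Form E κ) (x : E) i, (BF.repr β i).1 x = B.repr (ev x β) i := by
    intro β x i
    induction β using TensorProduct.induction_on with
    | zero => simp
    | add a b ha hb =>
      have h1 : BF.repr (a + b) = BF.repr a + BF.repr b := map_add _ _ _
      have h2 : B.repr (ev x (a + b)) = B.repr (ev x a) + B.repr (ev x b) := by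
        rw [map_add, map_add]
      rw [h1, h2, Finsupp.add_apply, Finsupp.add_apply, Smo.add_apply, ha, hb]
    | tmul a y => simp [BF, mul_comm]
  apply BF.repr.injective
  ext i x
  rw [hrep, h, map_zero, map_zero]
  rfl

end Form

/-- Lebesgue measure on the unit cube, a probability measure. -/
noncomputable def cubeMeasure (κ : Type*) [Fintype κ] : Measure (κ → ℝ) :=
  Measure.pi fun _ => volume.restrict (Set.Icc (0 : ℝ) 1)

section Cube
variable {κ : Type*} [Fintype κ]

instance : IsProbabilityMeasure (volume.restrict (Set.Icc (0 : ℝ) 1)) :=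
  ⟨by simp⟩

instance : IsProbabilityMeasure (cubeMeasure κ) := by
  unfold cubeMeasure; infer_instance

theorem integrable_cubeMeasure {V : Type*} [NormedAddCommGroup V] {f : (κ → ℝ) → V}
    (hf : Continuous f) : Integrable f (cubeMeasure κ) := by
  have : cubeMeasure κ = volume.restrict (Set.univ.pi fun _ => Set.Icc (0 : ℝ) 1) := by
    rw [cubeMeasure, volume_pi, Measure.restrict_pi_pi]
  rw [this]
  exact hf.continuousOn.integrableOn_compact (isCompact_univ_pi fun _ => isCompact_Icc)

variable [DecidableEq κ]

theorem measurePreserving_update (l : κ) :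
    MeasurePreserving (fun p : (κ → ℝ) × ℝ => Function.update p.1 l p.2)
      ((cubeMeasure κ).prod (volume.restrict (Set.Icc (0 : ℝ) 1))) (cubeMeasure κ) := by
  have hm : Measurable (fun p : (κ → ℝ) × ℝ => Function.update p.1 l p.2) := by
    refine measurable_pi_iff.2 fun i => ?_
    by_cases h : i = l
    · subst h; simpa using measurable_snd
    · simp only [ne_eq, h, not_false_eq_true, Function.update_of_ne]
      exact (measurable_pi_apply i).comp measurable_fst
  refine ⟨hm, ?_⟩
  refine (Measure.pi_eq (μ := fun _ : κ => volume.restrict (Set.Icc (0 : ℝ) 1)) fun s hs => ?_).symm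
  rw [Measure.map_apply hm (MeasurableSet.univ_pi hs)]
  have : (fun p : (κ → ℝ) × ℝ => Function.update p.1 l p.2) ⁻¹' (Set.univ.pi s)
      = (Set.univ.pi (Function.update s l Set.univ)) ×ˢ (s l) := by
    ext ⟨x, t⟩
    simp only [Set.mem_preimage, Set.mem_pi, Set.mem_univ, true_imp_iff, Set.mem_prod]
    constructor
    · intro h
      refine ⟨fun i => ?_, by simpa using h l⟩
      by_cases hi : i = l
      · subst hi; simp
      · simpa [hi] using h i
    · rintro ⟨h1, h2⟩ i
      by_cases hi : i = l
      · subst hi; simpa using h2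
      · simpa [hi] using h1 i
  rw [this, Measure.prod_prod, cubeMeasure, Measure.pi_pi, ← Finset.mul_prod_erase _ _ (Finset.mem_univ l),
    ← Finset.mul_prod_erase Finset.univ (fun i => (volume.restrict (Set.Icc (0 : ℝ) 1)) (s i))
      (Finset.mem_univ l)]
  simp only [Function.update_self, measure_univ, one_mul]
  rw [mul_comm]
  congr 1
  refine Finset.prod_congr rfl fun i hi => ?_
  rw [Function.update_of_ne (Finset.ne_of_mem_erase hi)]

theorem integral_update (l : κ) {f : (κ → ℝ) → ℂ} (hf : Continuous f) :
    ∫ x, f x ∂cubeMeasure κ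
      = ∫ x, (∫ t in (0 : ℝ)..1, f (Function.update x l t)) ∂cubeMeasure κ := by
  have h1 := measurePreserving_update l
  rw [← h1.map_eq, integral_map h1.measurable.aemeasurable hf.aestronglyMeasurable]
  rw [h1.map_eq, integral_prod]
  · refine integral_congr_ae (.of_forall fun x => ?_)
    simp only []
    rw [intervalIntegral.integral_of_le zero_le_one, ← integral_Icc_eq_integral_Ioc]
  · exact h1.integrable_comp_of_integrable (integrable_cubeMeasure hf)

/-- Forgetting coordinates preserves the measure. -/
theorem measurePreserving_comp {κ' : Type*} [Fintype κ'] [DecidableEq κ'] {g : κ → κ'}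
    (hg : Function.Injective g) :
    MeasurePreserving (fun x : κ' → ℝ => x ∘ g) (cubeMeasure κ') (cubeMeasure κ) := by
  have hm : Measurable (fun x : κ' → ℝ => x ∘ g) :=
    measurable_pi_iff.2 fun i => measurable_pi_apply _
  refine ⟨hm, ?_⟩
  refine (Measure.pi_eq (μ := fun _ : κ => volume.restrict (Set.Icc (0 : ℝ) 1)) fun s hs => ?_).symm
  rw [Measure.map_apply hm (MeasurableSet.univ_pi hs)]
  let s' : κ' → Set ℝ := fun j => ⋂ i, ⋂ (_ : g i = j), s i
  have hs' : ∀ i, s' (g i) = s i := by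
    intro i
    ext t
    simp only [s', Set.mem_iInter]
    exact ⟨fun h => h i rfl, fun h j hj => by rwa [hg hj]⟩
  have : (fun x : κ' → ℝ => x ∘ g) ⁻¹' (Set.univ.pi s) = Set.univ.pi s' := by
    ext x
    simp only [Set.mem_preimage, Set.mem_pi, Set.mem_univ, true_imp_iff, s', Set.mem_iInter]
    exact ⟨fun h j i hi => by rw [← hi]; exact h i, fun h i => h (g i) i rfl⟩
  rw [this, cubeMeasure, Measure.pi_pi]
  rw [← Finset.prod_subset (Finset.subset_univ (Finset.univ.image g)), Finset.prod_image]
  · exact Finset.prod_congr rfl fun i _ => by rw [hs']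
  · exact fun i _ j _ h => hg h
  · intro j _ hj
    have : s' j = Set.univ := by
      refine Set.eq_univ_of_forall fun t => Set.mem_iInter₂.2 fun i hi => ?_
      exact absurd (Finset.mem_image.2 ⟨i, Finset.mem_univ _, hi⟩) hj
    rw [this, measure_univ]

end Cube

section Directions
variable {E κ : Type*} [NormedAddCommGroup E] [NormedSpace ℝ E] [Fintype κ]

/-- The linear map sending the standard basis to `b`. -/
noncomputable def lin (b : κ → E) : (κ → ℝ) →L[ℝ] E :=
  ∑ l, (ContinuousLinearMap.proj (R := ℝ) (φ := fun _ : κ => ℝ) l).smulRight (b l)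

theorem lin_apply (b : κ → E) (x : κ → ℝ) : lin b x = ∑ l, x l • b l := by
  simp [lin]

theorem lin_single [DecidableEq κ] (b : κ → E) (l : κ) (t : ℝ) :
    lin b (Pi.single l t) = t • b l := by
  rw [lin_apply, Finset.sum_eq_single l] <;> simp +contextual

theorem update_eq_add_single [DecidableEq κ] (x : κ → ℝ) (l : κ) (t : ℝ) :
    Function.update x l t = Function.update x l 0 + Pi.single l t := by
  ext i; by_cases h : i = l
  · subst h; simp
  · simp [h]

end Directions

namespace Smo
variable {E κ : Type*} [NormedAddCommGroup E] [NormedSpace ℝ E] [Fintype κ]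

/-- Integral over the parallelotope at `z` spanned by `b`. -/
noncomputable def J (b : κ → E) (z : E) : Smo E →ₗ[ℂ] ℂ where
  toFun a := ∫ x, a.1 (z + lin b x) ∂cubeMeasure κ
  map_add' a c := integral_add
    (integrable_cubeMeasure ((Smo.continuous a).comp (by fun_prop)))
    (integrable_cubeMeasure ((Smo.continuous c).comp (by fun_prop)))
  map_smul' r a := integral_const_mul r _

theorem J_apply (b : κ → E) (z : E) (a : Smo E) :
    J b z a = ∫ x, a.1 (z + lin b x) ∂cubeMeasure κ := rfl

/-- Integral over a face. -/
noncomputable def face [DecidableEq κ] (b : κ → E) (z : E) (l : κ) : Smo E →ₗ[ℂ] ℂ where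
  toFun a := ∫ x, a.1 (z + lin b (Function.update x l 0)) ∂cubeMeasure κ
  map_add' a c := integral_add
    (integrable_cubeMeasure ((Smo.continuous a).comp (by fun_prop)))
    (integrable_cubeMeasure ((Smo.continuous c).comp (by fun_prop)))
  map_smul' r a := integral_const_mul r _

theorem deriv_line (a : Smo E) (z v : E) (t : ℝ) :
    HasDerivAt (fun t : ℝ => a.1 (z + t • v)) ((D v a).1 (z + t • v)) t := by
  have h1 : HasDerivAt (fun t : ℝ => z + t • v) v t := by
    simpa using ((hasDerivAt_id t).smul_const v).const_add z
  exact ((Smo.differentiable a (z + t • v)).hasFDerivAt.comp_hasDerivAt t h1)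

theorem integral_line (a : Smo E) (z v : E) :
    ∫ t in (0 : ℝ)..1, (D v a).1 (z + t • v) = a.1 (z + v) - a.1 z := by
  rw [intervalIntegral.integral_eq_sub_of_hasDerivAt (fun t _ => deriv_line a z v t)]
  · simp
  · exact ((Smo.continuous (D v a)).comp (by fun_prop)).intervalIntegrable _ _

theorem J_D [DecidableEq κ] (b : κ → E) (z : E) (l : κ) (a : Smo E) :
    J b z (D (b l) a) = face b z l (tau (b l) a - a) := by
  rw [J_apply, integral_update l (f := fun x => (D (b l) a).1 (z + lin b x))
    ((Smo.continuous (D (b l) a)).comp (by fun_prop))]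
  refine integral_congr_ae (.of_forall fun x => ?_)
  have : ∀ t : ℝ, z + lin b (Function.update x l t)
      = (z + lin b (Function.update x l 0)) + t • b l := by
    intro t
    rw [update_eq_add_single, map_add, lin_single, add_assoc]
  exact (intervalIntegral.integral_congr fun t _ => congrArg (D (b l) a).1 (this t)).trans
    (integral_line a _ _)

/-- Directions of the cylinder. -/
def cylDir (b : κ → E) (v : E) : Option κ → E := fun o => o.elim v b

theorem J_add [DecidableEq κ] (b : κ → E) (z v : E) (a : Smo E) :
    J b (z + v) a = J b z a + J (cylDir b v) z (D v a) := by
  have h := J_D (cylDir b v) z none a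
  have hf : ∀ c : Smo E, face (cylDir b v) z none c = J b z c := by
    intro c
    have hm := measurePreserving_comp (Option.some_injective κ)
    rw [J_apply, ← hm.map_eq, integral_map (f := fun x => c.1 (z + lin b x))
      hm.measurable.aemeasurable
      ((Smo.continuous c).comp (by fun_prop)).aestronglyMeasurable]
    refine integral_congr_ae (.of_forall fun x => ?_)
    simp only [lin_apply, Fintype.sum_option, cylDir]
    simp
  change J (cylDir b v) z (D v a) = face (cylDir b v) z none (tau v a - a) at h
  rw [h, hf, map_sub, J_apply b z (tau v a), J_apply b (z + v)]
  simp only [tau_apply, add_right_comm _ v]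
  abel

end Smo

namespace Form
variable {E κ : Type*} [NormedAddCommGroup E] [NormedSpace ℝ E] [Fintype κ] [DecidableEq κ]

/-- Fibre integral of a form. -/
noncomputable def I (b : κ → E) (z : E) : Form E κ →ₗ[ℂ] Lam κ := fn (Smo.J b z)

theorem I_tmul (b : κ → E) (z : E) (a : Smo E) (x : Lam κ) :
    I b z (a ⊗ₜ x) = Smo.J b z a • x := fn_tmul _ _ _

/-- Stokes' theorem on the torus. -/
theorem I_d_comp {κ' : Type*} [Fintype κ'] [DecidableEq κ'] (g : κ → κ') (b : κ' → E) (z : E)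
    {η : Form E κ} (hη : ∀ l, tau (b (g l)) η = η) :
    fn (Smo.J b z) (d (b ∘ g) η) = 0 := by
  let T : κ → Form E κ →ₗ[ℂ] Lam κ := fun l =>
    (TensorProduct.lid ℂ (Lam κ)).toLinearMap ∘ₗ
      TensorProduct.map (Smo.face b z (g l)) (LinearMap.mulLeft ℂ (Lam.θ l))
  have key : ∀ η : Form E κ, fn (Smo.J b z) (d (b ∘ g) η) = ∑ l, T l (tau (b (g l)) η - η) := by
    intro η
    induction η using TensorProduct.induction_on with
    | zero => simp
    | add x y hx hy =>
      rw [map_add, map_add, hx, hy, ← Finset.sum_add_distrib]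
      refine Finset.sum_congr rfl fun l _ => ?_
      rw [map_add, ← map_add]
      congr 1; abel
    | tmul a x =>
      rw [d_tmul, map_sum]
      refine Finset.sum_congr rfl fun l _ => ?_
      rw [fn_tmul, Function.comp_apply, Smo.J_D, tau_tmul, ← TensorProduct.sub_tmul]
      simp [T]
  rw [key]
  simp [hη]

theorem I_d (b : κ → E) (z : E) {η : Form E κ} (hη : ∀ l, tau (b l) η = η) :
    I b z (d b η) = 0 := I_d_comp id b z hη

theorem I_add (b : κ → E) (z v : E) (α : Form E κ) :
    I b (z + v) α = I b z α + fn (Smo.J (Smo.cylDir b v) z) (D v α) := by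
  induction α using TensorProduct.induction_on with
  | zero => simp
  | add x y hx hy =>
    simp only [map_add, hx, hy]; abel
  | tmul a x => rw [I_tmul, I_tmul, D_tmul, fn_tmul, Smo.J_add, add_smul]

/-- The periods of a periodic form do not change when its derivative is exact. -/
theorem I_add_of_exact (b : κ → E) (z v : E) {α η : Form E κ} (hα : D v α = d b η)
    (hη : ∀ l, tau (b l) η = η) : I b (z + v) α = I b z α := by
  rw [I_add, hα]
  have := I_d_comp some (Smo.cylDir b v) z hη
  rw [show d b = d (Smo.cylDir b v ∘ some) from rfl, this, add_zero]

end Form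

namespace Smo
variable {E E' : Type*} [NormedAddCommGroup E] [NormedSpace ℝ E]
  [NormedAddCommGroup E'] [NormedSpace ℝ E']

/-- Pullback along an affine map. -/
def aff (z : E) (L : E' →L[ℝ] E) : Smo E →ₐ[ℂ] Smo E' := pull (fun x => z + L x) (by fun_prop)

@[simp] theorem aff_apply (z : E) (L : E' →L[ℝ] E) (a : Smo E) (x : E') :
    (aff z L a).1 x = a.1 (z + L x) := rfl

theorem D_aff (z : E) (L : E' →L[ℝ] E) (v : E') (a : Smo E) :
    D v (aff z L a) = aff z L (D (L v) a) := D_pull_affine L z v a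

theorem tau_eq_aff (v : E) : tau v = aff v (ContinuousLinearMap.id ℝ E) := by
  ext a x; simp [add_comm]

end Smo

namespace Form
variable {E E' κ κ' : Type*} [NormedAddCommGroup E] [NormedSpace ℝ E]
  [NormedAddCommGroup E'] [NormedSpace ℝ E'] [Fintype κ] [DecidableEq κ]

/-- Pullback of coefficients along an affine map. -/
noncomputable def aff (z : E) (L : E' →L[ℝ] E) : Form E κ →ₐ[ℂ] Form E' κ :=
  Algebra.TensorProduct.map (Smo.aff z L) (AlgHom.id ℂ _)

@[simp] theorem aff_tmul (z : E) (L : E' →L[ℝ] E) (a : Smo E) (y : Lam κ) :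
    aff z L (a ⊗ₜ y) = Smo.aff z L a ⊗ₜ y := by simp [aff]

theorem aff_incl (z : E) (L : E' →L[ℝ] E) (a : Smo E) :
    aff z L (incl a : Form E κ) = incl (Smo.aff z L a) := by simp [incl_eq]

theorem tau_eq_aff (v : E) : (tau v : Form E κ →ₐ[ℂ] Form E κ)
    = aff v (ContinuousLinearMap.id ℝ E) := by rw [tau, Smo.tau_eq_aff]; rfl

theorem d_aff (z : E) (L : E' →L[ℝ] E) (b : κ → E') (α : Form E κ) :
    d b (aff z L α) = aff z L (d (L ∘ b) α) := by
  induction α using TensorProduct.induction_on with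
  | zero => simp
  | add x y hx hy => simp only [map_add, hx, hy]
  | tmul a x => simp [d_tmul, Smo.D_aff]

theorem D_aff (z : E) (L : E' →L[ℝ] E) (v : E') (α : Form E κ) :
    D v (aff z L α) = aff z L (D (L v) α) := by
  induction α using TensorProduct.induction_on with
  | zero => simp
  | add x y hx hy => simp only [map_add, hx, hy]
  | tmul a x => simp [D_tmul, Smo.D_aff]

theorem d_tau (v : E) (b : κ → E) (α : Form E κ) : d b (tau v α) = tau v (d b α) := by
  rw [tau_eq_aff, d_aff]; rfl

theorem D_tau (v w : E) (α : Form E κ) : D w (tau v α) = tau v (D w α) := by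
  rw [tau_eq_aff, D_aff]; rfl

theorem fn_aff (z : E) (L : E' →L[ℝ] E) (b : κ' → E') [Fintype κ'] (y : E') (α : Form E κ) :
    fn (Smo.J b y) (aff z L α) = fn (Smo.J (L ∘ b) (z + L y)) α := by
  induction α using TensorProduct.induction_on with
  | zero => simp
  | add x y hx hy => simp only [map_add, hx, hy]
  | tmul a x =>
    rw [aff_tmul, fn_tmul, fn_tmul]
    congr 1
    rw [Smo.J_apply, Smo.J_apply]
    simp [lin_apply, add_assoc]

variable {r s : Type*} [Fintype r] [DecidableEq r] [Fintype s] [DecidableEq s]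

/-- The `k`-th Chern character form of an idempotent matrix of functions. -/
noncomputable def chern (b : κ → E) (e : Matrix r r (Smo E)) (k : ℕ) : Form E κ :=
  (e.map incl * ((e.map incl).map (d b)) ^ (2 * k)).trace

theorem isTracial (b : κ → E) {e : Matrix r r (Smo E)} (he : e * e = e) :
    ((diff b).matrix (r := r)).IsTracial (e.map incl : Matrix r r (Form E κ))
      (Matrix.traceAddMonoidHom r _) := by
  refine GradedDiff.isTracial_matrix _ ?_ (fun i j => ?_) (fun i j x => incl_comm _ _)
  · rw [← AlgHom.mapMatrix_apply, ← map_mul, he]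
  · change par (incl (e i j)) = incl (e i j)
    rw [incl_eq, par_tmul, map_one]

theorem d_chern (b : κ → E) {e : Matrix r r (Smo E)} (he : e * e = e) (k : ℕ) :
    d b (chern b e k) = 0 := by
  have h := (isTracial b he).closed k
  rw [chern]
  exact (AddMonoidHom.map_trace (d b).toAddMonoidHom _).trans h

theorem map_chern {κ' : Type*} [Fintype κ'] [DecidableEq κ'] (b : κ → E) (b' : κ' → E')
    (g : Form E κ →ₐ[ℂ] Form E' κ')
    (hd : ∀ α, g (d b α) = d b' (g α)) (f : Smo E → Smo E') (hf : ∀ a, g (incl a) = incl (f a))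
    (e : Matrix r r (Smo E)) (k : ℕ) : g (chern b e k) = chern b' (e.map f) k := by
  rw [chern, chern, AddMonoidHom.map_trace g, ← AlgHom.mapMatrix_apply g, map_mul, map_pow]
  congr 3
  · ext i j : 2; simp [hf]
  · ext i j : 2; simp [hf, hd]

theorem aff_chern (z : E) (L : E' →L[ℝ] E) (b : κ → E') (e : Matrix r r (Smo E)) (k : ℕ) :
    aff z L (chern (L ∘ b) e k) = chern b (e.map (Smo.aff z L)) k :=
  map_chern _ _ _ (fun α => (d_aff z L b α).symm) _ (fun a => aff_incl z L a) e k

theorem tau_chern (v : E) (b : κ → E) (e : Matrix r r (Smo E)) (k : ℕ) :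
    tau v (chern b e k) = chern b (e.map (Smo.tau v)) k :=
  map_chern _ _ _ (fun α => (d_tau v b α).symm) _ (fun a => by simp [incl_eq]) e k

theorem D_chern (b : κ → E) {e : Matrix r r (Smo E)} (he : e * e = e) (v : E) (k : ℕ) :
    ∃ η : Form E κ, D v (chern b e k) = d b η ∧
      ∀ w, e.map (Smo.tau w) = e → tau w η = η := by
  set X : Matrix r r (Form E κ) := e.map incl with hX
  set DM : Matrix r r (Form E κ) →+ Matrix r r (Form E κ) := (D v).toAddMonoidHom.mapMatrix
  refine ⟨(GradedDiff.xi (diff b).matrix DM X k).trace, ?_, ?_⟩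
  · have h := (isTracial b he).transgression DM
      (fun x y => by
        ext i j
        simp [DM, Matrix.mul_apply, D_mul, Finset.sum_add_distrib])
      (fun x => by ext i j; exact D_d b v (x i j)) k
    rw [chern]
    exact (AddMonoidHom.map_trace (D v).toAddMonoidHom _).trans
      (h.trans (AddMonoidHom.map_trace (d b).toAddMonoidHom _).symm)
  · intro w hw
    have hXw : (tau w).mapMatrix X = X := by
      rw [hX]; nth_rewrite 2 [← hw]; ext i j : 2; simp [incl_eq]
    have hdw : (tau w).mapMatrix ((diff b).matrix.d X) = (diff b).matrix.d X := by
      nth_rewrite 2 [← hXw]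
      ext i j : 2
      exact (d_tau w b (X i j)).symm
    have hDw : (tau w).mapMatrix (DM X) = DM X := by
      nth_rewrite 2 [← hXw]
      ext i j : 2
      exact (D_tau w v (X i j)).symm
    rw [AddMonoidHom.map_trace (tau w), ← AlgHom.mapMatrix_apply, GradedDiff.xi, map_sum]
    congr 1
    refine Finset.sum_congr rfl fun a _ => ?_
    simp only [map_mul, map_pow, map_neg, map_one, hXw, hdw, hDw]

/-- Homotopy invariance of the periods of Chern character forms. -/
theorem I_chern_mul (b : κ → E) (z v : E) {e : Matrix r r (Smo E)} (he : e * e = e)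
    (hp : ∀ l, e.map (Smo.tau (b l)) = e) (k : ℕ) {ψ : Form E κ} (hψ : d b ψ = 0)
    (hψp : ∀ l, tau (b l) ψ = ψ) (hψv : D v ψ = 0) :
    I b (z + v) (chern b e k * ψ) = I b z (chern b e k * ψ) := by
  obtain ⟨η, h1, h2⟩ := D_chern b he v k
  refine I_add_of_exact b z v (η := η * ψ) ?_ fun l => by rw [map_mul, h2 _ (hp l), hψp]
  rw [D_mul, hψv, mul_zero, add_zero, h1, d_mul, hψ, mul_zero, add_zero]

theorem I_chern (b : κ → E) (z v : E) {e : Matrix r r (Smo E)} (he : e * e = e)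
    (hp : ∀ l, e.map (Smo.tau (b l)) = e) (k : ℕ) :
    I b (z + v) (chern b e k) = I b z (chern b e k) := by
  obtain ⟨η, h1, h2⟩ := D_chern b he v k
  exact I_add_of_exact b z v h1 fun l => h2 _ (hp l)

/-! Additivity. -/

theorem chern_fromBlocks (b : κ → E) (e : Matrix r r (Smo E)) (f : Matrix s s (Smo E)) (k : ℕ) :
    chern b (Matrix.fromBlocks e 0 0 f) k = chern b e k + chern b f k := by
  have hpow : ∀ (X : Matrix r r (Form E κ)) (Y : Matrix s s (Form E κ)) (m : ℕ),
      (Matrix.fromBlocks X 0 0 Y) ^ m = Matrix.fromBlocks (X ^ m) 0 0 (Y ^ m) := by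
    intro X Y m
    induction m with
    | zero => simp
    | succ m ih => simp [pow_succ, ih, Matrix.fromBlocks_multiply]
  have hm : (Matrix.fromBlocks e 0 0 f).map (incl (κ := κ))
      = Matrix.fromBlocks (e.map incl) 0 0 (f.map incl) := by
    rw [Matrix.fromBlocks_map]; congr 1 <;> (ext; simp)
  have hd : (Matrix.fromBlocks (e.map (incl (κ := κ))) 0 0 (f.map incl)).map (d b)
      = Matrix.fromBlocks ((e.map incl).map (d b)) 0 0 ((f.map incl).map (d b)) := by
    rw [Matrix.fromBlocks_map]; congr 1 <;> (ext; simp)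
  rw [chern, hm, hd, hpow, Matrix.fromBlocks_multiply]
  simp [chern, Matrix.trace, Matrix.diag]

theorem chern_reindex (b : κ → E) (g : r ≃ s) (e : Matrix r r (Smo E)) (k : ℕ) :
    chern b (Matrix.reindex g g e) k = chern b e k := by
  have hpow : ∀ (X : Matrix r r (Form E κ)) (m : ℕ),
      (Matrix.reindexAlgEquiv ℂ (Form E κ) g X) ^ m = Matrix.reindexAlgEquiv ℂ (Form E κ) g (X ^ m) :=
    fun X m => (map_pow _ _ _).symm
  have h1 : (Matrix.reindex g g e).map (incl (κ := κ))
      = Matrix.reindexAlgEquiv ℂ (Form E κ) g (e.map incl) := rfl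
  have h2 : (Matrix.reindexAlgEquiv ℂ (Form E κ) g (e.map incl)).map (d b)
    = Matrix.reindexAlgEquiv ℂ (Form E κ) g ((e.map incl).map (d b)) := rfl
  rw [chern, h1, h2, hpow, ← map_mul, chern]
  simp [Matrix.trace, Matrix.diag]
  exact Fintype.sum_equiv g.symm _ _ fun i => rfl

end Form

namespace Lam
variable {κ κ' : Type*} [DecidableEq κ] [DecidableEq κ']

/-- The product of the generators along a word. -/
noncomputable def word {m : ℕ} (w : Fin m → κ) : Lam κ := (List.ofFn fun i => θ (w i)).prod

theorem word_cons {m : ℕ} (l : κ) (w : Fin m → κ) :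
    word (Fin.cons l w : Fin (m + 1) → κ) = θ l * word w := by simp [word]

theorem word_eq_zero {m : ℕ} {w : Fin m → κ} (hw : ¬ Function.Injective w) : word w = 0 := by
  have : word w = ExteriorAlgebra.ιMulti ℂ m (fun i => (Pi.single (w i) 1 : κ → ℂ)) := by
    rw [ExteriorAlgebra.ιMulti_apply]; rfl
  rw [this]
  refine AlternatingMap.map_eq_zero_of_not_injective _ _ fun h => hw fun i j hij => h ?_
  simp [hij]

/-- Relabelling of generators. -/
noncomputable def relabel [Fintype κ] (w : κ → κ') : Lam κ →ₐ[ℂ] Lam κ' :=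
  ExteriorAlgebra.map ((Pi.basisFun ℂ κ).constr ℂ fun l => Pi.single (w l) 1)

theorem relabel_θ [Fintype κ] (w : κ → κ') (l : κ) : relabel w (θ l) = θ (w l) := by
  rw [relabel, θ, ExteriorAlgebra.map_apply_ι, θ]
  congr 1
  rw [← Pi.basisFun_apply, Module.Basis.constr_basis]

theorem relabel_word [Fintype κ] (w : κ → κ') {m : ℕ} (u : Fin m → κ) :
    relabel w (word u) = word (w ∘ u) := by
  rw [word, map_list_prod, List.map_ofFn, word]
  congr 2; ext i; simp [relabel_θ]

end Lam

namespace Form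
variable {E E' κ κ' : Type*} [NormedAddCommGroup E] [NormedSpace ℝ E]
  [NormedAddCommGroup E'] [NormedSpace ℝ E'] [Fintype κ] [DecidableEq κ]
variable {r s : Type*} [Fintype r] [DecidableEq r] [Fintype s] [DecidableEq s]

/-- Product of derivatives of a matrix along a word. -/
noncomputable def wordD (b : κ → E) (e : Matrix r r (Smo E)) {m : ℕ} (w : Fin m → κ) :
    Matrix r r (Smo E) := (List.ofFn fun i => e.map (Smo.D (b (w i)))).prod

theorem wordD_cons (b : κ → E) (e : Matrix r r (Smo E)) {m : ℕ} (l : κ) (w : Fin m → κ) :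
    wordD b e (Fin.cons l w : Fin (m + 1) → κ) = e.map (Smo.D (b l)) * wordD b e w := by
  simp [wordD]

theorem map_tmul_mul (X Y : Matrix r r (Smo E)) (x y : Lam κ) :
    X.map (fun a => (a ⊗ₜ x : Form E κ)) * Y.map (fun a => (a ⊗ₜ y : Form E κ))
      = (X * Y).map fun a => (a ⊗ₜ (x * y) : Form E κ) := by
  ext i j : 2
  simp [Matrix.mul_apply, TensorProduct.sum_tmul]

theorem d_pow_eq (b : κ → E) (e : Matrix r r (Smo E)) (m : ℕ) :
    ((e.map (incl (κ := κ))).map (d b)) ^ m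
      = ∑ w : Fin m → κ, (wordD b e w).map fun a => (a ⊗ₜ Lam.word w : Form E κ) := by
  induction m with
  | zero =>
    simp only [pow_zero, Finset.univ_unique, Finset.sum_singleton]
    ext i j : 2
    by_cases h : i = j
    · subst h
      simp only [wordD, Lam.word, List.ofFn_zero, List.prod_nil, Matrix.map_apply,
        Matrix.one_apply_eq]
      rfl
    · simp [wordD, Lam.word, h]
  | succ m ih =>
    have h1 : (e.map (incl (κ := κ))).map (d b)
        = ∑ l, (e.map (Smo.D (b l))).map fun a => (a ⊗ₜ Lam.θ l : Form E κ) := by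
      ext i j : 2
      simp [Matrix.sum_apply, incl_eq, d_tmul]
    rw [pow_succ', ih, h1, Finset.sum_mul_sum, ← (Fin.consEquiv fun _ : Fin (m + 1) => κ).sum_comp,
      Fintype.sum_prod_type]
    refine Finset.sum_congr rfl fun l _ => Finset.sum_congr rfl fun w _ => ?_
    rw [map_tmul_mul]
    simp only [Fin.consEquiv, Equiv.coe_fn_mk]
    rw [wordD_cons, Lam.word_cons]

/-- The coefficient of the Chern character form along a word. -/
noncomputable def coef (b : κ → E) (e : Matrix r r (Smo E)) {m : ℕ} (w : Fin m → κ) : Smo E :=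
  (e * wordD b e w).trace

theorem chern_eq_sum (b : κ → E) (e : Matrix r r (Smo E)) (k : ℕ) :
    chern b e k = ∑ w : Fin (2 * k) → κ, coef b e w ⊗ₜ[ℂ] Lam.word w := by
  rw [chern, d_pow_eq, Finset.mul_sum, Matrix.trace_sum]
  refine Finset.sum_congr rfl fun w _ => ?_
  have : e.map (incl (κ := κ)) = e.map fun a => (a ⊗ₜ 1 : Form E κ) := rfl
  rw [this, map_tmul_mul, one_mul]
  simp [Matrix.trace, coef, TensorProduct.sum_tmul]

theorem chern_eq_zero (b : κ → E) (e : Matrix r r (Smo E)) {k : ℕ} (hk : Fintype.card κ = 2 * k)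
    {l : κ} (hl : e.map (Smo.D (b l)) = 0) : chern b e k = 0 := by
  rw [chern_eq_sum]
  refine Finset.sum_eq_zero fun w _ => ?_
  by_cases hw : Function.Injective w
  · have hb := (Fintype.bijective_iff_injective_and_card w).2 ⟨hw, by simp [hk]⟩
    obtain ⟨i, rfl⟩ := hb.2 l
    have : wordD b e w = 0 := by
      rw [wordD]
      exact List.prod_eq_zero (by rw [List.mem_ofFn]; exact ⟨i, hl⟩)
    simp [coef, this]
  · rw [Lam.word_eq_zero hw, TensorProduct.tmul_zero]

theorem tau_coef (v : E) (b : κ → E) {e : Matrix r r (Smo E)} (he : e.map (Smo.tau v) = e)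
    {m : ℕ} (w : Fin m → κ) : Smo.tau v (coef b e w) = coef b e w := by
  have hD : ∀ u, (Smo.tau v).mapMatrix (e.map (Smo.D u)) = e.map (Smo.D u) := by
    intro u
    nth_rewrite 2 [← he]
    ext i j : 2
    simp only [AlgHom.mapMatrix_apply, Matrix.map_apply, Smo.tau_eq_aff, Smo.D_aff]
    rfl
  rw [coef, AddMonoidHom.map_trace (Smo.tau v), ← AlgHom.mapMatrix_apply, map_mul,
    AlgHom.mapMatrix_apply, he, wordD, map_list_prod, List.map_ofFn]
  congr 4
  ext1 i
  exact hD _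

end Form

/-! Iterated integrals. -/

namespace Smo
variable {E κ κ' : Type*} [NormedAddCommGroup E] [NormedSpace ℝ E] [Fintype κ] [DecidableEq κ]
  [Fintype κ'] [DecidableEq κ']

theorem J_elim (b : κ → E) (b' : κ' → E) (z : E) (a : Smo E) :
    J (Sum.elim b b') z a = ∫ y, J b (z + lin b' y) a ∂cubeMeasure κ' := by
  have hm := measurePreserving_sumPiEquivProdPi_symm
    (X := fun _ : κ ⊕ κ' => ℝ) (fun _ => volume.restrict (Set.Icc (0 : ℝ) 1))
  have hc : Continuous fun p : (κ → ℝ) × (κ' → ℝ) => a.1 (z + lin b' p.2 + lin b p.1) :=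
    (Smo.continuous a).comp (by fun_prop)
  have h1 : J (Sum.elim b b') z a
      = ∫ p, a.1 (z + lin b' p.2 + lin b p.1) ∂((cubeMeasure κ).prod (cubeMeasure κ')) := by
    rw [J_apply]
    rw [cubeMeasure, ← hm.map_eq, integral_map_equiv]
    refine integral_congr_ae (.of_forall fun p => ?_)
    simp only [lin_apply, Fintype.sum_sum_type, MeasurableEquiv.sumPiEquivProdPi]
    simp only [MeasurableEquiv.coe_mk, MeasurableEquiv.symm_mk, Equiv.sumPiEquivProdPi_symm_apply,
      Sum.elim_inl, Sum.elim_inr]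
    abel_nf
  rw [h1, integral_prod_symm]
  · rfl
  · have : (cubeMeasure κ).prod (cubeMeasure κ') = ((volume.restrict (Set.univ.pi fun _ => Set.Icc (0 : ℝ) 1)).prod
      (volume.restrict (Set.univ.pi fun _ => Set.Icc (0 : ℝ) 1))) := by
      simp only [cubeMeasure, volume_pi, Measure.restrict_pi_pi]
    rw [this, Measure.prod_restrict]
    exact hc.continuousOn.integrableOn_compact
      ((isCompact_univ_pi fun _ => isCompact_Icc).prod (isCompact_univ_pi fun _ => isCompact_Icc))

theorem J_elim' (b : κ → E) (b' : κ' → E) (z : E) (a : Smo E) :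
    J (Sum.elim b b') z a = ∫ x, J b' (z + lin b x) a ∂cubeMeasure κ := by
  rw [← J_elim, J_apply, J_apply]
  have hm := measurePreserving_comp (κ := κ' ⊕ κ) (κ' := κ ⊕ κ') (g := Sum.swap)
    Sum.swap_leftInverse.injective
  rw [← hm.map_eq, integral_map (f := fun x => a.1 (z + lin (Sum.elim b' b) x))
    hm.measurable.aemeasurable ((Smo.continuous a).comp (by fun_prop)).aestronglyMeasurable]
  refine integral_congr_ae (.of_forall fun p => ?_)
  simp [lin_apply, Fintype.sum_sum_type, add_comm]

theorem J_add_of_periodic (b : κ → E) (z : E) {a : Smo E} (ha : ∀ l, tau (b l) a = a)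
    (y : κ → ℝ) : J b (z + lin b y) a = J b z a := by
  have h1 : ∀ z (l : κ) (t : ℝ), J b (z + t • b l) a = J b z a := by
    intro z l t
    have hD : D (t • b l) a = t • D (b l) a := by ext x; simp [D_apply]
    have h3 : J (cylDir b (t • b l)) z (D (b l) a)
        = face (cylDir b (t • b l)) z (some l) (tau (b l) a - a) := J_D (cylDir b (t • b l)) z (some l) a
    have hs : (t • D (b l) a) = (t : ℂ) • D (b l) a := by ext x; rfl
    rw [J_add, hD, hs, map_smul, h3, ha]
    simp
  have h2 : ∀ s : Finset κ, J b (z + ∑ l ∈ s, y l • b l) a = J b z a := by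
    intro s
    induction s using Finset.induction_on with
    | empty => simp
    | insert l s hl ih => rw [Finset.sum_insert hl, add_comm (y l • b l), ← add_assoc, h1, ih]
  rw [lin_apply]; exact h2 _

end Smo

namespace Form
variable {E κ κ' κ'' : Type*} [NormedAddCommGroup E] [NormedSpace ℝ E] [Fintype κ] [DecidableEq κ]
  [Fintype κ'] [DecidableEq κ']

theorem fn_elim_eq_zero [DecidableEq κ''] (b : κ → E) (b' : κ' → E) (z : E) {α : Form E κ''}
    (h : ∀ y, fn (Smo.J b (z + lin b' y)) α = 0) : fn (Smo.J (Sum.elim b b') z) α = 0 := by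
  let B := Module.Free.chooseBasis ℂ (Lam κ'')
  let BF := B.baseChange (Smo E)
  have hrep : ∀ (J : Smo E →ₗ[ℂ] ℂ) (β : Form E κ'') i, B.repr (fn J β) i = J (BF.repr β i) := by
    intro J β i
    induction β using TensorProduct.induction_on with
    | zero => simp
    | add a b ha hb =>
      have h1 : BF.repr (a + b) = BF.repr a + BF.repr b := map_add _ _ _
      have h2 : B.repr (fn J (a + b)) = B.repr (fn J a) + B.repr (fn J b) := by
        rw [map_add, map_add]
      rw [h1, h2, Finsupp.add_apply, Finsupp.add_apply, map_add, ha, hb]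
    | tmul a y => simp [BF, mul_comm]
  apply B.repr.injective
  ext i
  rw [hrep, Smo.J_elim]
  simp only [← hrep, h]
  simp

theorem fn_elim_eq_zero' [DecidableEq κ''] (b : κ → E) (b' : κ' → E) (z : E) {α : Form E κ''}
    (h : ∀ y, fn (Smo.J b' (z + lin b y)) α = 0) : fn (Smo.J (Sum.elim b b') z) α = 0 := by
  have : Smo.J (Sum.elim b b') z = Smo.J (Sum.elim b' b) z := by
    ext a; rw [Smo.J_elim', ← Smo.J_elim]
  rw [this]
  exact fn_elim_eq_zero b' b z h

end Form

namespace Form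
variable {E E' E'' κ κ' : Type*} [NormedAddCommGroup E] [NormedSpace ℝ E]
  [NormedAddCommGroup E'] [NormedSpace ℝ E'] [NormedAddCommGroup E''] [NormedSpace ℝ E'']
  [Fintype κ] [DecidableEq κ] [Fintype κ'] [DecidableEq κ']
variable {r : Type*} [Fintype r] [DecidableEq r]

theorem aff_aff (z : E) (L : E' →L[ℝ] E) (z' : E') (L' : E'' →L[ℝ] E') (α : Form E κ) :
    aff z' L' (aff z L α) = aff (z + L z') (L.comp L') α := by
  induction α using TensorProduct.induction_on with
  | zero => simp
  | add x y hx hy => simp only [map_add, hx, hy]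
  | tmul a x =>
    rw [aff_tmul, aff_tmul, aff_tmul]
    congr 1
    ext y
    change a.1 (z + L (z' + L' y)) = a.1 (z + L z' + L (L' y))
    rw [map_add, add_assoc]

theorem tau_aff (z : E) (L : E' →L[ℝ] E) (v : E') (α : Form E κ) :
    tau v (aff z L α) = aff z L (tau (L v) α) := by
  rw [tau_eq_aff, tau_eq_aff, aff_aff, aff_aff]
  congr 1
  rw [add_comm]; rfl

theorem aff_id (α : Form E κ) : aff 0 (ContinuousLinearMap.id ℝ E) α = α := by
  induction α using TensorProduct.induction_on with
  | zero => simp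
  | add x y hx hy => simp only [map_add, hx, hy]
  | tmul a x =>
    rw [aff_tmul]
    congr 1
    ext y
    change a.1 (0 + y) = a.1 y
    rw [zero_add]

theorem fn_mul_aff_zero (J : Smo E' →ₗ[ℂ] ℂ) (z : E) (α : Form E' κ) (ψ : Form E κ) :
    fn J (α * aff z 0 ψ) = fn J α * ev z ψ := by
  induction ψ using TensorProduct.induction_on with
  | zero => simp
  | add x y hx hy => simp only [map_add, mul_add, hx, hy]
  | tmul c y =>
    induction α using TensorProduct.induction_on with
    | zero => simp
    | add x y hx hy => simp only [map_add, add_mul, hx, hy]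
    | tmul a x =>
      rw [aff_tmul, Algebra.TensorProduct.tmul_mul_tmul, fn_tmul, fn_tmul, ev_tmul]
      have : a * Smo.aff z (0 : E' →L[ℝ] E) c = Smo.ev z c • a := by
        ext t
        change a.1 t * c.1 (z + 0) = c.1 z * a.1 t
        rw [add_zero, mul_comm]
      rw [this, map_smul]
      simp [smul_smul]

theorem I_chern_mul_eq_zero (b : κ → E) {e : Matrix r r (Smo E)} (he : e * e = e)
    (hp : ∀ l, e.map (Smo.tau (b l)) = e) {k : ℕ} (h0 : ∀ z, I b z (chern b e k) = 0)
    {ψ : Form E κ} (hψ : d b ψ = 0) (hψp : ∀ l, tau (b l) ψ = ψ) (z : E) :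
    I b z (chern b e k * ψ) = 0 := by
  set L1 : E × E →L[ℝ] E := ContinuousLinearMap.fst ℝ E E + ContinuousLinearMap.snd ℝ E E
  set L2 : E × E →L[ℝ] E := ContinuousLinearMap.fst ℝ E E
  set b2 : κ → E × E := fun l => (b l, 0)
  set b3 : κ → E × E := fun l => (0, b l)
  have hLb1 : L1 ∘ b2 = b := by ext l; simp [L1, b2]
  have hLb2 : L2 ∘ b2 = b := rfl
  set e2 := e.map (Smo.aff 0 L1)
  set ψ2 := aff 0 L2 ψ
  have hα : aff 0 L1 (chern b e k) = chern b2 e2 k := by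
    have := aff_chern 0 L1 b2 e k
    rwa [hLb1] at this
  have he2 : e2 * e2 = e2 := by
    change (Smo.aff 0 L1).mapMatrix e * (Smo.aff 0 L1).mapMatrix e = (Smo.aff 0 L1).mapMatrix e
    rw [← map_mul, he]
  have hp2 : ∀ l, e2.map (Smo.tau (b2 l)) = e2 := by
    intro l
    refine Matrix.ext fun i j => Subtype.ext (funext fun y => ?_)
    have h1 := congrFun (congrArg Subtype.val (congrFun (congrFun (hp l) i) j)) (0 + (y.1 + y.2))
    refine Eq.trans ?_ h1
    change (e i j).1 (0 + ((y + b2 l).1 + (y + b2 l).2)) = (e i j).1 (0 + (y.1 + y.2) + b l)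
    simp only [b2, Prod.fst_add, Prod.snd_add]
    abel_nf
  have hψ2 : d b2 ψ2 = 0 := by rw [d_aff, hLb2, hψ, map_zero]
  have hψp2 : ∀ l, tau (b2 l) ψ2 = ψ2 := by
    intro l
    rw [tau_aff, show L2 (b2 l) = b l from rfl, hψp]
  have hψD : ∀ v, D ((0 : E), v) ψ2 = 0 := by
    intro v
    rw [D_aff, show L2 ((0 : E), v) = 0 from rfl]
    have : D (0 : E) ψ = 0 := by
      apply ext_ev
      intro x
      have : ∀ β : Form E κ, D (0 : E) β = 0 := by
        intro β
        induction β using TensorProduct.induction_on with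
        | zero => simp
        | add x y hx hy => simp only [map_add, hx, hy, add_zero]
        | tmul a x =>
          have h0 : Smo.D (0 : E) a = 0 := by ext x; simp [Smo.D_apply]
          rw [D_tmul, h0, TensorProduct.zero_tmul]
      rw [this, map_zero]
    rw [this, map_zero]
  set β := chern b2 e2 k * ψ2 with hβ
  have hconst : ∀ v, I b2 (z, v) β = I b2 (z, 0) β := by
    intro v
    have := I_chern_mul b2 (z, 0) (0, v) he2 hp2 k hψ2 hψp2 (hψD v)
    simpa using this
  have hC : I b2 (z, 0) β = I b z (chern b e k * ψ) := by
    have h1 := fn_aff (0 : E × E) (ContinuousLinearMap.inl ℝ E E) b z β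
    have h2 : aff (0 : E × E) (ContinuousLinearMap.inl ℝ E E) β = chern b e k * ψ := by
      rw [hβ, map_mul, ← hα, aff_aff, aff_aff]
      congr 1
      · convert aff_id (chern b e k) using 2
        congr 1
        · simp
        · ext; simp [L1]
      · convert aff_id ψ using 2
        congr 1
        simp
    rw [h2] at h1
    rw [I, I, h1, zero_add]
    rfl
  have hlin : ∀ y, ((z, 0) : E × E) + lin b3 y = (z, lin b y) := by
    intro y; simp [lin_apply, b3, Prod.ext_iff, Prod.fst_sum, Prod.snd_sum]
  have hlin2 : ∀ y, ((z, 0) : E × E) + lin b2 y = (z + lin b y, 0) := by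
    intro y; simp [lin_apply, b2, Prod.ext_iff, Prod.fst_sum, Prod.snd_sum]
  set C := I b2 (z, 0) β
  have hJ1 : ∀ {κ'' : Type _} [Fintype κ''] (b'' : κ'' → E × E) z, Smo.J b'' z 1 = 1 := by
    intro κ'' _ b'' z
    rw [Smo.J_apply]; simp
  have hz1 := fn_elim_eq_zero b2 b3 (z, 0) (α := β - 1 ⊗ₜ C) (fun y => by
    rw [hlin, map_sub, fn_tmul, hJ1, one_smul]
    exact sub_eq_zero.2 (hconst _))
  have hz2 := fn_elim_eq_zero' b2 b3 (z, 0) (α := β) (fun y => by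
    rw [hlin2]
    set z' := z + lin b y
    have h1 := fn_aff ((z', 0) : E × E) (ContinuousLinearMap.inr ℝ E E) b 0 β
    have h2 : aff ((z', 0) : E × E) (ContinuousLinearMap.inr ℝ E E) β
        = aff z' (ContinuousLinearMap.id ℝ E) (chern b e k) * aff z' 0 ψ := by
      rw [hβ, map_mul, ← hα, aff_aff, aff_aff]
      congr 2
      congr 1
      · simp [L1]
      · ext; simp [L1]
      · congr 1
        · simp [L2]
    rw [h2, fn_mul_aff_zero, fn_aff] at h1
    have h3 : fn (Smo.J b3 (z', 0)) β = fn (Smo.J (ContinuousLinearMap.inr ℝ E E ∘ b)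
      ((z', 0) + ContinuousLinearMap.inr ℝ E E 0)) β := by
      rw [map_zero, add_zero]
      rfl
    rw [h3, ← h1]
    have h4 := h0 (z' + ContinuousLinearMap.id ℝ E 0)
    rw [I] at h4
    have h5 : (ContinuousLinearMap.id ℝ E ∘ b) = b := rfl
    rw [h5, h4, zero_mul])
  rw [map_sub, hz2, fn_tmul, hJ1, one_smul, zero_sub, neg_eq_zero] at hz1
  rw [← hC, hz1]

theorem I_chern_eq_zero_of_words (b : κ → E) {e : Matrix r r (Smo E)}
    (hp : ∀ l, e.map (Smo.tau (b l)) = e) {k : ℕ}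
    (h : ∀ w : Fin (2 * k) → κ, Function.Injective w → ∀ z, I (b ∘ w) z (chern (b ∘ w) e k) = 0)
    (z : E) : I b z (chern b e k) = 0 := by
  have hper : ∀ w : Fin (2 * k) → κ, ∀ l, Smo.tau (b l) (coef b e w) = coef b e w :=
    fun w l => tau_coef _ _ (hp l) _
  set F : (Fin (2 * k) → κ) → Lam κ := fun w => Smo.J b z (coef b e w) • Lam.word w with hF
  have hsum : I b z (chern b e k) = ∑ w, F w := by
    rw [chern_eq_sum, map_sum]
    exact Finset.sum_congr rfl fun w _ => fn_tmul _ _ _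
  have hF0 : ∀ w, ¬ Function.Injective w → F w = 0 := fun w hw => by
    rw [hF]; simp only [Lam.word_eq_zero hw, smul_zero]
  have hw : ∀ w : Fin (2 * k) → κ, Function.Injective w →
      ∑ u : Fin (2 * k) → Fin (2 * k), F (w ∘ u) = 0 := by
    intro w hw
    have h1 := fn_elim_eq_zero (b ∘ w) b z (α := chern (b ∘ w) e k) (fun y => h w hw _)
    rw [chern_eq_sum, map_sum] at h1
    have h2 := congrArg (Lam.relabel w) h1
    rw [map_sum, map_zero] at h2
    rw [← h2]
    refine Finset.sum_congr rfl fun u _ => ?_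
    rw [fn_tmul, map_smul, Lam.relabel_word, Smo.J_elim']
    have hc : coef (b ∘ w) e u = coef b e (w ∘ u) := rfl
    have h3 : ∀ x, Smo.J b (z + lin (b ∘ w) x) (coef b e (w ∘ u)) = Smo.J b z (coef b e (w ∘ u)) := by
      intro x
      have : lin (b ∘ w) x = lin b (∑ i, Pi.single (w i) (x i)) := by
        rw [map_sum]; simp [lin_apply]
      rw [this]
      exact Smo.J_add_of_periodic b z (hper _) _
    simp only [hc, h3]
    simp [hF]
  have htot : ∑ u : Fin (2 * k) → Fin (2 * k), ∑ w, F (w ∘ u) = 0 := by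
    rw [Finset.sum_comm]
    refine Finset.sum_eq_zero fun w _ => ?_
    by_cases hwi : Function.Injective w
    · exact hw w hwi
    · refine Finset.sum_eq_zero fun u _ => ?_
      by_cases hu : Function.Injective u
      · refine hF0 _ fun hc => hwi ?_
        exact (Function.Injective.of_comp_iff' w (Finite.injective_iff_bijective.1 hu)).1 hc
      · exact hF0 _ fun hc => hu hc.of_comp
  classical
  have h2 : ∀ u : Fin (2 * k) → Fin (2 * k),
      ∑ w, F (w ∘ u) = if Function.Injective u then ∑ w, F w else 0 := by
    intro u
    split_ifs with hu
    · exact ((Equiv.ofBijective u (Finite.injective_iff_bijective.1 hu)).symm.arrowCongr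
        (Equiv.refl κ)).sum_comp F
    · exact Finset.sum_eq_zero fun w _ => hF0 _ fun hc => hu hc.of_comp
  simp only [h2] at htot
  rw [← Finset.sum_filter, Finset.sum_const, ← Nat.cast_smul_eq_nsmul ℂ, smul_eq_zero] at htot
  rw [hsum]
  refine htot.resolve_left ?_
  simp only [Nat.cast_eq_zero, Finset.card_eq_zero]
  exact Finset.Nonempty.ne_empty ⟨id, by simp [Function.injective_id]⟩

end Form

theorem Matrix.exists_factor_of_idempotent {r : Type*} [Fintype r] [DecidableEq r]
    {P : Matrix r r ℂ} (hP : P * P = P) {N : ℕ} (hN : P.trace = N) :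
    ∃ (C : Matrix r (Fin N) ℂ) (D : Matrix (Fin N) r ℂ), D * C = 1 ∧ C * D = P := by
  set f := Matrix.toLin' P with hf
  have hff : IsIdempotentElem f := by
    rw [IsIdempotentElem, hf, Module.End.mul_eq_comp, ← Matrix.toLin'_mul, hP]
  have hproj := LinearMap.IsIdempotentElem.isProj_range f hff
  have htr := hproj.trace
  rw [hf, Matrix.trace_toLin'_eq, hN] at htr
  have hfin : Module.finrank ℂ (LinearMap.range f) = N := by exact_mod_cast htr.symm
  set B : Module.Basis (Fin N) ℂ (LinearMap.range f) := Module.finBasisOfFinrankEq ℂ _ hfin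
  refine ⟨Matrix.of fun i j => (B j : r → ℂ) i,
    LinearMap.toMatrix' (B.equivFun.toLinearMap ∘ₗ f.rangeRestrict), ?_, ?_⟩
  · have h1 : ∀ j, f.rangeRestrict (B j : r → ℂ) = B j := fun j =>
      Subtype.ext (hproj.map_id _ (B j).2)
    have h2 : ∀ j, Matrix.mulVec (LinearMap.toMatrix' (B.equivFun.toLinearMap ∘ₗ f.rangeRestrict))
        (B j : r → ℂ) = Pi.single j 1 := by
      intro j
      rw [LinearMap.toMatrix'_mulVec]
      simp only [LinearMap.comp_apply, h1]
      ext i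
      simp [Pi.single_apply, eq_comm]
    ext i j
    have := congrFun (h2 j) i
    rw [Pi.single_apply] at this
    rw [Matrix.one_apply, ← this]
    rfl
  · apply Matrix.toLin'.injective
    refine LinearMap.ext fun v => ?_
    rw [Matrix.toLin'_mul, LinearMap.comp_apply, Matrix.toLin'_toMatrix', ← hf]
    have h := congrArg (Subtype.val) (B.sum_equivFun (f.rangeRestrict v))
    refine Eq.trans ?_ h
    ext i
    simp [-Module.Basis.sum_repr, Matrix.mulVec, dotProduct,
      mul_comm ((B _ : r → ℂ) i)]

namespace Lam
variable {κ : Type*} [DecidableEq κ] [Fintype κ]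

theorem mem_center_of_par {y : Lam κ} (hy : par y = y) : y ∈ Subalgebra.center ℂ (Lam κ) := by
  rw [Subalgebra.mem_center_iff]
  intro x
  induction x using ExteriorAlgebra.induction with
  | algebraMap r => exact Algebra.commutes r y
  | ι v =>
    have : ExteriorAlgebra.ι ℂ v = ∑ l, v l • θ l := by
      conv_lhs => rw [← Finset.univ_sum_single v]
      rw [map_sum]
      refine Finset.sum_congr rfl fun l _ => ?_
      rw [θ, ← map_smul]
      congr 1
      rw [← Pi.single_smul, smul_eq_mul, mul_one]
    rw [this, Finset.sum_mul, Finset.mul_sum]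
    refine Finset.sum_congr rfl fun l _ => ?_
    rw [smul_mul_assoc, θ_mul, hy, mul_smul_comm]
  | mul a b ha hb => rw [mul_assoc, hb, ← mul_assoc, ha, mul_assoc]
  | add a b ha hb => rw [mul_add, add_mul, ha, hb]

end Lam

theorem Matrix.trace_mul_comm_of_commute {m n R : Type*} [Fintype m] [Fintype n] [Ring R]
    (A : Matrix m n R) (B : Matrix n m R) (h : ∀ i j x, A i j * x = x * A i j) :
    (A * B).trace = (B * A).trace := by
  simp only [Matrix.trace, Matrix.diag, Matrix.mul_apply]
  rw [Finset.sum_comm]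
  exact Finset.sum_congr rfl fun i _ => Finset.sum_congr rfl fun j _ => h _ _ _

/-- Odd exterior matrices compressed by an idempotent of rank `N` satisfy the Newton identities
of `N × N` matrices. -/
theorem newtonCoeff_trace_eq_zero {κ r : Type*} [DecidableEq κ] [Fintype κ] [Fintype r]
    [DecidableEq r] {P : Matrix r r ℂ} (hP : P * P = P) {N : ℕ} (hN : P.trace = N)
    {W : Matrix r r (Lam κ)} (hW : ∀ i j, Lam.par (W i j) = -W i j)
    (hPW : P.map (algebraMap ℂ (Lam κ)) * W = W * (1 - P.map (algebraMap ℂ (Lam κ))))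
    {K : ℕ} (hK : N < K) :
    newtonCoeff (fun k => (P.map (algebraMap ℂ (Lam κ)) * W ^ (2 * k)).trace) K = 0 := by
  obtain ⟨C', D', hDC, hCD⟩ := Matrix.exists_factor_of_idempotent hP hN
  set A := P.map (algebraMap ℂ (Lam κ))
  set C := C'.map (algebraMap ℂ (Lam κ)) with hC
  set D := D'.map (algebraMap ℂ (Lam κ)) with hD
  have hDC1 : D * C = 1 := by rw [hC, hD, ← Matrix.map_mul, hDC]; simp
  have hCD1 : C * D = A := by rw [hC, hD, ← Matrix.map_mul, hCD]
  have hcom : Commute A (W ^ 2) := by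
    have h1 : A * W = W - W * A := by rw [hPW, mul_sub, mul_one]
    rw [Commute, SemiconjBy, sq, ← mul_assoc, h1, sub_mul, mul_assoc W A, h1]
    noncomm_ring
  set X : Matrix (Fin N) (Fin N) (Lam κ) := D * W ^ 2 * C with hX
  have hpow : ∀ k, X ^ k = D * W ^ (2 * k) * C := by
    intro k
    induction k with
    | zero => simp [hDC1]
    | succ k ih =>
      rw [pow_succ, ih, hX]
      calc D * W ^ (2 * k) * C * (D * W ^ 2 * C) = D * W ^ (2 * k) * (A * W ^ 2) * C := by
            rw [← hCD1]; simp only [Matrix.mul_assoc]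
        _ = D * W ^ (2 * k) * W ^ 2 * (C * D * C) := by
            rw [hcom.eq, ← hCD1]; simp only [Matrix.mul_assoc]
        _ = D * W ^ (2 * (k + 1)) * C := by
            rw [Matrix.mul_assoc C, hDC1, Matrix.mul_one, Matrix.mul_assoc D, ← pow_add]; rfl
  have htrace : ∀ k, (A * W ^ (2 * k)).trace = (X ^ k).trace := by
    intro k
    rw [hpow, ← hCD1, Matrix.mul_assoc, Matrix.trace_mul_comm_of_commute]
    exact fun i j x => Algebra.commutes (C' i j) x
  have hpar2 : ∀ i j, Lam.par (X i j) = X i j := by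
    have hWW : Lam.par.mapMatrix (W ^ 2) = W ^ 2 := by
      have : Lam.par.mapMatrix W = -W := by ext i j; simp [hW]
      rw [map_pow, this, neg_sq]
    have hXX : X.map Lam.par = X := by
      rw [hX, Matrix.map_mul, Matrix.map_mul]
      congr 1
      · congr 1
        ext i j : 2
        simp [D]
      · ext i j : 2
        simp [C]
    exact fun i j => congrFun (congrFun hXX i) j
  set X' : Matrix (Fin N) (Fin N) (Subalgebra.center ℂ (Lam κ)) :=
    Matrix.of fun i j => ⟨X i j, Lam.mem_center_of_par (hpar2 i j)⟩ with hX'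
  have hval : ∀ k, (X ^ k).trace = (Subalgebra.center ℂ (Lam κ)).val ((X' ^ k).trace) := by
    intro k
    have h1 : (Subalgebra.center ℂ (Lam κ)).val.mapMatrix X' = X := by ext i j; rfl
    rw [← h1, ← map_pow, AddMonoidHom.map_trace (Subalgebra.center ℂ (Lam κ)).val]; rfl
  simp only [htrace, hval]
  rw [← map_newtonCoeff (Subalgebra.center ℂ (Lam κ)).val]
  have h0 := Matrix.newtonCoeff_eq_zero X' (l := K) (by simpa using hK)
  exact (congrArg (Subalgebra.center ℂ (Lam κ)).val h0).trans (map_zero _)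

namespace Form
variable {E κ : Type*} [NormedAddCommGroup E] [NormedSpace ℝ E] [Fintype κ] [DecidableEq κ]
variable {r : Type*} [Fintype r] [DecidableEq r]

theorem newtonCoeff_chern (b : κ → E) {e : Matrix r r (Smo E)} (he : e * e = e) {N K : ℕ}
    (hN : ∀ x, (e.map (Smo.ev x)).trace = N) (hK : N < K) :
    newtonCoeff (fun k => chern b e k) K = 0 := by
  apply ext_ev
  intro x
  rw [map_newtonCoeff]
  have hP : e.map (Smo.ev x) * e.map (Smo.ev x) = e.map (Smo.ev x) := by
    change (Smo.ev x).mapMatrix e * (Smo.ev x).mapMatrix e = (Smo.ev x).mapMatrix e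
    rw [← map_mul, he]
  have hA : (e.map (incl (κ := κ))).map (ev x)
      = (e.map (Smo.ev x)).map (algebraMap ℂ (Lam κ)) := by
    ext i j : 2
    simp [incl_eq, Algebra.algebraMap_eq_smul_one]
  have h := newtonCoeff_trace_eq_zero (κ := κ) hP (hN x)
    (W := ((e.map (incl (κ := κ))).map (d b)).map (ev x)) (fun i j => by
      simp only [Matrix.map_apply, incl_eq, d_tmul, map_sum, ev_tmul, mul_one, map_smul,
        Lam.par_θ, smul_neg, Finset.sum_neg_distrib])
    (by
      rw [← hA]
      have h3 := congrArg (ev x).mapMatrix (isTracial b he).mul_d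
      rw [map_mul, map_mul, map_sub, map_one] at h3
      exact h3) hK
  refine Eq.trans ?_ h
  congr 1
  ext1 k
  rw [chern, AddMonoidHom.map_trace (ev x), ← AlgHom.mapMatrix_apply, map_mul, map_pow,
    ← hA]
  rfl

theorem I_chern_eq_zero (b : κ → E) {e : Matrix r r (Smo E)} (he : e * e = e)
    (hp : ∀ l, e.map (Smo.tau (b l)) = e) {N K : ℕ}
    (hN : ∀ x, (e.map (Smo.ev x)).trace = N) (hK : N < K)
    (h0 : ∀ k, 1 ≤ k → k < K → ∀ z, I b z (chern b e k) = 0) (z : E) :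
    I b z (chern b e K) = 0 := by
  have hnew := newtonCoeff_chern b he hN hK
  obtain ⟨L, rfl⟩ : ∃ L, K = L + 1 := ⟨K - 1, by omega⟩
  have htau : ∀ l k, tau (b l) (chern b e k) = chern b e k := fun l k => by
    rw [tau_chern, hp]
  have hc : ∀ i, d b (newtonCoeff (fun k => chern b e k) i) = 0 := by
    intro i
    induction i using Nat.strong_induction_on with
    | _ i ih =>
    cases i with
    | zero =>
      rw [newtonCoeff, Algebra.TensorProduct.one_def, d_tmul]
      simp [Smo.D_one]
    | succ i =>
      rw [newtonCoeff, map_neg, map_smul, map_sum]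
      simp only [d_mul, d_chern b he, ih _ (Fin.is_lt _), zero_mul, mul_zero, add_zero,
        Finset.sum_const_zero, smul_zero, neg_zero]
  have hct : ∀ l i, tau (b l) (newtonCoeff (fun k => chern b e k) i)
      = newtonCoeff (fun k => chern b e k) i := by
    intro l i
    rw [map_newtonCoeff]
    simp only [htau]
  rw [newtonCoeff, neg_eq_zero, smul_eq_zero] at hnew
  have h1 := hnew.resolve_left (inv_ne_zero (Nat.cast_add_one_ne_zero L))
  rw [Fin.sum_univ_succ] at h1
  have h2 := congrArg (I b z) h1
  rw [map_add, map_sum, map_zero] at h2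
  have h3 : ∀ i : Fin L, I b z (chern b e (L + 1 - (i.succ : Fin (L + 1)))
      * newtonCoeff (fun k => chern b e k) (i.succ : Fin (L + 1))) = 0 := by
    intro i
    have hi := i.2
    refine I_chern_mul_eq_zero b he hp (h0 _ ?_ ?_) (hc _) (fun l => hct l _) z
    · simp only [Fin.val_succ]; omega
    · simp only [Fin.val_succ]; omega
  rw [Finset.sum_eq_zero fun i _ => h3 i, add_zero] at h2
  simpa [newtonCoeff] using h2

end Form

section Retraction
open Topology Filter

variable {A : Type*} [NormedRing A] [NormedAlgebra ℝ A] [CompleteSpace A]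

theorem exists_smooth_sqrt_near_one :
    ∃ (r : A → A), ContDiffAt ℝ ω r 1 ∧ r 1 = 1 ∧ (∀ᶠ u in 𝓝 (1 : A), r u * r u = u) ∧
      ∀ᶠ u in 𝓝 (1 : A), ∀ a, Commute a u → Commute a (r u) := by
  have hf : ContDiffAt ℝ ω (fun x : A => x * x) 1 := contDiffAt_id.mul contDiffAt_id
  let f' : A ≃L[ℝ] A := ContinuousLinearEquiv.smulLeft (Units.mk0 (2 : ℝ) two_ne_zero)
  have hf' : HasFDerivAt (fun x : A => x * x) (f' : A →L[ℝ] A) 1 := by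
    have := (hasFDerivAt_id (𝕜 := ℝ) (1 : A)).mul' (hasFDerivAt_id (𝕜 := ℝ) (1 : A))
    refine this.congr_fderiv ?_
    ext x
    simp [f', two_smul, Units.smul_def]
  have hn : (ω : WithTop ℕ∞) ≠ 0 := by simp
  set h := hf.toOpenPartialHomeomorph _ hf' hn with hh
  have hcoe : ∀ x, h x = x * x := fun x => by rw [hh, ContDiffAt.toOpenPartialHomeomorph_coe]
  have h1 : (1 : A) ∈ h.source := hf.mem_toOpenPartialHomeomorph_source hf' hn
  have h1' : (1 : A) ∈ h.target := by simpa [hcoe] using h.map_source h1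
  have hr1 : h.symm 1 = 1 := by simpa [hcoe] using h.left_inv h1
  refine ⟨h.symm, ?_, hr1, ?_, ?_⟩
  · have := hf.to_localInverse hf' hn
    rw [mul_one] at this
    exact this
  · filter_upwards [h.open_target.mem_nhds h1'] with u hu
    simpa [hcoe] using h.right_inv hu
  · filter_upwards [h.open_target.mem_nhds h1'] with u hu a hau
    have hsq : h.symm u * h.symm u = u := by simpa [hcoe] using h.right_inv hu
    have hcont : ContinuousAt
        (fun ε : ℝ => (1 + ε • a) * h.symm u * Ring.inverse (1 + ε • a)) 0 := by
      have hl : ContinuousAt (fun ε : ℝ => 1 + ε • a) 0 := by fun_prop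
      refine (hl.mul continuousAt_const).mul ?_
      have : ContinuousAt Ring.inverse ((1 : A) + (0 : ℝ) • a) := by
        simpa using NormedRing.inverse_continuousAt (1 : Aˣ)
      exact ContinuousAt.comp (f := fun ε : ℝ => 1 + ε • a) this hl
    have hev1 : ∀ᶠ ε : ℝ in 𝓝 0, (1 + ε • a) * h.symm u * Ring.inverse (1 + ε • a) ∈ h.source := by
      refine hcont.eventually (h.open_source.mem_nhds ?_)
      simpa using h.map_target hu
    have hev2 : ∀ᶠ ε : ℝ in 𝓝 0, IsUnit (1 + ε • a) := by
      have hl : ContinuousAt (fun ε : ℝ => 1 + ε • a) 0 := by fun_prop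
      refine hl.eventually ?_
      simpa [Filter.Eventually] using Units.nhds (1 : Aˣ)
    obtain ⟨ε, ⟨hε1, hε2⟩, hε0⟩ :=
      (((hev1.and hev2).filter_mono nhdsWithin_le_nhds).and
        (self_mem_nhdsWithin : ({0}ᶜ : Set ℝ) ∈ 𝓝[≠] 0)).exists
    have hc : Commute (1 + ε • a) u := (Commute.one_left u).add_left (hau.smul_left ε)
    have heq : (1 + ε • a) * h.symm u * Ring.inverse (1 + ε • a) = h.symm u := by
      refine h.injOn hε1 (h.map_target hu) ?_
      rw [hcoe, hcoe, hsq]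
      have h3 := Ring.inverse_mul_cancel _ hε2
      calc (1 + ε • a) * h.symm u * Ring.inverse (1 + ε • a) *
            ((1 + ε • a) * h.symm u * Ring.inverse (1 + ε • a))
          = (1 + ε • a) * h.symm u * (Ring.inverse (1 + ε • a) * (1 + ε • a)) * h.symm u *
            Ring.inverse (1 + ε • a) := by simp only [mul_assoc]
        _ = (1 + ε • a) * (h.symm u * h.symm u) * Ring.inverse (1 + ε • a) := by
            rw [h3]; simp only [mul_assoc, mul_one]
        _ = u * ((1 + ε • a) * Ring.inverse (1 + ε • a)) := by rw [hsq, hc.eq, mul_assoc]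
        _ = u := by rw [Ring.mul_inverse_cancel _ hε2, mul_one]
    have h4 : (1 + ε • a) * h.symm u = h.symm u * (1 + ε • a) := by
      calc _ = (1 + ε • a) * h.symm u * Ring.inverse (1 + ε • a) * (1 + ε • a) := by
            rw [mul_assoc _ (Ring.inverse _), Ring.inverse_mul_cancel _ hε2, mul_one]
        _ = _ := by rw [heq]
    rw [add_mul, mul_add, one_mul, mul_one, add_right_inj, smul_mul_assoc, mul_smul_comm] at h4
    exact smul_right_injective A (by simpa using hε0) h4

theorem exists_retraction_idempotents : ∃ (U : Set A) (Φ : A → A), IsOpen U ∧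
    ContDiffOn ℝ ∞ Φ U ∧ (∀ a ∈ U, Φ a * Φ a = Φ a) ∧ ∀ e, e * e = e → e ∈ U ∧ Φ e = e := by
  obtain ⟨r, hr, hr1, hsq, hcomm⟩ := exists_smooth_sqrt_near_one (A := A)
  have hra : ∀ᶠ u in 𝓝 (1 : A), ContDiffAt ℝ ∞ r u :=
    (hr.analyticAt.eventually_analyticAt).mono fun u hu => hu.contDiffAt
  have hinv : ContinuousAt Ring.inverse (1 : A) := by
    simpa using NormedRing.inverse_continuousAt (1 : Aˣ)
  have htend : Tendsto Ring.inverse (𝓝 (1 : A)) (𝓝 1) := by simpa using hinv.tendsto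
  have hunit : ∀ᶠ u in 𝓝 (1 : A), IsUnit u := by
    simpa [Filter.Eventually] using Units.nhds (1 : Aˣ)
  obtain ⟨O, hO, hOo, hO1⟩ := eventually_nhds_iff.1
    (hunit.and (htend.eventually (hsq.and (hcomm.and hra))))
  have key : ∀ e : A, e * e = e → ((2 : ℝ) • e - 1) * ((2 : ℝ) • e - 1) = 1 := by
    intro e he
    rw [mul_sub, sub_mul, sub_mul, smul_mul_smul_comm, he, one_mul, mul_one, mul_one]
    module
  refine ⟨{a | ((2 : ℝ) • a - 1) * ((2 : ℝ) • a - 1) ∈ O}, fun a => (1 / 2 : ℝ) •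
    (1 + ((2 : ℝ) • a - 1) * r (Ring.inverse (((2 : ℝ) • a - 1) * ((2 : ℝ) • a - 1)))),
    hOo.preimage (by fun_prop), ?_, ?_, ?_⟩
  · intro a ha
    obtain ⟨⟨y, hy⟩, -, -, hc⟩ := hO _ ha
    have hp : ContDiffAt ℝ ∞ (fun a : A => (2 : ℝ) • a - 1) a := by fun_prop
    have hi : ContDiffAt ℝ ∞ Ring.inverse (((2 : ℝ) • a - 1) * ((2 : ℝ) • a - 1)) := by
      rw [← hy]; exact contDiffAt_ringInverse ℝ y
    have h1 := ContDiffAt.comp (f := fun a : A => ((2 : ℝ) • a - 1) * ((2 : ℝ) • a - 1)) a hi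
      (hp.mul hp)
    have h2 := ContDiffAt.comp a (g := r) hc h1
    exact ((contDiffAt_const.add (hp.mul h2)).const_smul _).contDiffWithinAt
  · intro a ha
    obtain ⟨hu, hs, hc, -⟩ := hO _ ha
    set b := (2 : ℝ) • a - 1
    set t := r (Ring.inverse (b * b))
    have hbt : Commute b t := by
      refine hc b ?_
      obtain ⟨y, hy⟩ := hu
      rw [← hy, Ring.inverse_unit]
      refine Commute.units_inv_right ?_
      rw [hy]
      exact (Commute.refl b).mul_right (Commute.refl b)
    have hF : b * t * (b * t) = 1 := by
      rw [Commute.mul_mul_mul_comm hbt.symm, hs, Ring.mul_inverse_cancel _ hu]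
    simp only
    rw [smul_mul_smul_comm, add_mul, mul_add, mul_add, hF, one_mul, one_mul, mul_one]
    module
  · intro e he
    refine ⟨by simpa [key e he] using hO1, ?_⟩
    simp only [key e he, Ring.inverse_one, hr1, mul_one]
    module

end Retraction

section MatrixRetraction
attribute [local instance] Matrix.linftyOpNormedRing Matrix.linftyOpNormedAlgebra

variable {r : Type*} [Fintype r] [DecidableEq r]

theorem Matrix.exists_retraction_idempotents : ∃ (U : Set (Matrix r r ℂ))
    (Φ : Matrix r r ℂ → Matrix r r ℂ), @IsOpen _ instTopologicalSpaceMatrix U ∧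
    (@ContinuousOn _ _ instTopologicalSpaceMatrix instTopologicalSpaceMatrix Φ U) ∧
    (∀ a ∈ U, Φ a * Φ a = Φ a) ∧ (∀ e, e * e = e → e ∈ U ∧ Φ e = e) ∧
    ∀ {E : Type} [NormedAddCommGroup E] [NormedSpace ℝ E] (a : E → Matrix r r ℂ),
      (∀ i j, ContDiff ℝ ∞ fun x => a x i j) → (∀ x, a x ∈ U) →
      ∀ i j, ContDiff ℝ ∞ fun x => Φ (a x) i j := by
  obtain ⟨U, Φ, hU, hΦ, h1, h2⟩ := _root_.exists_retraction_idempotents (A := Matrix r r ℂ)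
  refine ⟨U, Φ, hU, hΦ.continuousOn, h1, h2, ?_⟩
  intro E _ _ a ha haU i j
  have hs : ContDiff ℝ ∞ a := by
    have : a = fun x => ∑ i, ∑ j, a x i j • Matrix.single i j (1 : ℂ) := by
      funext x
      conv_lhs => rw [Matrix.matrix_eq_sum_single (a x)]
      simp
    rw [this]
    refine ContDiff.sum fun i _ => ContDiff.sum fun j _ => (ha i j).smul contDiff_const
  let L : Matrix r r ℂ →ₗ[ℝ] ℂ := { toFun := fun m => m i j, map_add' := fun _ _ => rfl, map_smul' := fun _ _ => rfl }
  have hL : ContDiff ℝ ∞ L := (LinearMap.toContinuousLinearMap L).contDiff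
  exact hL.comp (hΦ.comp_contDiff hs haU)

end MatrixRetraction

section PeriodicIdempotents
open Topology Filter

variable {κ : Type} [Fintype κ] [DecidableEq κ] {r : Type} [Fintype r] [DecidableEq r]

/-- Invariance under integral translations. -/
def IntPeriodic {X : Type*} (f : (κ → ℝ) → X) : Prop :=
  ∀ (x : κ → ℝ) (m : κ → ℤ), f (x + fun l => (m l : ℝ)) = f x

/-- Continuous idempotent matrices on the torus. -/
structure CIdem (e : (κ → ℝ) → Matrix r r ℂ) : Prop where
  cont : Continuous e
  idem : ∀ x, e x * e x = e x
  per : IntPeriodic e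

theorem IntPeriodic.exists_cube {X : Type*} {f : (κ → ℝ) → X} (hf : IntPeriodic f) (x : κ → ℝ) :
    ∃ m : κ → ℤ, (x + fun l => (m l : ℝ)) ∈ Set.Icc (0 : κ → ℝ) 1 ∧
      f (x + fun l => (m l : ℝ)) = f x := by
  refine ⟨fun l => -⌊x l⌋, ⟨fun l => ?_, fun l => ?_⟩, hf _ _⟩
  · simp [← sub_eq_add_neg]
  · simpa [← sub_eq_add_neg] using (Int.fract_lt_one (x l)).le

theorem IntPeriodic.uniform {f : (κ → ℝ) → ℂ} (hf : IntPeriodic f) (hc : Continuous f) {ε : ℝ}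
    (hε : 0 < ε) : ∃ δ > 0, ∀ x y, dist x y < δ → dist (f x) (f y) < ε := by
  have hK : IsCompact (Set.Icc (0 : κ → ℝ) 1) := isCompact_Icc
  obtain ⟨δ, hδ, h⟩ := Metric.mem_uniformity_dist.1
    (hK.uniformContinuousAt_of_continuousAt f (fun a _ => hc.continuousAt)
      (Metric.dist_mem_uniformity hε))
  refine ⟨δ, hδ, fun x y hxy => ?_⟩
  obtain ⟨m, hm, hfm⟩ := hf.exists_cube x
  rw [← hfm, ← hf y m]
  exact h (by simpa using hxy) hm

theorem IntPeriodic.exists_smooth_approx {f : (κ → ℝ) → ℂ} (hf : IntPeriodic f)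
    (hc : Continuous f) {ε : ℝ} (hε : 0 < ε) :
    ∃ g : (κ → ℝ) → ℂ, ContDiff ℝ ∞ g ∧ (∀ x, ‖g x - f x‖ < ε) ∧
      ∀ v, (∀ x, f (x + v) = f x) → ∀ x, g (x + v) = g x := by
  obtain ⟨δ, hδ, h⟩ := hf.uniform hc (half_pos hε)
  let φ : ContDiffBump (0 : κ → ℝ) := ⟨δ / 2, δ, half_pos hδ, half_lt_self hδ⟩
  refine ⟨convolution (φ.normed volume) f (ContinuousLinearMap.lsmul ℝ ℝ) volume, ?_, ?_, ?_⟩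
  · exact φ.hasCompactSupport_normed.contDiff_convolution_left (n := ⊤) _ φ.contDiff_normed
      hc.locallyIntegrable
  · intro x
    rw [← dist_eq_norm]
    refine lt_of_le_of_lt (φ.dist_normed_convolution_le (μ := volume) hc.aestronglyMeasurable ?_)
      (half_lt_self hε)
    intro y hy
    exact (h y x hy).le
  · intro v hv x
    rw [convolution_def, convolution_def]
    congr 1
    funext t
    rw [add_sub_right_comm, hv]

/-- A smooth idempotent on the torus, close to a given function. -/
structure Smooths (ε : ℝ) (e : (κ → ℝ) → Matrix r r ℂ) (a : Matrix r r (Smo (κ → ℝ))) : Prop where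
  idem : a * a = a
  per : ∀ m : κ → ℤ, a.map (Smo.tau fun l => (m l : ℝ)) = a
  close : ∀ x i j, ‖(a i j).1 x - e x i j‖ < ε

theorem Smooths.mono {ε ε' : ℝ} {e : (κ → ℝ) → Matrix r r ℂ} {a : Matrix r r (Smo (κ → ℝ))}
    (h : Smooths ε e a) (hε : ε ≤ ε') : Smooths ε' e a :=
  ⟨h.idem, h.per, fun x i j => (h.close x i j).trans_le hε⟩

theorem Smooths.trans {ε ε' : ℝ} {e e' : (κ → ℝ) → Matrix r r ℂ} {a : Matrix r r (Smo (κ → ℝ))}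
    (h : Smooths ε e a) (h' : ∀ x i j, ‖e x i j - e' x i j‖ < ε') : Smooths (ε + ε') e' a :=
  ⟨h.idem, h.per, fun x i j => by
    have := norm_add_le ((a i j).1 x - e x i j) (e x i j - e' x i j)
    rw [sub_add_sub_cancel] at this
    exact this.trans_lt (add_lt_add (h.close x i j) (h' x i j))⟩

theorem CIdem.isCompact_range {e : (κ → ℝ) → Matrix r r ℂ} (he : CIdem e) :
    IsCompact (Set.range e) := by
  have : Set.range e = e '' Set.Icc 0 1 := by
    refine Set.Subset.antisymm ?_ (Set.image_subset_range _ _)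
    rintro _ ⟨x, rfl⟩
    obtain ⟨m, hm, h⟩ := he.per.exists_cube x
    exact ⟨_, hm, h⟩
  rw [this]
  exact isCompact_Icc.image he.cont

theorem CIdem.exists_tube {e : (κ → ℝ) → Matrix r r ℂ} (he : CIdem e) {U : Set (Matrix r r ℂ)}
    (hU : IsOpen U) (heU : ∀ x, e x ∈ U) :
    ∃ δ > 0, ∀ x (m : Matrix r r ℂ), (∀ i j, ‖m i j - e x i j‖ < δ) → m ∈ U := by
  obtain ⟨δ, hδ, h⟩ := IsCompact.exists_thickening_subset_open (α := r → r → ℂ)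
    (s := Set.range e) (t := U) he.isCompact_range hU (Set.range_subset_iff.2 heU)
  refine ⟨δ, hδ, fun x m hm => h ?_⟩
  refine (Metric.mem_thickening_iff (X := r → r → ℂ)).2 ⟨e x, ⟨x, rfl⟩, ?_⟩
  exact (dist_pi_lt_iff hδ).2 fun i => (dist_pi_lt_iff hδ).2 fun j => by
    rw [dist_eq_norm]; exact hm i j

theorem CIdem.exists_close {e : (κ → ℝ) → Matrix r r ℂ} (he : CIdem e)
    {Φ : Matrix r r ℂ → Matrix r r ℂ} (hΦ : ∀ x, ContinuousAt Φ (e x)) {ε : ℝ} (hε : 0 < ε) :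
    ∃ δ > 0, ∀ x (m : Matrix r r ℂ), (∀ i j, ‖m i j - e x i j‖ < δ) →
      ∀ i j, ‖Φ m i j - Φ (e x) i j‖ < ε := by
  obtain ⟨δ, hδ, h⟩ := Metric.mem_uniformity_dist.1
    (IsCompact.uniformContinuousAt_of_continuousAt (α := r → r → ℂ) (β := r → r → ℂ)
      (s := Set.range e) he.isCompact_range Φ (by rintro _ ⟨x, rfl⟩; exact hΦ x)
      (Metric.dist_mem_uniformity hε))
  refine ⟨δ, hδ, fun x m hm i j => ?_⟩
  have h1 : dist (α := r → r → ℂ) (e x) m < δ :=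
    (dist_pi_lt_iff hδ).2 fun i => (dist_pi_lt_iff hδ).2 fun j => by
      rw [dist_comm, dist_eq_norm]; exact hm i j
  have h2 : dist (α := r → r → ℂ) (Φ (e x)) (Φ m) < ε := h h1 ⟨x, rfl⟩
  have h3 := (dist_pi_lt_iff hε).1 ((dist_pi_lt_iff hε).1 h2 i) j
  rwa [dist_comm, dist_eq_norm] at h3

theorem CIdem.exists_smooths {e : (κ → ℝ) → Matrix r r ℂ} (he : CIdem e) {ε : ℝ} (hε : 0 < ε) :
    ∃ a, Smooths ε e a ∧ ∀ v, (∀ x, e (x + v) = e x) → a.map (Smo.tau v) = a := by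
  obtain ⟨U, Φ, hU, hΦc, hΦ, hΦe, hΦs⟩ := Matrix.exists_retraction_idempotents (r := r)
  obtain ⟨δ₁, hδ₁, h₁⟩ := he.exists_tube hU fun x => (hΦe _ (he.idem x)).1
  obtain ⟨δ₂, hδ₂, h₂⟩ := he.exists_close (Φ := Φ)
    (fun x => hΦc.continuousAt (hU.mem_nhds (hΦe _ (he.idem x)).1)) hε
  have hper : ∀ i j, IntPeriodic fun x => e x i j := fun i j x m => by
    simp only [he.per x m]
  have hcont : ∀ i j, Continuous fun x => e x i j := fun i j => he.cont.matrix_elem i j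
  choose g hg hgc hgi using fun i j =>
    (hper i j).exists_smooth_approx (hcont i j) (lt_min hδ₁ hδ₂)
  let G : (κ → ℝ) → Matrix r r ℂ := fun x => Matrix.of fun i j => g i j x
  have hGU : ∀ x, G x ∈ U := fun x => h₁ x _ fun i j => (hgc i j x).trans_le (min_le_left _ _)
  have hGs := hΦs G (fun i j => hg i j) hGU
  have hinv : ∀ v, (∀ x, e (x + v) = e x) →
      (Matrix.of fun i j => (⟨fun x => Φ (G x) i j, hGs i j⟩ : Smo (κ → ℝ))).map (Smo.tau v)
        = Matrix.of fun i j => ⟨fun x => Φ (G x) i j, hGs i j⟩ := by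
    intro v hv
    refine Matrix.ext fun i j => Subtype.ext (funext fun x => ?_)
    change Φ (G (x + v)) i j = Φ (G x) i j
    have : G (x + v) = G x := Matrix.ext fun i j => hgi i j v (fun x => by rw [hv]) x
    rw [this]
  refine ⟨Matrix.of fun i j => ⟨fun x => Φ (G x) i j, hGs i j⟩,
    ⟨?_, fun m => hinv _ fun x => he.per x m, ?_⟩, hinv⟩
  · refine Matrix.ext fun i j => Subtype.ext (funext fun x => ?_)
    have := congrFun (congrFun (hΦ _ (hGU x)) i) j
    rw [Matrix.mul_apply] at this ⊢
    change Smo.ev x (∑ l, _) = _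
    rw [map_sum]
    exact this
  · intro x i j
    have := h₂ x (G x) (fun i j => (hgc i j x).trans_le (min_le_right _ _)) i j
    rwa [(hΦe _ (he.idem x)).2] at this

end PeriodicIdempotents

theorem Form.I_chern_aff {E E' κ : Type*} [NormedAddCommGroup E] [NormedSpace ℝ E]
    [NormedAddCommGroup E'] [NormedSpace ℝ E'] [Fintype κ] [DecidableEq κ]
    {r : Type*} [Fintype r] [DecidableEq r] (z : E) (L : E' →L[ℝ] E) (b : κ → E') (y : E')
    (e : Matrix r r (Smo E)) (k : ℕ) :
    I b y (chern b (e.map (Smo.aff z L)) k) = I (L ∘ b) (z + L y) (chern (L ∘ b) e k) := by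
  rw [← aff_chern, I, fn_aff]; rfl

section ChernNumber
open Topology Filter

/-- The standard basis. -/
def stdDir (κ : Type) [DecidableEq κ] : κ → κ → ℝ := fun l => Pi.single l 1

variable {κ : Type} [Fintype κ] [DecidableEq κ] {r : Type} [Fintype r] [DecidableEq r]

theorem stdDir_eq_cast (l : κ) :
    stdDir κ l = fun l' => (((Pi.single l 1 : κ → ℤ) l' : ℤ) : ℝ) := by
  funext l'
  simp [stdDir, Pi.single_apply]

theorem lin_comp_stdDir {E : Type*} [NormedAddCommGroup E] [NormedSpace ℝ E] (b : κ → E) :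
    lin b ∘ stdDir κ = b := by
  funext l
  simp [stdDir, lin_single]

/-- The Chern numbers of a smooth idempotent on the torus. -/
noncomputable def chernNumber (a : Matrix r r (Smo (κ → ℝ))) (k : ℕ) : Lam κ :=
  Form.I (stdDir κ) 0 (Form.chern (stdDir κ) a k)

theorem Smooths.per_std {ε : ℝ} {e : (κ → ℝ) → Matrix r r ℂ} {a : Matrix r r (Smo (κ → ℝ))}
    (h : Smooths ε e a) (l : κ) : a.map (Smo.tau (stdDir κ l)) = a := by
  rw [stdDir_eq_cast]; exact h.per _

theorem Matrix.smo_mul_self {E : Type*} [NormedAddCommGroup E] [NormedSpace ℝ E]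
    {a : Matrix r r (Smo E)} :
    a * a = a ↔ ∀ x, a.map (Smo.ev x) * a.map (Smo.ev x) = a.map (Smo.ev x) := by
  constructor
  · intro h x
    rw [← AlgHom.mapMatrix_apply, ← map_mul, h]
  · intro h
    refine Matrix.ext fun i j => Subtype.ext (funext fun x => ?_)
    have h1 := h x
    rw [← AlgHom.mapMatrix_apply, ← map_mul] at h1
    exact congrFun (congrFun h1 i) j

theorem CIdem.exists_chernNumber_eq {e : (κ → ℝ) → Matrix r r ℂ} (he : CIdem e) (k : ℕ) :
    ∃ δ > 0, ∀ a b, Smooths δ e a → Smooths δ e b → chernNumber a k = chernNumber b k := by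
  obtain ⟨U, Φ, hU, hΦc, hΦ, hΦe, hΦs⟩ := Matrix.exists_retraction_idempotents (r := r)
  obtain ⟨δ, hδ, h⟩ := he.exists_tube hU fun x => (hΦe _ (he.idem x)).1
  refine ⟨δ, hδ, fun a b ha hb => ?_⟩
  let G : (κ → ℝ) × ℝ → Matrix r r ℂ := fun p =>
    Matrix.of fun i j => (a i j).1 p.1 +
      (Real.smoothTransition p.2 : ℂ) * ((b i j).1 p.1 - (a i j).1 p.1)
  have hGU : ∀ p, G p ∈ U := by
    intro p
    refine h p.1 _ fun i j => ?_
    have h0 := Real.smoothTransition.nonneg p.2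
    have h1 := Real.smoothTransition.le_one p.2
    have := (convex_ball (e p.1 i j) δ).add_smul_sub_mem
      (x := (a i j).1 p.1) (y := (b i j).1 p.1)
      (by rw [Metric.mem_ball, dist_eq_norm]; exact ha.close p.1 i j)
      (by rw [Metric.mem_ball, dist_eq_norm]; exact hb.close p.1 i j) ⟨h0, h1⟩
    rw [Metric.mem_ball, dist_eq_norm, Complex.real_smul] at this
    exact this
  have hGs : ∀ i j, ContDiff ℝ ∞ fun p => G p i j := by
    intro i j
    have h1 : ContDiff ℝ ∞ fun p : (κ → ℝ) × ℝ => (a i j).1 p.1 := (Smo.contDiff (a i j)).comp contDiff_fst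
    have h2 : ContDiff ℝ ∞ fun p : (κ → ℝ) × ℝ => (b i j).1 p.1 := (Smo.contDiff (b i j)).comp contDiff_fst
    have h3 : ContDiff ℝ ∞ fun p : (κ → ℝ) × ℝ => (Real.smoothTransition p.2 : ℂ) :=
      Complex.ofRealCLM.contDiff.comp (Real.smoothTransition.contDiff.comp contDiff_snd)
    exact h1.add (h3.mul (h2.sub h1))
  let c : Matrix r r (Smo ((κ → ℝ) × ℝ)) :=
    Matrix.of fun i j => ⟨fun p => Φ (G p) i j, hΦs G hGs hGU i j⟩
  have hcc : c * c = c := Matrix.smo_mul_self.2 fun p => hΦ _ (hGU p)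
  let L : (κ → ℝ) →L[ℝ] (κ → ℝ) × ℝ := ContinuousLinearMap.inl ℝ _ _
  have hcp : ∀ l, c.map (Smo.tau ((L ∘ stdDir κ) l)) = c := by
    intro l
    refine Matrix.ext fun i j => Subtype.ext (funext fun p => ?_)
    change Φ (G (p + (stdDir κ l, 0))) i j = Φ (G p) i j
    have : G (p + (stdDir κ l, 0)) = G p := by
      ext i j
      have h1 := congrArg (fun m => (m i j).1 p.1) (ha.per_std l)
      have h2 := congrArg (fun m => (m i j).1 p.1) (hb.per_std l)
      simp only [Matrix.map_apply, Smo.tau_apply] at h1 h2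
      simp [G, h1, h2]
    rw [this]
  have key := Form.I_chern (L ∘ stdDir κ) 0 (0, 1) hcc hcp k
  have idem : ∀ {a : Matrix r r (Smo (κ → ℝ))}, a * a = a → ∀ x,
      Φ (a.map (Smo.ev x)) = a.map (Smo.ev x) := fun ha x =>
    (hΦe _ (Matrix.smo_mul_self.1 ha x)).2
  have e0 : c.map (Smo.aff 0 L) = a := by
    refine Matrix.ext fun i j => Subtype.ext (funext fun x => ?_)
    change Φ (G (0 + L x)) i j = _
    have : G (0 + L x) = a.map (Smo.ev x) := by
      ext i j
      simp [G, L]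
    rw [this, idem ha.idem]; rfl
  have e1 : c.map (Smo.aff (0, 1) L) = b := by
    refine Matrix.ext fun i j => Subtype.ext (funext fun x => ?_)
    change Φ (G ((0, 1) + L x)) i j = _
    have : G ((0, 1) + L x) = b.map (Smo.ev x) := by
      ext i j
      simp [G, L]
    rw [this, idem hb.idem]; rfl
  have k0 := Form.I_chern_aff (0 : (κ → ℝ) × ℝ) L (stdDir κ) 0 c k
  have k1 := Form.I_chern_aff ((0, 1) : (κ → ℝ) × ℝ) L (stdDir κ) 0 c k
  rw [e0, map_zero, add_zero] at k0
  rw [e1, map_zero, add_zero] at k1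
  rw [zero_add] at key
  rw [chernNumber, chernNumber, k0, k1, key]

open Classical in
/-- The Chern numbers of a continuous idempotent on the torus. -/
noncomputable def ch (e : (κ → ℝ) → Matrix r r ℂ) (k : ℕ) : Lam κ :=
  if h : ∃ c, ∃ δ > 0, ∀ a, Smooths δ e a → chernNumber a k = c then h.choose else 0

theorem CIdem.ch_spec {e : (κ → ℝ) → Matrix r r ℂ} (he : CIdem e) (k : ℕ) :
    ∃ δ > 0, ∀ a, Smooths δ e a → chernNumber a k = ch e k := by
  have h : ∃ c, ∃ δ > 0, ∀ a, Smooths δ e a → chernNumber a k = c := by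
    obtain ⟨δ, hδ, h⟩ := he.exists_chernNumber_eq k
    obtain ⟨a, ha, -⟩ := he.exists_smooths hδ
    exact ⟨chernNumber a k, δ, hδ, fun b hb => h b a hb ha⟩
  rw [ch, dif_pos h]
  exact h.choose_spec

theorem CIdem.ch_eq {e : (κ → ℝ) → Matrix r r ℂ} (he : CIdem e) (k : ℕ)
    {a : Matrix r r (Smo (κ → ℝ))} (ha : ∀ x, a.map (Smo.ev x) = e x) :
    ch e k = chernNumber a k := by
  obtain ⟨δ, hδ, h⟩ := he.ch_spec k
  refine (h a ⟨?_, ?_, ?_⟩).symm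
  · exact Matrix.smo_mul_self.2 fun x => by rw [ha, he.idem]
  · intro m
    refine Matrix.ext fun i j => Subtype.ext (funext fun x => ?_)
    have := (ha (x + fun l => (m l : ℝ))).trans ((he.per x m).trans (ha x).symm)
    exact congrFun (congrFun this i) j
  · intro x i j
    rw [← ha x]
    simpa using hδ

theorem CIdem.exists_smooths_ch {e : (κ → ℝ) → Matrix r r ℂ} (he : CIdem e) (k : ℕ) {ε : ℝ}
    (hε : 0 < ε) : ∃ a, Smooths ε e a ∧ (∀ v, (∀ x, e (x + v) = e x) → a.map (Smo.tau v) = a) ∧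
      chernNumber a k = ch e k := by
  obtain ⟨δ, hδ, h⟩ := he.ch_spec k
  obtain ⟨a, ha, hv⟩ := he.exists_smooths (lt_min hε hδ)
  exact ⟨a, ha.mono (min_le_left _ _), hv, h a (ha.mono (min_le_right _ _))⟩

theorem ch_homotopy {H : unitInterval → (κ → ℝ) → Matrix r r ℂ}
    (hc : Continuous fun p : unitInterval × (κ → ℝ) => H p.1 p.2) (hH : ∀ t, CIdem (H t)) (k : ℕ) :
    ch (H 0) k = ch (H 1) k := by
  refine IsLocallyConstant.apply_eq_of_preconnectedSpace (f := fun t => ch (H t) k)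
    ((IsLocallyConstant.iff_eventually_eq _).2 fun t₀ => ?_) 0 1
  obtain ⟨δ, hδ, h⟩ := (hH t₀).ch_spec k
  have hclose : ∀ᶠ t in 𝓝 t₀, ∀ x ∈ Set.Icc (0 : κ → ℝ) 1, ∀ i j,
      ‖H t x i j - H t₀ x i j‖ < δ / 2 := by
    refine isCompact_Icc.eventually_forall_of_forall_eventually fun x _ => ?_
    refine eventually_all.2 fun i => eventually_all.2 fun j => ?_
    have h1 : Continuous fun p : unitInterval × (κ → ℝ) =>
        ‖H p.1 p.2 i j - H t₀ p.2 i j‖ := by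
      refine ((hc.matrix_elem i j).sub ?_).norm
      exact ((hH t₀).cont.comp continuous_snd).matrix_elem i j
    refine h1.continuousAt.eventually_lt continuousAt_const ?_
    simpa using hδ
  filter_upwards [hclose] with t ht
  obtain ⟨a, ha, -, hak⟩ := (hH t).exists_smooths_ch k (half_pos hδ)
  rw [← hak]
  refine h a ?_
  have := ha.trans (e' := H t₀) (ε' := δ / 2) fun x i j => ?_
  · rwa [add_halves] at this
  · obtain ⟨m, hm, -⟩ := (hH t).per.exists_cube x
    have := ht _ hm i j
    rwa [(hH t).per, (hH t₀).per] at this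

end ChernNumber

theorem Matrix.exists_trace_eq_natCast {r : Type*} [Fintype r] [DecidableEq r]
    {P : Matrix r r ℂ} (hP : P * P = P) : ∃ n : ℕ, P.trace = n := by
  have hff : IsIdempotentElem (Matrix.toLin' P) := by
    rw [IsIdempotentElem, Module.End.mul_eq_comp, ← Matrix.toLin'_mul, hP]
  have htr := (LinearMap.IsIdempotentElem.isProj_range _ hff).trace
  rw [Matrix.trace_toLin'_eq] at htr
  exact ⟨_, htr⟩

section ChernNumber
open Topology Filter

variable {κ : Type} [Fintype κ] [DecidableEq κ] {r s : Type} [Fintype r] [DecidableEq r]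
  [Fintype s] [DecidableEq s]

theorem CIdem.exists_trace_eq {e : (κ → ℝ) → Matrix r r ℂ} (he : CIdem e) :
    ∃ δ > 0, ∀ a, Smooths δ e a → ∀ x, (a.map (Smo.ev x)).trace = (e x).trace := by
  refine ⟨1 / (Fintype.card r + 1), by positivity, fun a ha x => ?_⟩
  obtain ⟨n, hn⟩ := Matrix.exists_trace_eq_natCast (Matrix.smo_mul_self.1 ha.idem x)
  obtain ⟨m, hm⟩ := Matrix.exists_trace_eq_natCast (he.idem x)
  have h1 : ‖(a.map (Smo.ev x)).trace - (e x).trace‖ < 1 := by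
    rw [← Matrix.trace_sub, Matrix.trace]
    refine (norm_sum_le _ _).trans_lt ?_
    calc _ ≤ ∑ i : r, (1 / (Fintype.card r + 1) : ℝ) :=
          Finset.sum_le_sum fun i _ => (ha.close x i i).le
      _ = Fintype.card r / (Fintype.card r + 1) := by simp [div_eq_mul_inv]
      _ < 1 := by rw [div_lt_one (by positivity)]; linarith
  rw [hn, hm] at h1 ⊢
  have h2 : ‖((n - m : ℤ) : ℂ)‖ < 1 := by push_cast; exact h1
  rw [Complex.norm_intCast] at h2
  have h3 : (n - m : ℤ) = 0 := Int.abs_lt_one_iff.1 (by exact_mod_cast h2)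
  have : n = m := by omega
  rw [this]

theorem CIdem.fromBlocks {e : (κ → ℝ) → Matrix r r ℂ} {f : (κ → ℝ) → Matrix s s ℂ}
    (he : CIdem e) (hf : CIdem f) : CIdem fun x => Matrix.fromBlocks (e x) 0 0 (f x) :=
  ⟨he.cont.matrix_fromBlocks continuous_const continuous_const hf.cont,
    fun x => by simp [Matrix.fromBlocks_multiply, he.idem, hf.idem],
    fun x m => by simp only [he.per x m, hf.per x m]⟩

theorem CIdem.reindex {e : (κ → ℝ) → Matrix r r ℂ} (he : CIdem e) (g : r ≃ s) :
    CIdem fun x => Matrix.reindex g g (e x) :=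
  ⟨he.cont.matrix_reindex g g,
    fun x => by
      simp only [Matrix.reindex_apply]
      rw [Matrix.submatrix_mul_equiv, he.idem],
    fun x m => by simp only [he.per x m]⟩

theorem ch_reindex {e : (κ → ℝ) → Matrix r r ℂ} (he : CIdem e) (g : r ≃ s) (k : ℕ) :
    ch (fun x => Matrix.reindex g g (e x)) k = ch e k := by
  obtain ⟨δ, hδ, h⟩ := (he.reindex g).ch_spec k
  obtain ⟨a, ha, -, hak⟩ := he.exists_smooths_ch k hδ
  rw [← hak, ← h (Matrix.reindex g g a), chernNumber, Form.chern_reindex, chernNumber]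
  refine ⟨?_, fun m => ?_, fun x i j => ha.close x _ _⟩
  · simp only [Matrix.reindex_apply]
    rw [Matrix.submatrix_mul_equiv, ha.idem]
  · conv_rhs => rw [← ha.per m]
    rfl

theorem ch_fromBlocks {e : (κ → ℝ) → Matrix r r ℂ} {f : (κ → ℝ) → Matrix s s ℂ}
    (he : CIdem e) (hf : CIdem f) (k : ℕ) :
    ch (fun x => Matrix.fromBlocks (e x) 0 0 (f x)) k = ch e k + ch f k := by
  obtain ⟨δ, hδ, h⟩ := (he.fromBlocks hf).ch_spec k
  obtain ⟨a, ha, -, hak⟩ := he.exists_smooths_ch k hδ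
  obtain ⟨b, hb, -, hbk⟩ := hf.exists_smooths_ch k hδ
  rw [← hak, ← hbk, ← h (Matrix.fromBlocks a 0 0 b), chernNumber, Form.chern_fromBlocks,
    map_add, chernNumber, chernNumber]
  refine ⟨?_, fun m => ?_, fun x i j => ?_⟩
  · simp [Matrix.fromBlocks_multiply, ha.idem, hb.idem]
  · rw [Matrix.fromBlocks_map, ha.per, hb.per]
    congr 1
  · rcases i with i | i <;> rcases j with j | j
    · exact ha.close x i j
    · simpa using hδ
    · simpa using hδ
    · exact hb.close x i j

theorem Smo.D_eq_zero {E : Type*} [NormedAddCommGroup E] [NormedSpace ℝ E] {v : E} {a : Smo E}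
    (h : ∀ t : ℝ, Smo.tau (t • v) a = a) : Smo.D v a = 0 := by
  ext x
  rw [D_apply, zero_apply]
  have h1 : HasDerivAt (fun t : ℝ => a.1 (x + t • v)) (fderiv ℝ a.1 x v) 0 := by
    have h2 : HasDerivAt (fun t : ℝ => x + t • v) v 0 := by
      simpa using ((hasDerivAt_id (0 : ℝ)).smul_const v).const_add x
    have h3 : HasFDerivAt a.1 (fderiv ℝ a.1 x) (x + (0 : ℝ) • v) := by
      simpa using (Smo.differentiable a x).hasFDerivAt
    exact h3.comp_hasDerivAt 0 h2
  have h4 : (fun t : ℝ => a.1 (x + t • v)) = fun _ => a.1 x :=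
    funext fun t => congrArg (fun b : Smo E => b.1 x) (h t)
  rw [h4] at h1
  exact h1.unique (hasDerivAt_const _ _)

theorem CIdem.ch_eq_zero {e : (κ → ℝ) → Matrix r r ℂ} (he : CIdem e) {k : ℕ}
    (hk : Fintype.card κ = 2 * k) {l : κ} (hl : ∀ x t, e (x + Pi.single l t) = e x) :
    ch e k = 0 := by
  obtain ⟨a, -, hv, hak⟩ := he.exists_smooths_ch k one_pos
  rw [← hak, chernNumber, Form.chern_eq_zero (l := l) _ _ hk, map_zero]
  refine Matrix.ext fun i j => ?_
  refine Smo.D_eq_zero fun t => ?_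
  have := hv (t • stdDir κ l) fun x => by
    rw [stdDir, ← Pi.single_smul, smul_eq_mul, mul_one, hl]
  exact congrFun (congrFun this i) j

theorem CIdem.I_chern_subtorus_eq_zero {e : (κ → ℝ) → Matrix r r ℂ} (he : CIdem e) {k : ℕ}
    (w : Fin (2 * k) → κ) (z : κ → ℝ) (l : Fin (2 * k))
    (hl : ∀ x t, e (z + lin (stdDir κ ∘ w) (x + Pi.single l t)) = e (z + lin (stdDir κ ∘ w) x)) :
    ∃ δ₀ > 0, ∀ a, Smooths δ₀ e a → ∀ z,
      Form.I (stdDir κ ∘ w) z (Form.chern (stdDir κ ∘ w) a k) = 0 := by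
  set b := stdDir κ ∘ w
  have hcast : ∀ m : Fin (2 * k) → ℤ, ∃ m' : κ → ℤ,
      lin b (fun i => (m i : ℝ)) = fun l => (m' l : ℝ) := by
    intro m
    refine ⟨∑ i, m i • (Pi.single (w i) 1 : κ → ℤ), ?_⟩
    rw [lin_apply]
    funext l
    simp [b, stdDir, Finset.sum_apply, Pi.single_apply]
  have he' : CIdem fun x => e (z + lin b x) := by
    refine ⟨he.cont.comp (by fun_prop), fun x => he.idem _, fun x m => ?_⟩
    obtain ⟨m', hm'⟩ := hcast m
    simp only [map_add, ← add_assoc, hm', he.per _ m']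
  obtain ⟨δ, hδ, h⟩ := he'.ch_spec k
  refine ⟨δ, hδ, fun a ha z' => ?_⟩
  have h1 := h (a.map (Smo.aff z (lin b))) ⟨?_, ?_, ?_⟩
  · rw [he'.ch_eq_zero (by simp) hl, chernNumber, Form.I_chern_aff, map_zero, add_zero,
      lin_comp_stdDir] at h1
    rw [← h1, ← Form.I_chern b z (z' - z) ha.idem (fun l => ha.per_std _) k,
      add_sub_cancel]
  · rw [← AlgHom.mapMatrix_apply, ← map_mul, ha.idem]
  · intro m
    obtain ⟨m', hm'⟩ := hcast m
    refine Matrix.ext fun i j => Subtype.ext (funext fun x => ?_)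
    have := congrArg (fun c => (c i j).1 (z + lin b x)) (ha.per m')
    simp only [Matrix.map_apply, Smo.tau_apply] at this
    simp only [Matrix.map_apply, Smo.tau_apply, Smo.aff_apply, map_add, ← add_assoc, hm', this]
  · exact fun x i j => ha.close _ i j

end ChernNumber

section Vanishing
open Topology Filter

variable {L R : Type} [Fintype L] [DecidableEq L] [Fintype R] [DecidableEq R]
  {r : Type} [Fintype r] [DecidableEq r]

theorem exists_hit_miss {k : ℕ} (hL : Odd (Fintype.card L)) (hR : Odd (Fintype.card R))
    (hk : 1 ≤ k) (hk' : 2 * k < Fintype.card L + Fintype.card R) {w : Fin (2 * k) → L ⊕ R}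
    (hw : Function.Injective w) :
    (∃ i l, (∀ a, w a ≠ Sum.inl i) ∧ w l ∈ Set.range Sum.inl) ∨
      ∃ i l, (∀ a, w a ≠ Sum.inr i) ∧ w l ∈ Set.range Sum.inr := by
  by_contra! hcon
  obtain ⟨h1, h2⟩ := hcon
  set u := Finset.univ.image w with hu
  have hcard : u.toLeft.card + u.toRight.card = 2 * k := by
    rw [Finset.card_toLeft_add_card_toRight, hu, Finset.card_image_of_injective _ hw]; simp
  have hl : u.toLeft = ∅ ∨ u.toLeft = Finset.univ := by
    by_contra! hcon
    obtain ⟨⟨x, hx⟩, hne⟩ := hcon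
    obtain ⟨i, hi⟩ : ∃ i, i ∉ u.toLeft := by
      by_contra! h; exact hne (Finset.eq_univ_iff_forall.2 h)
    rw [Finset.mem_toLeft, hu, Finset.mem_image] at hx hi
    obtain ⟨l, -, hl⟩ := hx
    exact h1 i l (fun a ha => hi ⟨a, Finset.mem_univ _, ha⟩) ⟨x, hl.symm⟩
  have hr : u.toRight = ∅ ∨ u.toRight = Finset.univ := by
    by_contra! hcon
    obtain ⟨⟨x, hx⟩, hne⟩ := hcon
    obtain ⟨i, hi⟩ : ∃ i, i ∉ u.toRight := by
      by_contra! h; exact hne (Finset.eq_univ_iff_forall.2 h)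
    rw [Finset.mem_toRight, hu, Finset.mem_image] at hx hi
    obtain ⟨l, -, hl⟩ := hx
    exact h2 i l (fun a ha => hi ⟨a, Finset.mem_univ _, ha⟩) ⟨x, hl.symm⟩
  obtain ⟨p, hp⟩ := hL
  obtain ⟨q, hq⟩ := hR
  rcases hl with hl | hl <;> rcases hr with hr | hr <;> rw [hl, hr] at hcard <;>
    simp only [Finset.card_empty, Finset.card_univ] at hcard <;> omega

/-- Vanishing of the top Chern number of a low rank bundle pulled back from the product of two
odd-dimensional spheres. -/
theorem CIdem.ch_eq_zero_of_sum {e : (L ⊕ R → ℝ) → Matrix r r ℂ} (he : CIdem e)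
    (hL : Odd (Fintype.card L)) (hR : Odd (Fintype.card R)) {N K : ℕ}
    (hK : 2 * K = Fintype.card L + Fintype.card R) (hNK : N < K) (hN : ∀ x, (e x).trace = N)
    (h1 : ∀ x y, (∃ l, ∃ m : ℤ, x (Sum.inl l) = (m : ℝ)) → (∃ l, ∃ m : ℤ, y (Sum.inl l) = (m : ℝ)) →
      (∀ i, x (Sum.inr i) = y (Sum.inr i)) → e x = e y)
    (h2 : ∀ x y, (∃ l, ∃ m : ℤ, x (Sum.inr l) = (m : ℝ)) → (∃ l, ∃ m : ℤ, y (Sum.inr l) = (m : ℝ)) →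
      (∀ i, x (Sum.inl i) = y (Sum.inl i)) → e x = e y) : ch e K = 0 := by
  have hlin : ∀ {k : ℕ} (w : Fin (2 * k) → L ⊕ R) (x : Fin (2 * k) → ℝ) (i : L ⊕ R),
      (∀ a, w a ≠ i) → lin (stdDir _ ∘ w) x i = 0 := by
    intro k w x i hi
    rw [lin_apply, Finset.sum_apply]
    exact Finset.sum_eq_zero fun a _ => by simp [stdDir, (hi a).symm]
  have hlin' : ∀ {k : ℕ} (w : Fin (2 * k) → L ⊕ R) (x : Fin (2 * k) → ℝ) (l : Fin (2 * k))
      (t : ℝ) (i : L ⊕ R), w l ≠ i →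
      lin (stdDir _ ∘ w) (x + Pi.single l t) i = lin (stdDir _ ∘ w) x i := by
    intro k w x l t i hi
    rw [map_add, lin_single]
    simp [stdDir, hi.symm]
  have hsub : ∀ k, 1 ≤ k → k < K → ∀ w : Fin (2 * k) → L ⊕ R, Function.Injective w →
      ∃ δ₀ > 0, ∀ a, Smooths δ₀ e a → ∀ z,
        Form.I (stdDir _ ∘ w) z (Form.chern (stdDir _ ∘ w) a k) = 0 := by
    intro k hk hkK w hw
    rcases exists_hit_miss hL hR hk (by omega) hw with ⟨i, l, hi, j, hj⟩ | ⟨i, l, hi, j, hj⟩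
    · refine he.I_chern_subtorus_eq_zero w 0 l fun x t => ?_
      rw [zero_add, zero_add]
      refine h1 _ _ ⟨i, 0, ?_⟩ ⟨i, 0, ?_⟩ fun c => hlin' w x l t _ ?_
      · rw [hlin w _ _ hi, Int.cast_zero]
      · rw [hlin w _ _ hi, Int.cast_zero]
      · rw [← hj]; simp
    · refine he.I_chern_subtorus_eq_zero w 0 l fun x t => ?_
      rw [zero_add, zero_add]
      refine h2 _ _ ⟨i, 0, ?_⟩ ⟨i, 0, ?_⟩ fun c => hlin' w x l t _ ?_
      · rw [hlin w _ _ hi, Int.cast_zero]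
      · rw [hlin w _ _ hi, Int.cast_zero]
      · rw [← hj]; simp
  have hev : ∀ᶠ δ : ℝ in 𝓝[>] 0, ∀ (k : Fin K), 1 ≤ k.1 → ∀ w : Fin (2 * k) → L ⊕ R,
      Function.Injective w → ∀ a, Smooths δ e a → ∀ z,
        Form.I (stdDir _ ∘ w) z (Form.chern (stdDir _ ∘ w) a k) = 0 := by
    refine eventually_all.2 fun k => eventually_all.2 fun hk => eventually_all.2 fun w =>
      eventually_all.2 fun hw => ?_
    obtain ⟨δ₀, hδ₀, h⟩ := hsub k hk k.2 w hw
    filter_upwards [Ioc_mem_nhdsGT hδ₀] with δ hδ a ha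
    exact h a (ha.mono hδ.2)
  obtain ⟨δ₁, hδ₁, ht⟩ := he.exists_trace_eq
  obtain ⟨δ, ⟨hδ, hδ'⟩, h0⟩ := ((hev.and (Ioc_mem_nhdsGT hδ₁)).and
    self_mem_nhdsWithin).exists
  obtain ⟨a, ha, -, hak⟩ := he.exists_smooths_ch K (show 0 < δ from h0)
  rw [← hak, chernNumber]
  refine Form.I_chern_eq_zero _ ha.idem ha.per_std (N := N) (fun x => ?_) hNK ?_ 0
  · rw [ht a (ha.mono hδ'.2), hN]
  · intro k hk hkK z
    exact Form.I_chern_eq_zero_of_words _ ha.per_std (fun w hw z => hδ ⟨k, hkK⟩ hk w hw a ha z) z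

end Vanishing

section Periodize
open Topology Filter

variable {κ : Type} [Fintype κ] [DecidableEq κ] {X : Type*}

theorem locallyFinite_cubes : LocallyFinite fun m : κ → ℤ =>
    {x : κ → ℝ | (x + fun l => ((m l : ℤ) : ℝ)) ∈ Set.Icc 0 1} := by
  intro x
  refine ⟨Metric.ball x 1, Metric.ball_mem_nhds x one_pos, ?_⟩
  refine (Set.finite_Icc (fun l => -⌊x l⌋ - 3) (fun l => -⌊x l⌋ + 3)).subset ?_
  rintro m ⟨y, ⟨hy0, hy1⟩, hyx⟩
  have hy : ∀ l, |y l - x l| < 1 := fun l => by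
    rw [← Real.dist_eq]; exact (dist_pi_lt_iff one_pos).1 hyx l
  constructor <;> intro l <;> have h0 := hy0 l <;> have h1 := hy1 l <;> have h2 := hy l <;>
    have h3 := Int.floor_le (x l) <;> have h4 := Int.lt_floor_add_one (x l) <;>
    simp only [Pi.add_apply, Pi.zero_apply, Pi.one_apply] at h0 h1 <;>
    rw [abs_lt] at h2
  · have : ((-⌊x l⌋ - 3 : ℤ) : ℝ) ≤ (m l : ℝ) := by push_cast; linarith [h2.1, h2.2]
    exact_mod_cast this
  · have : ((m l : ℤ) : ℝ) ≤ ((-⌊x l⌋ + 3 : ℤ) : ℝ) := by push_cast; linarith [h2.1, h2.2]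
    exact_mod_cast this

theorem IntPeriodic.continuous_uncurry [TopologicalSpace X] {T : Type*} [TopologicalSpace T]
    {G : T → (κ → ℝ) → X} (hG : ∀ t, IntPeriodic (G t))
    (hc : ContinuousOn (fun p : T × (κ → ℝ) => G p.1 p.2) (Set.univ ×ˢ Set.Icc 0 1)) :
    Continuous fun p : T × (κ → ℝ) => G p.1 p.2 := by
  refine (locallyFinite_cubes.preimage_continuous continuous_snd).continuous ?_ (fun m => ?_)
    fun m => ?_
  · refine Set.eq_univ_of_forall fun x => Set.mem_iUnion.2 ?_
    obtain ⟨m, hm, -⟩ := (hG x.1).exists_cube x.2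
    exact ⟨m, hm⟩
  · exact (isClosed_Icc.preimage (by fun_prop)).preimage continuous_snd
  · have : (fun p : T × (κ → ℝ) => G p.1 p.2) =
        (fun p : T × (κ → ℝ) => G p.1 p.2) ∘
          fun p => (p.1, p.2 + fun l => ((m l : ℤ) : ℝ)) :=
      funext fun p => (hG p.1 p.2 m).symm
    rw [this]
    exact hc.comp (by fun_prop) fun x hx => ⟨trivial, hx⟩

theorem IntPeriodic.continuous [TopologicalSpace X] {G : (κ → ℝ) → X} (hG : IntPeriodic G)
    (hc : ContinuousOn G (Set.Icc 0 1)) : Continuous G :=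
  (IntPeriodic.continuous_uncurry (T := Unit) (fun _ => hG)
    (hc.comp continuousOn_snd fun _ hx => hx.2)).comp (by fun_prop : Continuous fun x => ((), x))

/-- The periodic extension of a function on the unit cube. -/
noncomputable def periodize (F : (κ → ℝ) → X) : (κ → ℝ) → X := fun x => F fun l => Int.fract (x l)

theorem periodize_intPeriodic (F : (κ → ℝ) → X) : IntPeriodic (periodize F) := fun x m => by
  simp [periodize]

/-- Compatibility with the identification of opposite faces of the cube. -/
def FaceCompatible (F : (κ → ℝ) → X) : Prop :=
  ∀ x ∈ Set.Icc (0 : κ → ℝ) 1, ∀ l, x l = 1 → F (Function.update x l 0) = F x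

theorem FaceCompatible.periodize_eq {F : (κ → ℝ) → X} (hF : FaceCompatible F) {x : κ → ℝ}
    (hx : x ∈ Set.Icc (0 : κ → ℝ) 1) : periodize F x = F x := by
  have key : ∀ S : Finset κ, F (fun l => if l ∈ S then Int.fract (x l) else x l) = F x := by
    intro S
    induction S using Finset.induction_on with
    | empty => simp
    | insert l S hl ih =>
      rcases eq_or_ne (x l) 1 with h | h
      · rw [← ih, ← hF (fun l => if l ∈ S then Int.fract (x l) else x l) _ l (by simp [hl, h])]
        · congr 1
          funext j
          rcases eq_or_ne j l with rfl | hj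
          · simp [h]
          · simp [hj]
        · constructor <;> intro j <;> by_cases hj : j ∈ S <;> simp [hj]
          · exact hx.1 j
          · exact (Int.fract_lt_one _).le
          · exact hx.2 j
      · rw [← ih]
        congr 1
        funext j
        rcases eq_or_ne j l with rfl | hj
        · simp [hl, Int.fract_eq_self.2 ⟨hx.1 j, lt_of_le_of_ne (hx.2 j) h⟩]
        · simp [hj]
  simpa [periodize] using key Finset.univ

theorem FaceCompatible.continuous_periodize [TopologicalSpace X] {F : (κ → ℝ) → X}
    (hF : FaceCompatible F) (hc : ContinuousOn F (Set.Icc 0 1)) : Continuous (periodize F) :=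
  (periodize_intPeriodic F).continuous (hc.congr fun _ hx => hF.periodize_eq hx)

theorem FaceCompatible.continuous_periodize_uncurry [TopologicalSpace X] {T : Type*}
    [TopologicalSpace T] {F : T → (κ → ℝ) → X} (hF : ∀ t, FaceCompatible (F t))
    (hc : ContinuousOn (fun p : T × (κ → ℝ) => F p.1 p.2) (Set.univ ×ˢ Set.Icc 0 1)) :
    Continuous fun p : T × (κ → ℝ) => periodize (F p.1) p.2 :=
  IntPeriodic.continuous_uncurry (fun t => periodize_intPeriodic (F t))
    (hc.congr fun p hp => (hF p.1).periodize_eq hp.2)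

theorem fract_mem_cube (x : κ → ℝ) : (fun l => Int.fract (x l)) ∈ Set.Icc (0 : κ → ℝ) 1 :=
  ⟨fun l => Int.fract_nonneg (x l), fun l => (Int.fract_lt_one (x l)).le⟩

end Periodize

section Equivalence
open Topology Filter

variable {κ : Type} [Fintype κ] [DecidableEq κ] {r s : Type} [Fintype r] [DecidableEq r]
  [Fintype s] [DecidableEq s]

theorem CIdem.zero : CIdem (fun _ => 0 : (κ → ℝ) → Matrix r r ℂ) :=
  ⟨continuous_const, fun _ => by simp, fun _ _ => rfl⟩

theorem ch_zero (k : ℕ) : ch (fun _ => 0 : (κ → ℝ) → Matrix r r ℂ) k = 0 := by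
  rw [CIdem.zero.ch_eq k (a := 0) (fun x => by ext i j; simp), chernNumber, Form.chern,
    show (0 : Matrix r r (Smo (κ → ℝ))).map (Form.incl (κ := κ)) = 0 by ext; simp]
  simp

theorem Matrix.rotate_idem {A : Matrix r s ℂ} {B : Matrix s r ℂ}
    (he : A * B * (A * B) = A * B) (hf : B * A * (B * A) = B * A) {c d : ℂ}
    (h : c * c + d * d = 1) :
    Matrix.fromBlocks ((c * c) • (A * B)) ((c * d) • (A * B * A)) ((c * d) • (B * A * B))
      ((d * d) • (B * A)) * Matrix.fromBlocks ((c * c) • (A * B)) ((c * d) • (A * B * A))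
      ((c * d) • (B * A * B)) ((d * d) • (B * A)) =
    Matrix.fromBlocks ((c * c) • (A * B)) ((c * d) • (A * B * A)) ((c * d) • (B * A * B))
      ((d * d) • (B * A)) := by
  have h0 : A * (B * (A * B)) = A * B := by simpa only [Matrix.mul_assoc] using he
  have h1 : B * (A * (B * A)) = B * A := by simpa only [Matrix.mul_assoc] using hf
  rw [Matrix.fromBlocks_multiply]
  simp only [Matrix.smul_mul, Matrix.mul_smul, smul_smul, Matrix.mul_assoc, h0, h1, ← add_smul]
  congr 1
  · congr 1; linear_combination c * c * h
  · congr 1; linear_combination c * d * h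
  · congr 1; linear_combination c * d * h
  · congr 1; linear_combination d * d * h

theorem exists_rotation : ∃ c d : unitInterval → ℂ, Continuous c ∧ Continuous d ∧
    (∀ t, c t * c t + d t * d t = 1) ∧ c 0 = 1 ∧ d 0 = 0 ∧ c 1 = 0 ∧ d 1 = 1 := by
  refine ⟨fun t => (Real.cos (Real.pi / 2 * t) : ℝ), fun t => (Real.sin (Real.pi / 2 * t) : ℝ),
    by fun_prop, by fun_prop, fun t => ?_, by simp, by simp, by simp, by simp⟩
  have := Real.cos_sq_add_sin_sq (Real.pi / 2 * t)
  rw [sq, sq] at this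
  beta_reduce
  exact_mod_cast this

/-- Invariance of Chern numbers under Murray–von Neumann equivalence. -/
theorem ch_eq_of_equiv {A : (κ → ℝ) → Matrix r s ℂ} {B : (κ → ℝ) → Matrix s r ℂ}
    (hA : Continuous A) (hB : Continuous B) (he : CIdem fun x => A x * B x)
    (hf : CIdem fun x => B x * A x)
    (hA' : IntPeriodic fun x => A x) (hB' : IntPeriodic fun x => B x) (k : ℕ) :
    ch (fun x => A x * B x) k = ch (fun x => B x * A x) k := by
  obtain ⟨c, d, hcc, hdc, hcd, c0, d0, c1, d1⟩ := exists_rotation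
  let H : unitInterval → (κ → ℝ) → Matrix (r ⊕ s) (r ⊕ s) ℂ := fun t x =>
    Matrix.fromBlocks ((c t * c t) • (A x * B x)) ((c t * d t) • (A x * B x * A x))
      ((c t * d t) • (B x * A x * B x)) ((d t * d t) • (B x * A x))
  have hH : Continuous fun p : unitInterval × (κ → ℝ) => H p.1 p.2 := by
    have h1 : Continuous fun p : unitInterval × (κ → ℝ) => A p.2 := hA.comp continuous_snd
    have h2 : Continuous fun p : unitInterval × (κ → ℝ) => B p.2 := hB.comp continuous_snd
    have h3 : Continuous fun p : unitInterval × (κ → ℝ) => c p.1 := hcc.comp continuous_fst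
    have h4 : Continuous fun p : unitInterval × (κ → ℝ) => d p.1 := hdc.comp continuous_fst
    exact ((h3.mul h3).smul (h1.matrix_mul h2)).matrix_fromBlocks
      ((h3.mul h4).smul ((h1.matrix_mul h2).matrix_mul h1))
      ((h3.mul h4).smul ((h2.matrix_mul h1).matrix_mul h2)) ((h4.mul h4).smul (h2.matrix_mul h1))
  have key := ch_homotopy hH (fun t => ⟨hH.comp (by fun_prop : Continuous fun x => (t, x)),
    fun x => ?_, fun x m => ?_⟩) k
  · have e0 : H 0 = fun x => Matrix.fromBlocks (A x * B x) 0 0 0 := by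
      funext x; simp [H, c0, d0]
    have e1 : H 1 = fun x => Matrix.fromBlocks 0 0 0 (B x * A x) := by
      funext x; simp [H, c1, d1]
    rw [e0, e1, ch_fromBlocks he CIdem.zero, ch_fromBlocks CIdem.zero hf, ch_zero, ch_zero] at key
    simpa using key
  · exact Matrix.rotate_idem (he.idem x) (hf.idem x) (hcd t)
  · simp only [H, hA' x m, hB' x m]

theorem ch_add_of_orthogonal {e f : (κ → ℝ) → Matrix r r ℂ} (he : CIdem e) (hf : CIdem f)
    (h1 : ∀ x, e x * f x = 0) (h2 : ∀ x, f x * e x = 0) (k : ℕ) :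
    ch (fun x => e x + f x) k = ch e k + ch f k := by
  rw [← ch_fromBlocks he hf]
  let A : (κ → ℝ) → Matrix r (r ⊕ r) ℂ := fun x => Matrix.fromCols (e x) (f x)
  let B : (κ → ℝ) → Matrix (r ⊕ r) r ℂ := fun x => Matrix.fromRows (e x) (f x)
  have hA : Continuous A := continuous_matrix fun i j => by
    cases j
    · exact he.cont.matrix_elem _ _
    · exact hf.cont.matrix_elem _ _
  have hB : Continuous B := continuous_matrix fun i j => by
    cases i
    · exact he.cont.matrix_elem _ _
    · exact hf.cont.matrix_elem _ _
  have hAB : (fun x => A x * B x) = fun x => e x + f x := by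
    funext x
    simp [A, B, Matrix.fromCols_mul_fromRows, he.idem, hf.idem]
  have hBA : (fun x => B x * A x) = fun x => Matrix.fromBlocks (e x) 0 0 (f x) := by
    funext x
    simp [A, B, he.idem, hf.idem, h1, h2]
  rw [← hAB, ← hBA]
  refine ch_eq_of_equiv hA hB ?_ ?_ (fun x m => ?_) (fun x m => ?_) k
  · rw [hAB]
    exact ⟨he.cont.add hf.cont, fun x => by
      rw [add_mul, mul_add, mul_add, he.idem, hf.idem, h1, h2]; simp,
      fun x m => by simp only [he.per x m, hf.per x m]⟩
  · rw [hBA]; exact he.fromBlocks hf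
  · simp only [A, he.per x m, hf.per x m]
  · simp only [B, he.per x m, hf.per x m]

end Equivalence

section Clutching
open Topology Filter

variable {κ : Type} [Fintype κ] [DecidableEq κ] {r s : Type} [Fintype r] [DecidableEq r]
  [Fintype s] [DecidableEq s]

/-- Continuous periodic invertible matrices, together with their inverses. -/
structure CUnit (a a' : (κ → ℝ) → Matrix r r ℂ) : Prop where
  cont : Continuous a
  cont' : Continuous a'
  per : IntPeriodic a
  per' : IntPeriodic a'
  mul : ∀ x, a x * a' x = 1
  mul' : ∀ x, a' x * a x = 1

/-- A cosine interpolating from `1` to `0` on the first half of the unit interval. -/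
noncomputable def rampCos (t : ℝ) : ℂ := (Real.cos (Real.pi / 2 * min 1 (2 * t)) : ℝ)

/-- A sine interpolating from `0` to `1` on the first half of the unit interval. -/
noncomputable def rampSin (t : ℝ) : ℂ := (Real.sin (Real.pi / 2 * min 1 (2 * t)) : ℝ)

theorem continuous_rampCos : Continuous rampCos := by unfold rampCos; fun_prop

theorem continuous_rampSin : Continuous rampSin := by unfold rampSin; fun_prop

theorem ramp_sq (t : ℝ) : rampCos t ^ 2 + rampSin t ^ 2 = 1 := by
  have := Real.cos_sq_add_sin_sq (Real.pi / 2 * min 1 (2 * t))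
  unfold rampCos rampSin
  exact_mod_cast this

@[simp] theorem rampCos_zero : rampCos 0 = 1 := by simp [rampCos]
@[simp] theorem rampSin_zero : rampSin 0 = 0 := by simp [rampSin]

theorem rampCos_of_le {t : ℝ} (h : 1 / 2 ≤ t) : rampCos t = 0 := by
  simp [rampCos, min_eq_left (by linarith : 1 ≤ 2 * t)]

theorem rampSin_of_le {t : ℝ} (h : 1 / 2 ≤ t) : rampSin t = 1 := by
  simp [rampSin, min_eq_left (by linarith : 1 ≤ 2 * t)]

@[simp] theorem rampCos_one : rampCos 1 = 0 := rampCos_of_le (by norm_num)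
@[simp] theorem rampSin_one : rampSin 1 = 1 := rampSin_of_le (by norm_num)

/-- The isometric embedding onto the mapping torus bundle of `a`. -/
noncomputable def clutchV (t : ℝ) (a a' : Matrix r r ℂ) : Matrix (r ⊕ r) r ℂ :=
  Matrix.fromRows (rampCos t ^ 2 • (1 : Matrix r r ℂ) + rampSin t ^ 2 • a)
    ((rampCos t * rampSin t) • (a' - 1))

/-- The left inverse of `clutchV`. -/
noncomputable def clutchV' (t : ℝ) (a a' : Matrix r r ℂ) : Matrix r (r ⊕ r) ℂ :=
  Matrix.fromCols (rampCos t ^ 2 • (1 : Matrix r r ℂ) + rampSin t ^ 2 • a')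
    ((rampCos t * rampSin t) • (a - 1))

theorem clutchV'_mul {a a' : Matrix r r ℂ} (h' : a' * a = 1) (h : a * a' = 1) (t : ℝ) :
    clutchV' t a a' * clutchV t a a' = 1 := by
  rw [clutchV', clutchV, Matrix.fromCols_mul_fromRows]
  simp only [add_mul, mul_add, sub_mul, mul_sub, Matrix.smul_mul, Matrix.mul_smul, smul_smul,
    smul_sub, h, h', one_mul, mul_one]
  have e := ramp_sq t
  have : (1 : Matrix r r ℂ) = ((rampCos t ^ 2 + rampSin t ^ 2) ^ 2) • (1 : Matrix r r ℂ) := by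
    rw [e]; simp
  conv_rhs => rw [this]
  module

theorem clutchV_zero (a a' : Matrix r r ℂ) : clutchV 0 a a' = Matrix.fromRows 1 0 := by
  simp [clutchV]

theorem clutchV'_zero (a a' : Matrix r r ℂ) : clutchV' 0 a a' = Matrix.fromCols 1 0 := by
  simp [clutchV']

theorem clutchV_one (a a' : Matrix r r ℂ) : clutchV 1 a a' = Matrix.fromRows a 0 := by
  simp [clutchV]

theorem clutchV'_one (a a' : Matrix r r ℂ) : clutchV' 1 a a' = Matrix.fromCols a' 0 := by
  simp [clutchV']

theorem continuousOn_clutchV {T : Type*} [TopologicalSpace T] {S : Set T} {t : T → ℝ}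
    {a a' : T → Matrix r r ℂ} (ht : ContinuousOn t S) (ha : ContinuousOn a S)
    (ha' : ContinuousOn a' S) :
    ContinuousOn (fun x => clutchV (t x) (a x) (a' x)) S ∧
      ContinuousOn (fun x => clutchV' (t x) (a x) (a' x)) S := by
  have hc := continuous_rampCos.comp_continuousOn ht
  have hs := continuous_rampSin.comp_continuousOn ht
  have h1 : ∀ {b : T → Matrix r r ℂ}, ContinuousOn b S → ContinuousOn
      (fun x => rampCos (t x) ^ 2 • (1 : Matrix r r ℂ) + rampSin (t x) ^ 2 • b x) S :=
    fun hb => ((hc.pow 2).smul continuousOn_const).add ((hs.pow 2).smul hb)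
  have h2 : ∀ {b : T → Matrix r r ℂ}, ContinuousOn b S → ContinuousOn
      (fun x => (rampCos (t x) * rampSin (t x)) • (b x - 1)) S :=
    fun hb => (hc.mul hs).smul (hb.sub continuousOn_const)
  simp only [continuousOn_iff_continuous_domRestrict] at *
  refine ⟨continuous_matrix fun i j => ?_, continuous_matrix fun i j => ?_⟩
  · rcases i with i | i
    · exact (h1 ha).matrix_elem i j
    · exact (h2 ha').matrix_elem i j
  · rcases j with j | j
    · exact (h1 ha').matrix_elem i j
    · exact (h2 ha).matrix_elem i j

/-- The push-forward of `Q` along the embedding `clutchV`, on the cube. -/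
noncomputable def clutchCube (l : κ) (a a' Q : (κ → ℝ) → Matrix r r ℂ) (x : κ → ℝ) :
    Matrix (r ⊕ r) (r ⊕ r) ℂ :=
  clutchV (x l) (a x) (a' x) * Q x * clutchV' (x l) (a x) (a' x)

/-- A family of idempotents over the cube inducing a family on the mapping torus of `a`. -/
structure ClutchIdem (l : κ) (a a' Q : (κ → ℝ) → Matrix r r ℂ) : Prop where
  cont : ContinuousOn Q (Set.Icc 0 1)
  idem : ∀ x ∈ Set.Icc (0 : κ → ℝ) 1, Q x * Q x = Q x
  face : ∀ x ∈ Set.Icc (0 : κ → ℝ) 1, ∀ i ≠ l, x i = 1 → Q (Function.update x i 0) = Q x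
  glue : ∀ x ∈ Set.Icc (0 : κ → ℝ) 1, x l = 1 →
    a x * Q x * a' x = Q (Function.update x l 0)

/-- The idempotent on the torus given by `Q`, clutched by `a`. -/
noncomputable def clutchIdem (l : κ) (a a' Q : (κ → ℝ) → Matrix r r ℂ) :
    (κ → ℝ) → Matrix (r ⊕ r) (r ⊕ r) ℂ := periodize (clutchCube l a a' Q)

theorem IntPeriodic.update_eq {X : Type*} {f : (κ → ℝ) → X} (hf : IntPeriodic f) {x : κ → ℝ}
    {l : κ} (hx : x l = 1) : f (Function.update x l 0) = f x := by
  rw [← hf x (Pi.single l (-1))]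
  congr 1
  funext j
  rcases eq_or_ne j l with rfl | h
  · simp [hx]
  · simp [h]

theorem IntPeriodic.fract {X : Type*} {f : (κ → ℝ) → X} (hf : IntPeriodic f) (x : κ → ℝ) :
    f (fun l => Int.fract (x l)) = f x := by
  rw [← hf x fun l => -⌊x l⌋]
  congr 1
  funext l
  simp [Int.fract, sub_eq_add_neg]

theorem ClutchIdem.faceCompatible {l : κ} {a a' Q : (κ → ℝ) → Matrix r r ℂ} (h : CUnit a a')
    (hQ : ClutchIdem l a a' Q) : FaceCompatible (clutchCube l a a' Q) := by
  intro x hx i hi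
  by_cases hil : i = l
  · subst hil
    simp only [clutchCube, Function.update_self, hi, clutchV_zero, clutchV'_zero, clutchV_one,
      clutchV'_one]
    rw [← hQ.glue x hx hi]
    simp [Matrix.fromRows_mul, Matrix.mul_fromCols, Matrix.mul_assoc]
  · have hli : l ≠ i := fun h => hil h.symm
    simp only [clutchCube, Function.update_of_ne hli, h.per.update_eq hi, h.per'.update_eq hi,
      hQ.face x hx i hil hi]

theorem ClutchIdem.cidem {l : κ} {a a' Q : (κ → ℝ) → Matrix r r ℂ} (h : CUnit a a')
    (hQ : ClutchIdem l a a' Q) : CIdem (clutchIdem l a a' Q) := by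
  refine ⟨(hQ.faceCompatible h).continuous_periodize ?_, fun x => ?_, periodize_intPeriodic _⟩
  · obtain ⟨h1, h2⟩ := continuousOn_clutchV (S := Set.Icc (0 : κ → ℝ) 1)
      (continuous_apply l).continuousOn h.cont.continuousOn h.cont'.continuousOn
    have h3 := hQ.cont
    simp only [continuousOn_iff_continuous_domRestrict] at *
    exact (h1.matrix_mul h3).matrix_mul h2
  · set y : κ → ℝ := fun l => Int.fract (x l) with hy
    change clutchCube l a a' Q y * clutchCube l a a' Q y = clutchCube l a a' Q y
    have h1 := clutchV'_mul (h.mul' y) (h.mul y) (y l)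
    have h2 := hQ.idem y (fract_mem_cube x)
    calc clutchCube l a a' Q y * clutchCube l a a' Q y
        = clutchV (y l) (a y) (a' y) * (Q y * (clutchV' (y l) (a y) (a' y) *
            clutchV (y l) (a y) (a' y)) * Q y) * clutchV' (y l) (a y) (a' y) := by
          simp only [clutchCube, Matrix.mul_assoc]
      _ = _ := by rw [h1, mul_one, h2, clutchCube]

theorem trace_clutchIdem {l : κ} {a a' Q : (κ → ℝ) → Matrix r r ℂ} (h : CUnit a a') (x : κ → ℝ) :
    (clutchIdem l a a' Q x).trace = (Q fun l => Int.fract (x l)).trace := by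
  rw [clutchIdem, periodize, clutchCube, Matrix.trace_mul_comm, ← Matrix.mul_assoc,
    clutchV'_mul (h.mul' _) (h.mul _), one_mul]

theorem clutchIdem_add (l : κ) (a a' Q R : (κ → ℝ) → Matrix r r ℂ) (x : κ → ℝ) :
    clutchIdem l a a' (fun x => Q x + R x) x = clutchIdem l a a' Q x + clutchIdem l a a' R x := by
  simp [clutchIdem, periodize, clutchCube, Matrix.mul_add, Matrix.add_mul]

theorem clutchIdem_mul {l : κ} {a a' Q R : (κ → ℝ) → Matrix r r ℂ} (h : CUnit a a')
    (hQR : ∀ x ∈ Set.Icc (0 : κ → ℝ) 1, Q x * R x = 0) (x : κ → ℝ) :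
    clutchIdem l a a' Q x * clutchIdem l a a' R x = 0 := by
  set y : κ → ℝ := fun l => Int.fract (x l) with hy
  change clutchCube l a a' Q y * clutchCube l a a' R y = 0
  have h1 := clutchV'_mul (h.mul' y) (h.mul y) (y l)
  calc clutchCube l a a' Q y * clutchCube l a a' R y
      = clutchV (y l) (a y) (a' y) * (Q y * (clutchV' (y l) (a y) (a' y) *
          clutchV (y l) (a y) (a' y)) * R y) * clutchV' (y l) (a y) (a' y) := by
        simp only [clutchCube, Matrix.mul_assoc]
    _ = _ := by rw [h1, mul_one, hQR y (fract_mem_cube x)]; simp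

theorem ch_clutchIdem_add {l : κ} {a a' Q R : (κ → ℝ) → Matrix r r ℂ} (h : CUnit a a')
    (hQ : ClutchIdem l a a' Q) (hR : ClutchIdem l a a' R)
    (hQR : ∀ x ∈ Set.Icc (0 : κ → ℝ) 1, Q x * R x = 0)
    (hRQ : ∀ x ∈ Set.Icc (0 : κ → ℝ) 1, R x * Q x = 0) (k : ℕ) :
    ch (clutchIdem l a a' fun x => Q x + R x) k =
      ch (clutchIdem l a a' Q) k + ch (clutchIdem l a a' R) k := by
  rw [← ch_add_of_orthogonal (hQ.cidem h) (hR.cidem h) (clutchIdem_mul h hQR)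
    (clutchIdem_mul h hRQ)]
  congr 1
  funext x
  exact clutchIdem_add ..

/-- The bundle over the torus with clutching function `a` in the direction `l`. -/
noncomputable def clutch (l : κ) (a a' : (κ → ℝ) → Matrix r r ℂ) :
    (κ → ℝ) → Matrix (r ⊕ r) (r ⊕ r) ℂ := clutchIdem l a a' 1

theorem CUnit.clutchIdem_one {l : κ} {a a' : (κ → ℝ) → Matrix r r ℂ} (h : CUnit a a') :
    ClutchIdem l a a' 1 :=
  ⟨continuousOn_const, fun _ _ => by simp, fun _ _ _ _ _ => rfl, fun x _ _ => by simp [h.mul x]⟩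

theorem CUnit.clutch {l : κ} {a a' : (κ → ℝ) → Matrix r r ℂ} (h : CUnit a a') :
    CIdem (clutch l a a') := h.clutchIdem_one.cidem h

theorem clutch_apply {l : κ} {a a' : (κ → ℝ) → Matrix r r ℂ} (h : CUnit a a') (x : κ → ℝ) :
    clutch l a a' x = clutchV (Int.fract (x l)) (a x) (a' x) *
      clutchV' (Int.fract (x l)) (a x) (a' x) := by
  rw [clutch, clutchIdem, periodize, clutchCube, h.per.fract, h.per'.fract]
  simp

theorem ch_clutch_homotopy {l : κ} {a a' : unitInterval → (κ → ℝ) → Matrix r r ℂ}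
    (h : ∀ t, CUnit (a t) (a' t))
    (hc : Continuous fun p : unitInterval × (κ → ℝ) => a p.1 p.2)
    (hc' : Continuous fun p : unitInterval × (κ → ℝ) => a' p.1 p.2) (k : ℕ) :
    ch (clutch l (a 0) (a' 0)) k = ch (clutch l (a 1) (a' 1)) k := by
  refine ch_homotopy (H := fun t => clutch l (a t) (a' t)) ?_ (fun t => (h t).clutch) k
  refine FaceCompatible.continuous_periodize_uncurry
    (fun t => (h t).clutchIdem_one.faceCompatible (h t)) (Continuous.continuousOn ?_)
  obtain ⟨h1, h2⟩ := continuousOn_clutchV (S := Set.univ)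
    (t := fun p : unitInterval × (κ → ℝ) => p.2 l) (by fun_prop) hc.continuousOn hc'.continuousOn
  rw [← continuousOn_univ]
  simp only [continuousOn_iff_continuous_domRestrict] at *
  exact (h1.matrix_mul continuous_const).matrix_mul h2

theorem CUnit.one : CUnit (1 : (κ → ℝ) → Matrix r r ℂ) 1 :=
  ⟨continuous_const, continuous_const, fun _ _ => rfl, fun _ _ => rfl, fun _ => by simp,
    fun _ => by simp⟩

theorem CUnit.mul_mul {a a' b b' : (κ → ℝ) → Matrix r r ℂ} (h : CUnit a a') (g : CUnit b b') :
    CUnit (fun x => a x * b x) fun x => b' x * a' x :=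
  ⟨h.cont.matrix_mul g.cont, g.cont'.matrix_mul h.cont',
    fun x m => by simp only [h.per x m, g.per x m], fun x m => by simp only [h.per' x m, g.per' x m],
    fun x => by rw [mul_assoc, ← mul_assoc (b x), g.mul, one_mul, h.mul],
    fun x => by rw [mul_assoc, ← mul_assoc (a' x), h.mul', one_mul, g.mul']⟩

theorem ch_clutch_eq_zero {l j : κ} (hj : j ≠ l) {a a' : (κ → ℝ) → Matrix r r ℂ}
    (h : CUnit a a') (ha : ∀ x t, a (x + Pi.single j t) = a x) {k : ℕ}
    (hk : Fintype.card κ = 2 * k) : ch (clutch l a a') k = 0 := by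
  refine h.clutch.ch_eq_zero hk (l := j) fun x t => ?_
  have ha' : a' (x + Pi.single j t) = a' x := by
    have h1 := h.mul (x + Pi.single j t)
    rw [ha] at h1
    rw [← one_mul (a' (x + _)), ← h.mul' x, mul_assoc, h1, mul_one]
  rw [clutch_apply h, clutch_apply h, ha, ha']
  simp [hj.symm]

theorem CUnit.fromBlocks {a a' : (κ → ℝ) → Matrix r r ℂ} {b b' : (κ → ℝ) → Matrix s s ℂ}
    (h : CUnit a a') (g : CUnit b b') :
    CUnit (fun x => Matrix.fromBlocks (a x) 0 0 (b x)) fun x =>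
      Matrix.fromBlocks (a' x) 0 0 (b' x) :=
  ⟨h.cont.matrix_fromBlocks continuous_const continuous_const g.cont,
    h.cont'.matrix_fromBlocks continuous_const continuous_const g.cont',
    fun x m => by simp only [h.per x m, g.per x m], fun x m => by simp only [h.per' x m, g.per' x m],
    fun x => by simp [Matrix.fromBlocks_multiply, h.mul, g.mul],
    fun x => by simp [Matrix.fromBlocks_multiply, h.mul', g.mul']⟩

theorem ch_clutch_fromBlocks {l : κ} {a a' : (κ → ℝ) → Matrix r r ℂ}
    {b b' : (κ → ℝ) → Matrix s s ℂ} (h : CUnit a a') (g : CUnit b b') (k : ℕ) :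
    ch (clutch l (fun x => Matrix.fromBlocks (a x) 0 0 (b x)) fun x =>
      Matrix.fromBlocks (a' x) 0 0 (b' x)) k = ch (clutch l a a') k + ch (clutch l b b') k := by
  rw [← ch_fromBlocks h.clutch g.clutch, ← ch_reindex (h.fromBlocks g).clutch
    (Equiv.sumSumSumComm r s r s)]
  congr 1
  funext x
  rw [clutch_apply (h.fromBlocks g), clutch_apply h, clutch_apply g]
  have e1 : clutchV (Int.fract (x l)) (Matrix.fromBlocks (a x) 0 0 (b x))
      (Matrix.fromBlocks (a' x) 0 0 (b' x)) = Matrix.reindex (Equiv.sumSumSumComm r s r s).symm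
      (Equiv.refl _) (Matrix.fromBlocks (clutchV (Int.fract (x l)) (a x) (a' x)) 0 0
        (clutchV (Int.fract (x l)) (b x) (b' x))) := by
    ext i j
    rcases i with (i | i) | (i | i) <;> rcases j with j | j <;>
      simp [clutchV, Matrix.one_apply]
  have e2 : clutchV' (Int.fract (x l)) (Matrix.fromBlocks (a x) 0 0 (b x))
      (Matrix.fromBlocks (a' x) 0 0 (b' x)) = Matrix.reindex (Equiv.refl _)
      (Equiv.sumSumSumComm r s r s).symm (Matrix.fromBlocks (clutchV' (Int.fract (x l)) (a x) (a' x))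
        0 0 (clutchV' (Int.fract (x l)) (b x) (b' x))) := by
    ext i j
    rcases i with i | i <;> rcases j with (j | j) | (j | j) <;>
      simp [clutchV', Matrix.one_apply]
  rw [e1, e2]
  simp only [Matrix.reindex_apply, Matrix.submatrix_mul_equiv, Matrix.fromBlocks_multiply,
    Matrix.submatrix_submatrix]
  ext i j
  rcases i with (i | i) | (i | i) <;> rcases j with (j | j) | (j | j) <;> simp

/-- The rotation by a quarter turn of the two summands. -/
def blockRot (r : Type) [Fintype r] [DecidableEq r] (c d : ℂ) : Matrix (r ⊕ r) (r ⊕ r) ℂ :=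
  Matrix.fromBlocks (c • 1) (-d • 1) (d • 1) (c • 1)

theorem blockRot_mul {c d : ℂ} (h : c * c + d * d = 1) :
    blockRot r c d * blockRot r c (-d) = 1 := by
  rw [blockRot, blockRot, Matrix.fromBlocks_multiply, ← Matrix.fromBlocks_one]
  simp only [Matrix.mul_smul, mul_one, smul_smul, ← add_smul]
  congr 1
  · rw [show c * c + -d * -d = 1 by linear_combination h, one_smul]
  · rw [show - -d * c + c * -d = 0 by ring, zero_smul]
  · rw [show c * d + -d * c = 0 by ring, zero_smul]
  · rw [show - -d * d + c * c = 1 by linear_combination h, one_smul]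

theorem ch_clutch_mul {l j : κ} (hj : j ≠ l) {a a' b b' : (κ → ℝ) → Matrix r r ℂ}
    (h : CUnit a a') (g : CUnit b b') {k : ℕ} (hk : Fintype.card κ = 2 * k) :
    ch (clutch l (fun x => a x * b x) fun x => b' x * a' x) k =
      ch (clutch l a a') k + ch (clutch l b b') k := by
  obtain ⟨c, d, hcc, hdc, hcd, c0, d0, c1, d1⟩ := exists_rotation
  have hcd' : ∀ t, c t * c t + -d t * -d t = 1 := fun t => by rw [neg_mul_neg, hcd]
  have hR : Continuous fun t => blockRot r (c t) (d t) :=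
    (hcc.smul continuous_const).matrix_fromBlocks (hdc.neg.smul continuous_const)
      (hdc.smul continuous_const) (hcc.smul continuous_const)
  have hR' : Continuous fun t => blockRot r (c t) (-d t) :=
    (hcc.smul continuous_const).matrix_fromBlocks (hdc.neg.neg.smul continuous_const)
      (hdc.neg.smul continuous_const) (hcc.smul continuous_const)
  have hr1 : ∀ t, blockRot r (c t) (d t) * blockRot r (c t) (-d t) = 1 :=
    fun t => blockRot_mul (hcd t)
  have hr2 : ∀ t, blockRot r (c t) (-d t) * blockRot r (c t) (d t) = 1 := fun t => by
    simpa using blockRot_mul (r := r) (hcd' t)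
  have hrot : ∀ t, CUnit (fun _ : κ → ℝ => blockRot r (c t) (d t)) fun _ =>
      blockRot r (c t) (-d t) := fun t =>
    ⟨continuous_const, continuous_const, fun _ _ => rfl, fun _ _ => rfl, fun _ => hr1 t,
      fun _ => hr2 t⟩
  have hrot' : ∀ t, CUnit (fun _ : κ → ℝ => blockRot r (c t) (-d t)) fun _ =>
      blockRot r (c t) (d t) := fun t =>
    ⟨continuous_const, continuous_const, fun _ _ => rfl, fun _ _ => rfl, fun _ => hr2 t,
      fun _ => hr1 t⟩
  have hA := h.fromBlocks (CUnit.one (κ := κ) (r := r))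
  have hB := g.fromBlocks (CUnit.one (κ := κ) (r := r))
  have hH := fun t => ((hA.mul_mul (hrot t)).mul_mul hB).mul_mul (hrot' t)
  have hfst := fun {f : unitInterval → Matrix (r ⊕ r) (r ⊕ r) ℂ} (hf : Continuous f) =>
    hf.comp (continuous_fst : Continuous (Prod.fst : unitInterval × (κ → ℝ) → _))
  have hsnd := fun {f : (κ → ℝ) → Matrix (r ⊕ r) (r ⊕ r) ℂ} (hf : Continuous f) =>
    hf.comp (continuous_snd : Continuous (Prod.snd : unitInterval × (κ → ℝ) → _))
  have key := ch_clutch_homotopy (l := l) hH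
    ((((hsnd hA.cont).matrix_mul (hfst hR)).matrix_mul (hsnd hB.cont)).matrix_mul (hfst hR'))
    ((hfst hR).matrix_mul ((hsnd hB.cont').matrix_mul ((hfst hR').matrix_mul (hsnd hA.cont')))) k
  have z1 : ch (clutch l (1 : (κ → ℝ) → Matrix r r ℂ) 1) k = 0 :=
    ch_clutch_eq_zero hj CUnit.one (fun _ _ => rfl) hk
  have s0 := ch_clutch_fromBlocks (l := l) (h.mul_mul g) (CUnit.one (κ := κ) (r := r)) k
  have s1 := ch_clutch_fromBlocks (l := l) h g k
  rw [z1, add_zero] at s0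
  rw [← s0, ← s1]
  convert key using 3 <;> funext x <;>
    simp [blockRot, Matrix.fromBlocks_multiply, c0, d0, c1, d1]

theorem CUnit.pow {a a' : (κ → ℝ) → Matrix r r ℂ} (h : CUnit a a') (m : ℕ) :
    CUnit (fun x => a x ^ m) fun x => a' x ^ m := by
  induction m with
  | zero => simpa using! CUnit.one
  | succ m ih => 
    have := ih.mul_mul h
    simp only [← pow_succ, ← pow_succ'] at this
    exact this

theorem ch_clutch_pow {l j : κ} (hj : j ≠ l) {a a' : (κ → ℝ) → Matrix r r ℂ}
    (h : CUnit a a') {k : ℕ} (hk : Fintype.card κ = 2 * k) (m : ℕ) :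
    ch (clutch l (fun x => a x ^ m) fun x => a' x ^ m) k = m • ch (clutch l a a') k := by
  induction m with
  | zero =>
    simp only [pow_zero, zero_smul]
    exact ch_clutch_eq_zero hj CUnit.one (fun _ _ => rfl) hk
  | succ m ih =>
    rw [succ_nsmul, ← ih, ← ch_clutch_mul hj (h.pow m) h hk]
    simp only [pow_succ, (Commute.refl _).pow_left m |>.eq]

end Clutching

section Obstruction
open Topology Filter

variable {p R : Type} [Fintype p] [DecidableEq p] [Fintype R] [DecidableEq R]
  {r : Type} [Fintype r] [DecidableEq r]

/-- A homotopy of families of idempotents from the conjugate of `F` by `b` to `F`, relative to the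
boundary of the cube in the directions `p`, and parametrized by a sphere obtained from the
cube in the directions `R` by collapsing the boundary. -/
structure ConjHomotopy (N : ℕ) (b b' G F : (Option p ⊕ R → ℝ) → Matrix r r ℂ) : Prop where
  cont : ContinuousOn G (Set.Icc 0 1)
  idem : ∀ x ∈ Set.Icc (0 : Option p ⊕ R → ℝ) 1, G x * G x = G x
  trace : ∀ x ∈ Set.Icc (0 : Option p ⊕ R → ℝ) 1, (G x).trace = N
  zero : ∀ x ∈ Set.Icc (0 : Option p ⊕ R → ℝ) 1, x (Sum.inl none) = 0 → G x = b x * F x * b' x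
  one : ∀ x ∈ Set.Icc (0 : Option p ⊕ R → ℝ) 1, x (Sum.inl none) = 1 → G x = F x
  boundary : ∀ x ∈ Set.Icc (0 : Option p ⊕ R → ℝ) 1,
    (∃ i, x (Sum.inl (some i)) = 0 ∨ x (Sum.inl (some i)) = 1) → G x = F x
  indep : ∀ x y, (∀ i, x (Sum.inr i) = y (Sum.inr i)) → F x = F y
  collapse : ∀ x ∈ Set.Icc (0 : Option p ⊕ R → ℝ) 1, ∀ y ∈ Set.Icc (0 : Option p ⊕ R → ℝ) 1,
    (∃ i, x (Sum.inr i) = 0 ∨ x (Sum.inr i) = 1) → (∃ i, y (Sum.inr i) = 0 ∨ y (Sum.inr i) = 1) →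
    (∀ i, x (Sum.inl i) = y (Sum.inl i)) → G x = G y

variable {N : ℕ} {b b' G F : (Option p ⊕ R → ℝ) → Matrix r r ℂ}

theorem ConjHomotopy.one_sub (h : ConjHomotopy N b b' G F) (hb : CUnit b b')
    (hr : Fintype.card r = 2 * N) :
    ConjHomotopy N b b' (fun x => 1 - G x) (fun x => 1 - F x) where
  cont := continuousOn_const.sub h.cont
  idem x hx := by
    have := h.idem x hx
    simp only [mul_sub, sub_mul, this, one_mul, mul_one]
    abel
  trace x hx := by
    rw [Matrix.trace_sub, h.trace x hx, Matrix.trace_one, hr]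
    push_cast
    ring
  zero x hx h0 := by
    rw [h.zero x hx h0, mul_sub, sub_mul, mul_one, hb.mul]
  one x hx h0 := by rw [h.one x hx h0]
  boundary x hx h0 := by rw [h.boundary x hx h0]
  indep x y hxy := by rw [h.indep x y hxy]
  collapse x hx y hy h1 h2 h3 := by rw [h.collapse x hx y hy h1 h2 h3]

/-- The reparametrization of the cube which is constant on the first half of the clutching
direction. -/
noncomputable def delay (x : Option p ⊕ R → ℝ) : Option p ⊕ R → ℝ :=
  Function.update x (Sum.inl none) (max (2 * x (Sum.inl none) - 1) 0)

theorem delay_mem {x : Option p ⊕ R → ℝ} (hx : x ∈ Set.Icc (0 : Option p ⊕ R → ℝ) 1) :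
    delay x ∈ Set.Icc (0 : Option p ⊕ R → ℝ) 1 := by
  constructor <;> intro l <;> by_cases hl : l = Sum.inl none
  · subst hl; simp [delay]
  · simpa [delay, hl] using hx.1 l
  · subst hl
    have := hx.2 (Sum.inl none)
    simp only [Pi.one_apply] at this
    simp only [delay, Function.update_self, Pi.one_apply, max_le_iff]
    constructor <;> linarith
  · simpa [delay, hl] using hx.2 l

theorem continuous_delay : Continuous (delay : (Option p ⊕ R → ℝ) → _) :=
  continuous_id.update _ (by fun_prop)

@[simp] theorem delay_inr (x : Option p ⊕ R → ℝ) (i : R) : delay x (Sum.inr i) = x (Sum.inr i) := by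
  simp [delay]

@[simp] theorem delay_some (x : Option p ⊕ R → ℝ) (i : p) :
    delay x (Sum.inl (some i)) = x (Sum.inl (some i)) := by
  simp [delay]

theorem CUnit.inv_eq_one {κ : Type} [Fintype κ] [DecidableEq κ] {a a' : (κ → ℝ) → Matrix r r ℂ}
    (h : CUnit a a') {x : κ → ℝ} (hx : a x = 1) : a' x = 1 := by
  have := h.mul x
  rwa [hx, one_mul] at this

theorem clutchV_one_one (t : ℝ) : clutchV t (1 : Matrix r r ℂ) 1 = Matrix.fromRows 1 0 := by
  rw [clutchV, ← add_smul, ramp_sq]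
  simp

theorem clutchV'_one_one (t : ℝ) : clutchV' t (1 : Matrix r r ℂ) 1 = Matrix.fromCols 1 0 := by
  rw [clutchV', ← add_smul, ramp_sq]
  simp

theorem fromRows_mul_fromCols_zero (A : Matrix r r ℂ) :
    Matrix.fromRows (1 : Matrix r r ℂ) (0 : Matrix r r ℂ) * A * Matrix.fromCols 1 (0 : Matrix r r ℂ)
      = Matrix.fromBlocks A 0 0 0 := by
  simp [Matrix.fromRows_mul, Matrix.mul_fromCols]
  ext i j
  rcases i with i | i <;> rcases j with j | j <;> simp

/-- The family of idempotents over the cube that a homotopy induces on the mapping torus. -/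
noncomputable def ConjHomotopy.family (b b' G : (Option p ⊕ R → ℝ) → Matrix r r ℂ)
    (x : Option p ⊕ R → ℝ) : Matrix r r ℂ := b' x * G (delay x) * b x

theorem ConjHomotopy.family_eq_of_b_eq_one (hb : CUnit b b') {x : Option p ⊕ R → ℝ} (h1 : b x = 1) :
    family b b' G x = G (delay x) := by
  simp [family, h1, hb.inv_eq_one h1]

theorem ConjHomotopy.family_zero (h : ConjHomotopy N b b' G F) (hb : CUnit b b')
    {x : Option p ⊕ R → ℝ} (hx : x ∈ Set.Icc (0 : Option p ⊕ R → ℝ) 1)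
    (h0 : x (Sum.inl none) = 0) : family b b' G x = F x := by
  have hd : delay x = x := by simp [delay, h0]
  rw [family, hd, h.zero x hx h0]
  rw [mul_assoc, mul_assoc, hb.mul', mul_one, ← mul_assoc, hb.mul', one_mul]

theorem ConjHomotopy.clutchIdem_family (h : ConjHomotopy N b b' G F) (hb : CUnit b b')
    (hb1 : ∀ x, (∃ l ≠ Sum.inl none, ∃ m : ℤ, x l = (m : ℝ)) → b x = 1) :
    ClutchIdem (Sum.inl none) b b' (family b b' G) where
  cont := by
    have h1 := hb.cont.continuousOn (s := Set.Icc (0 : Option p ⊕ R → ℝ) 1)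
    have h2 := hb.cont'.continuousOn (s := Set.Icc (0 : Option p ⊕ R → ℝ) 1)
    have h3 : ContinuousOn (fun x => G (delay x)) (Set.Icc (0 : Option p ⊕ R → ℝ) 1) :=
      h.cont.comp continuous_delay.continuousOn fun x hx => delay_mem hx
    simp only [continuousOn_iff_continuous_domRestrict] at *
    exact (h2.matrix_mul h3).matrix_mul h1
  idem x hx := by
    have := h.idem _ (delay_mem hx)
    calc family b b' G x * family b b' G x
        = b' x * (G (delay x) * (b x * b' x) * G (delay x)) * b x := by
          simp only [family, Matrix.mul_assoc]
      _ = _ := by rw [hb.mul, mul_one, this, family]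
  face x hx i hi hxi := by
    have hx' : Function.update x i 0 ∈ Set.Icc (0 : Option p ⊕ R → ℝ) 1 := by
      constructor <;> intro j <;> rcases eq_or_ne j i with rfl | hj <;> simp [*]
      · exact hx.1 j
      · exact hx.2 j
    rw [family_eq_of_b_eq_one hb (hb1 x ⟨i, hi, 1, by simpa using hxi⟩),
      family_eq_of_b_eq_one hb (hb1 (Function.update x i 0) ⟨i, hi, 0, by simp⟩)]
    rcases i with (_ | i) | i
    · exact absurd rfl hi
    · rw [h.boundary _ (delay_mem hx) ⟨i, Or.inr (by simpa using hxi)⟩,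
        h.boundary _ (delay_mem hx') ⟨i, Or.inl (by simp)⟩]
      exact h.indep _ _ fun j => by simp
    · refine h.collapse _ (delay_mem hx') _ (delay_mem hx) ⟨i, Or.inl (by simp)⟩
        ⟨i, Or.inr (by simpa using hxi)⟩ fun j => ?_
      rcases j with _ | j <;> simp [delay]
  glue x hx h1 := by
    have hx' : Function.update x (Sum.inl none) 0 ∈ Set.Icc (0 : Option p ⊕ R → ℝ) 1 := by
      constructor <;> intro j <;> rcases eq_or_ne j (Sum.inl none) with rfl | hj <;> simp [*]
      · exact hx.1 j
      · exact hx.2 j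
    rw [h.family_zero hb hx' (by simp), family, mul_assoc, mul_assoc, hb.mul, mul_one, ← mul_assoc,
      hb.mul, one_mul, h.one _ (delay_mem hx) (by simp [delay, h1]; norm_num)]
    exact h.indep _ _ fun j => by simp

theorem ConjHomotopy.ch_eq_zero (h : ConjHomotopy N b b' G F) (hb : CUnit b b')
    (hb1 : ∀ x, (∃ l ≠ Sum.inl none, ∃ m : ℤ, x l = (m : ℝ)) → b x = 1)
    (hp : Even (Fintype.card p)) (hR : Odd (Fintype.card R)) {K : ℕ}
    (hK : 2 * K = Fintype.card (Option p) + Fintype.card R) (hNK : N < K) :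
    ch (clutchIdem (Sum.inl none) b b' (family b b' G)) K = 0 := by
  refine ((h.clutchIdem_family hb hb1).cidem hb).ch_eq_zero_of_sum
    (by rw [Fintype.card_option]; exact hp.add_one) hR hK hNK (fun x => ?_) (fun x y h1 h2 h3 => ?_)
    (fun x y h1 h2 h3 => ?_)
  · rw [trace_clutchIdem hb, family, Matrix.trace_mul_comm, ← mul_assoc, hb.mul, one_mul]
    exact h.trace _ (delay_mem (fract_mem_cube x))
  · have key : ∀ z : Option p ⊕ R → ℝ, (∃ l, ∃ m : ℤ, z (Sum.inl l) = (m : ℝ)) →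
        clutchIdem (Sum.inl none) b b' (family b b' G) z =
          Matrix.fromBlocks (F fun l => Int.fract (z l)) 0 0 0 := by
      rintro z ⟨l, m, hm⟩
      have hz := fract_mem_cube z
      have hz0 : Int.fract (z (Sum.inl l)) = 0 := by simp [hm]
      rw [clutchIdem, periodize, clutchCube]
      rcases l with _ | l
      · rw [hz0, clutchV_zero, clutchV'_zero, h.family_zero hb hz hz0, fromRows_mul_fromCols_zero]
      · have hb' := hb1 (fun l => Int.fract (z l)) ⟨Sum.inl (some l), by simp, 0, by simpa using hz0⟩
        rw [family_eq_of_b_eq_one hb hb', hb.inv_eq_one hb', hb', clutchV_one_one, clutchV'_one_one,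
          fromRows_mul_fromCols_zero, h.boundary _ (delay_mem hz) ⟨l, Or.inl (by simpa using hz0)⟩]
        rw [h.indep (delay fun l => Int.fract (z l)) (fun l => Int.fract (z l)) fun j => by simp]
    rw [key x h1, key y h2]
    rw [h.indep (fun l => Int.fract (x l)) (fun l => Int.fract (y l)) fun j => by rw [h3]]
  · have key : ∀ z : Option p ⊕ R → ℝ, (∃ l, ∃ m : ℤ, z (Sum.inr l) = (m : ℝ)) →
        clutchIdem (Sum.inl none) b b' (family b b' G) z =
          Matrix.fromBlocks (G (delay fun l => Int.fract (z l))) 0 0 0 := by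
      rintro z ⟨l, m, hm⟩
      have hb' := hb1 (fun l => Int.fract (z l)) ⟨Sum.inr l, by simp, 0, by simp [hm]⟩
      rw [clutchIdem, periodize, clutchCube, family_eq_of_b_eq_one hb hb', hb.inv_eq_one hb', hb',
        clutchV_one_one, clutchV'_one_one, fromRows_mul_fromCols_zero]
    rw [key x h1, key y h2]
    obtain ⟨i, m, hm⟩ := h1
    obtain ⟨j, m', hm'⟩ := h2
    rw [h.collapse _ (delay_mem (fract_mem_cube x)) _ (delay_mem (fract_mem_cube y))
      ⟨i, Or.inl (by simp [hm])⟩ ⟨j, Or.inl (by simp [hm'])⟩ fun l => ?_]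
    rcases l with _ | l <;> simp [delay, h3]

/-- The top Chern number of a clutching function vanishes when conjugation by it is
null-homotopic. -/
theorem ConjHomotopy.ch_clutch_eq_zero (h : ConjHomotopy N b b' G F) (hb : CUnit b b')
    (hb1 : ∀ x, (∃ l ≠ Sum.inl none, ∃ m : ℤ, x l = (m : ℝ)) → b x = 1)
    (hr : Fintype.card r = 2 * N)
    (hp : Even (Fintype.card p)) (hR : Odd (Fintype.card R)) {K : ℕ}
    (hK : 2 * K = Fintype.card (Option p) + Fintype.card R) (hNK : N < K) :
    ch (clutch (Sum.inl none) b b') K = 0 := by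
  have h' := h.one_sub hb hr
  have hsum : (fun x => family b b' G x + family b b' (fun x => 1 - G x) x) =
      (1 : (Option p ⊕ R → ℝ) → Matrix r r ℂ) := by
    funext x
    rw [family, family, ← add_mul, ← mul_add, add_sub_cancel, mul_one, hb.mul']
    rfl
  have hmul : ∀ {A B : (Option p ⊕ R → ℝ) → Matrix r r ℂ} {x}, A (delay x) * B (delay x) = 0 →
      family b b' A x * family b b' B x = 0 := fun {A B x} hAB => by
    calc family b b' A x * family b b' B x
        = b' x * (A (delay x) * (b x * b' x) * B (delay x)) * b x := by
          simp only [family, Matrix.mul_assoc]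
      _ = _ := by rw [hb.mul, mul_one, hAB]; simp
  have key := ch_clutchIdem_add hb (h.clutchIdem_family hb hb1) (h'.clutchIdem_family hb hb1)
    (fun x hx => hmul (by rw [mul_sub, mul_one, h.idem _ (delay_mem hx), sub_self]))
    (fun x hx => hmul (by rw [sub_mul, one_mul, h.idem _ (delay_mem hx), sub_self])) K
  rw [hsum, h.ch_eq_zero hb hb1 hp hR hK hNK, h'.ch_eq_zero hb hb1 hp hR hK hNK, add_zero] at key
  exact key

end Obstruction

namespace Lam
variable {κ : Type*} [DecidableEq κ]

theorem contractLeft_prod_θ (a : κ) (l : List κ) (h : a ∉ l) :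
    CliffordAlgebra.contractLeft (Q := (0 : QuadraticForm ℂ (κ → ℂ))) (LinearMap.proj a)
      (l.map θ).prod = 0 := by
  induction l with
  | nil => exact CliffordAlgebra.contractLeft_one ..
  | cons b l ih =>
    simp only [List.mem_cons, not_or] at h
    rw [List.map_cons, List.prod_cons]
    refine (CliffordAlgebra.contractLeft_ι_mul (Q := (0 : QuadraticForm ℂ (κ → ℂ))) _ _ _).trans ?_
    rw [ih h.2]
    simp [h.1]

theorem prod_θ_ne_zero {l : List κ} (h : l.Nodup) : (l.map θ).prod ≠ 0 := by
  induction l with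
  | nil => simp
  | cons a l ih =>
    rw [List.nodup_cons] at h
    intro h0
    refine ih h.2 ?_
    have h1 := (CliffordAlgebra.contractLeft_ι_mul (Q := (0 : QuadraticForm ℂ (κ → ℂ)))
      (LinearMap.proj a) (Pi.single a 1) (l.map θ).prod)
    rw [contractLeft_prod_θ a l h.1] at h1
    rw [List.map_cons, List.prod_cons] at h0
    change CliffordAlgebra.contractLeft _ (θ a * (l.map θ).prod) = _ at h1
    rw [h0, map_zero] at h1
    simpa using h1.symm

theorem commute_θ_mul (a b c d : κ) : Commute (θ a * θ b) (θ c * θ d) := by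
  have h : ∀ c, Commute (θ a * θ b) (θ c) := fun c => by
    change θ a * θ b * θ c = θ c * (θ a * θ b)
    rw [mul_assoc, θ_anticomm b c, mul_neg, ← mul_assoc, θ_anticomm a c, neg_mul, neg_neg, mul_assoc]
  exact (h c).mul_right (h d)

theorem θ_mul_sq (a b : κ) : θ a * θ b * (θ a * θ b) = 0 := by
  rw [mul_assoc, ← mul_assoc (θ b), θ_anticomm b a, neg_mul, mul_assoc, θ_sq b]
  simp

end Lam

section SumPow
variable {R : Type*} [Ring R]

theorem add_pow_of_sq_eq_zero {a b : R} (h : Commute a b) (hb : b * b = 0) (n : ℕ) :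
    (a + b) ^ (n + 1) = a ^ (n + 1) + (n + 1 : ℕ) • (a ^ n * b) := by
  induction n with
  | zero => simp
  | succ n ih =>
    rw [pow_succ, ih, add_mul, mul_add, mul_add, smul_mul_assoc, smul_mul_assoc, mul_assoc (a ^ n),
      mul_assoc (a ^ n), hb, ← h.eq, ← mul_assoc, ← pow_succ]
    simp only [mul_zero, smul_zero, add_zero, ← pow_succ]
    rw [succ_nsmul (a ^ (n + 1) * b) (n + 1)]
    abel

theorem sum_pow_of_sq_eq_zero {ι : Type*} (w : ι → R) (hc : ∀ i j, Commute (w i) (w j))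
    (hw : ∀ i, w i * w i = 0) (l : List ι) :
    (l.map w).sum ^ l.length = l.length.factorial • (l.map w).prod ∧
      (l.map w).sum ^ (l.length + 1) = 0 := by
  induction l with
  | nil => simp
  | cons i l ih =>
    have h1 : Commute (l.map w).sum (w i) := by
      refine Commute.symm ?_
      induction l with
      | nil => simp
      | cons j l ih' => 
        rw [List.map_cons, List.sum_cons]
        refine (hc i j).add_right ?_
        clear ih ih'
        induction l with
        | nil => simp
        | cons j l ih => rw [List.map_cons, List.sum_cons]; exact (hc i j).add_right ih
    rw [List.map_cons, List.sum_cons, List.prod_cons, List.length_cons, add_comm (w i),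
      add_pow_of_sq_eq_zero h1 (hw i), add_pow_of_sq_eq_zero h1 (hw i), pow_succ _ (l.length + 1),
      ih.2, ih.1]
    have h2 : (l.map w).prod * w i = w i * (l.map w).prod := by
      refine Commute.symm ?_
      refine Commute.list_prod_right _ _ fun x hx => ?_
      obtain ⟨j, -, rfl⟩ := List.mem_map.1 hx
      exact hc i j
    constructor
    · rw [zero_add, smul_mul_assoc, h2, smul_smul, Nat.factorial_succ]
    · simp

end SumPow

/-- The top power of a symplectic form. -/
theorem Lam.sum_pow_ne_zero {κ : Type*} [DecidableEq κ] {K : ℕ} (t θ' : Fin K → κ)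
    (h : ((List.finRange K).flatMap fun i => [t i, θ' i]).Nodup) (c : Fin K → ℂ)
    (hc : ∀ i, c i ≠ 0) : (∑ i, c i • (θ (t i) * θ (θ' i))) ^ K ≠ 0 := by
  have key := (sum_pow_of_sq_eq_zero (fun i => c i • (θ (t i) * θ (θ' i)))
    (fun i j => ((commute_θ_mul _ _ _ _).smul_left _).smul_right _)
    (fun i => by rw [smul_mul_smul_comm, θ_mul_sq, smul_zero]) (List.finRange K)).1
  rw [List.length_finRange, ← List.ofFn_eq_map, List.sum_ofFn] at key
  rw [key]
  have hprod : ∀ l : List (Fin K), (l.map fun i => c i • (θ (t i) * θ (θ' i))).prod =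
      (l.map c).prod • ((l.flatMap fun i => [t i, θ' i]).map θ).prod := by
    intro l
    induction l with
    | nil => simp
    | cons i l ih =>
      rw [List.map_cons, List.prod_cons, ih, smul_mul_smul_comm]
      simp [mul_assoc]
  rw [List.ofFn_eq_map, hprod, ← Nat.cast_smul_eq_nsmul ℂ, smul_smul]
  refine smul_ne_zero (mul_ne_zero (by exact_mod_cast Nat.factorial_ne_zero _) ?_) (prod_θ_ne_zero h)
  rw [Ne, List.prod_eq_zero_iff]
  simp [hc]

namespace Form
variable {E κ : Type*} [NormedAddCommGroup E] [NormedSpace ℝ E] [Fintype κ] [DecidableEq κ]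
variable {r : Type*} [Fintype r] [DecidableEq r]

theorem d_one (b : κ → E) : d b (1 : Form E κ) = 0 := by
  rw [Algebra.TensorProduct.one_def, d_tmul]
  simp [Smo.D_one]

theorem d_incl (b : κ → E) (a : Smo E) : d b (incl a : Form E κ) = ∑ l, Smo.D (b l) a ⊗ₜ Lam.θ l := by
  simp [incl_eq, d_tmul]

theorem par_incl (a : Smo E) : par (incl a : Form E κ) = incl a := by
  rw [incl_eq, par_tmul, map_one]

/-- The connection form `u · dv`. -/
noncomputable def conn (b : κ → E) (v u : r → Smo E) : Form E κ :=
  ∑ j, incl (u j) * d b (incl (v j))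

theorem conn_eq (b : κ → E) (v u : r → Smo E) :
    conn b v u = ∑ l, (∑ j, u j * Smo.D (b l) (v j)) ⊗ₜ Lam.θ l := by
  simp only [conn, d_incl, Finset.mul_sum, TensorProduct.sum_tmul]
  rw [Finset.sum_comm]
  simp [incl_eq]

theorem conn_sq (b : κ → E) (v u : r → Smo E) : conn b v u * conn b v u = 0 := by
  have h : ∀ a : κ → Smo E, (∑ l, a l ⊗ₜ[ℂ] Lam.θ l) * (∑ l, a l ⊗ₜ[ℂ] Lam.θ l)
      = (0 : Form E κ) := by
    intro a
    have h1 : (∑ l, a l ⊗ₜ[ℂ] Lam.θ l) * (∑ l, a l ⊗ₜ[ℂ] Lam.θ l)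
        = ∑ l, ∑ m, (a l * a m) ⊗ₜ[ℂ] (Lam.θ l * Lam.θ m) := by
      rw [Finset.sum_mul_sum]; simp
    have h2 : ∑ l, ∑ m, (a l * a m) ⊗ₜ[ℂ] (Lam.θ l * Lam.θ m)
        = -∑ l, ∑ m, (a l * a m) ⊗ₜ[ℂ] (Lam.θ l * Lam.θ m) := by
      conv_lhs => rw [Finset.sum_comm]
      simp only [← Finset.sum_neg_distrib]
      refine Finset.sum_congr rfl fun l _ => Finset.sum_congr rfl fun m _ => ?_
      rw [Lam.θ_anticomm, TensorProduct.tmul_neg, mul_comm (a m)]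
    rw [h1]
    have h3 : (2 : ℂ) • (∑ l, ∑ m, (a l * a m) ⊗ₜ[ℂ] (Lam.θ l * Lam.θ m) : Form E κ) = 0 := by
      rw [two_smul]
      nth_rewrite 1 [h2]
      exact neg_add_cancel _
    exact (smul_eq_zero.1 h3).resolve_left two_ne_zero
  rw [conn_eq, h]

theorem par_conn (b : κ → E) (v u : r → Smo E) : par (conn b v u) = -conn b v u := by
  rw [conn_eq, map_sum, ← Finset.sum_neg_distrib]
  simp [par_tmul, Lam.par_θ, TensorProduct.tmul_neg]

theorem d_conn (b : κ → E) (v u : r → Smo E) :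
    d b (conn b v u) = ∑ j, d b (incl (u j)) * d b (incl (v j)) := by
  simp [conn, d_mul, d_d]

theorem sum_d_mul (b : κ → E) {v u : r → Smo E} (h : ∑ j, u j * v j = 1) :
    ∑ j, d b (incl (u j) : Form E κ) * incl (v j) = -conn b v u := by
  have h1 := congrArg (fun a => d b (incl a : Form E κ)) h
  simp only [map_sum, map_mul, map_one, d_one, d_mul, par_incl, Finset.sum_add_distrib] at h1
  exact eq_neg_of_add_eq_zero_left h1

theorem chern_line (b : κ → E) {v u : r → Smo E} (h : ∑ j, u j * v j = 1) (k : ℕ) :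
    chern b (Matrix.vecMulVec v u) k = d b (conn b v u) ^ k := by
  set Ω := d b (conn b v u) with hΩ
  set W := ((Matrix.vecMulVec v u).map (incl (κ := κ))).map (d b) with hW
  have hWij : ∀ i j, W i j = d b (incl (v i)) * incl (u j) + incl (v i) * d b (incl (u j)) := by
    intro i j
    simp [hW, Matrix.vecMulVec_apply, d_mul, par_incl]
  have hinc : ∑ j, (incl (u j) : Form E κ) * incl (v j) = 1 := by
    rw [← map_one incl, ← h, map_sum]; simp
  have h1 : Matrix.vecMul (fun j => (incl (u j) : Form E κ)) W
      = fun j => conn b v u * incl (u j) + d b (incl (u j)) := by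
    ext1 j
    simp only [Matrix.vecMul, dotProduct, hWij, mul_add, Finset.sum_add_distrib, ← mul_assoc]
    rw [← Finset.sum_mul, ← Finset.sum_mul, hinc, one_mul]
    rfl
  have h2 : Matrix.vecMul (fun j => (incl (u j) : Form E κ)) (W ^ 2)
      = fun j => Ω * incl (u j) := by
    rw [sq, ← Matrix.vecMul_vecMul, h1]
    ext1 j
    simp only [Matrix.vecMul, dotProduct, hWij, mul_add, add_mul, Finset.sum_add_distrib]
    have e1 : ∑ x, conn b v u * incl (u x) * (d b (incl (v x)) * incl (u j)) = 0 := by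
      simp only [← mul_assoc]
      rw [← Finset.sum_mul]
      simp only [mul_assoc (conn b v u)]
      rw [← Finset.mul_sum]
      change conn b v u * conn b v u * _ = _
      rw [conn_sq, zero_mul]
    have e2 : ∑ x, d b (incl (u x)) * (d b (incl (v x)) * incl (u j)) = Ω * incl (u j) := by
      simp only [← mul_assoc]
      rw [← Finset.sum_mul, hΩ, d_conn]
    have e3 : ∑ x, conn b v u * incl (u x) * (incl (v x) * d b (incl (u j)))
        = conn b v u * d b (incl (u j)) := by
      simp only [mul_assoc (conn b v u), ← mul_assoc (incl (u _))]
      rw [← Finset.mul_sum, ← Finset.sum_mul, hinc, one_mul]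
    have e4 : ∑ x, d b (incl (u x)) * (incl (v x) * d b (incl (u j)))
        = -(conn b v u * d b (incl (u j))) := by
      simp only [← mul_assoc]
      rw [← Finset.sum_mul, sum_d_mul b h, neg_mul]
    rw [e1, e2, e3, e4]
    abel
  have h3 : ∀ k, Matrix.vecMul (fun j => (incl (u j) : Form E κ)) (W ^ (2 * k))
      = fun j => Ω ^ k * incl (u j) := by
    intro k
    induction k with
    | zero => simp
    | succ k ih =>
      rw [mul_add, pow_add, ← Matrix.vecMul_vecMul, ih, mul_one]
      have : (fun j => Ω ^ k * (incl (u j) : Form E κ)) = Ω ^ k • fun j => incl (u j) := rfl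
      rw [this, Matrix.smul_vecMul, h2]
      ext1 j
      simp [pow_succ, mul_assoc]
  have h4 : (Matrix.vecMulVec v u).map (incl (κ := κ))
      = Matrix.vecMulVec (fun j => incl (v j)) (fun j => incl (u j)) := by
    ext i j : 2
    simp [Matrix.vecMulVec_apply]
  rw [chern, ← hW, h4, Matrix.vecMulVec_mul, h3, Matrix.trace]
  simp only [Matrix.diag, Matrix.vecMulVec_apply]
  have : ∀ i, (incl (v i) : Form E κ) * (Ω ^ k * incl (u i)) = Ω ^ k * (incl (u i) * incl (v i)) := by
    intro i
    rw [incl_comm, mul_assoc]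
  simp only [this]
  rw [← Finset.mul_sum, hinc, mul_one]

theorem conn_mul (b : κ → E) {v u : r → Smo E} (h : ∑ j, u j * v j = 1) {g g' : Smo E}
    (hg : g' * g = 1) : conn b (fun j => g * v j) (fun j => g' * u j)
      = incl g' * d b (incl g) + conn b v u := by
  have hinc : ∑ j, (incl (u j) : Form E κ) * incl (v j) = 1 := by
    rw [← map_one incl, ← h, map_sum]; simp
  have h1 : ∀ j, (incl (g' * u j) : Form E κ) * d b (incl (g * v j))
      = incl g' * d b (incl g) * (incl (u j) * incl (v j)) + incl (u j) * d b (incl (v j)) := by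
    intro j
    rw [map_mul, map_mul, d_mul, par_incl, mul_add]
    congr 1
    · rw [mul_assoc, mul_assoc, ← mul_assoc (incl (u j)), incl_comm (u j), mul_assoc]
    · rw [← mul_assoc, mul_assoc (incl g'), incl_comm (u j), ← mul_assoc, ← map_mul, hg, map_one,
        one_mul]
  simp only [conn, h1, Finset.sum_add_distrib]
  rw [← Finset.mul_sum, hinc, mul_one]

/-- Two potentials differing by a periodic form have curvatures with the same integrals. -/
theorem I_pow_eq (b : κ → E) (z : E) {A A' : Form E κ} (hA : par A = -A) 
    (hAA' : ∀ l, tau (b l) (A - A') = A - A') (hΩ : ∀ l, tau (b l) (d b A') = d b A') (k : ℕ) :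
    I b z (d b A ^ k) = I b z (d b A' ^ k) := by
  have hpar : ∀ {A : Form E κ}, par A = -A → ∀ k, par (d b A ^ k) = d b A ^ k := by
    intro A hA k
    rw [map_pow, par_d, hA, map_neg, neg_neg]
  have hclosed : ∀ {A : Form E κ}, par A = -A → ∀ k, d b (d b A ^ k) = 0 := by
    intro A hA k
    induction k with
    | zero => rw [pow_zero, d_one]
    | succ k ih => rw [pow_succ, d_mul, ih, d_d]; simp
  have hτ : ∀ l, tau (b l) (d b A) = d b A := by
    intro l
    have : d b A = d b (A - A') + d b A' := by rw [map_sub]; abel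
    rw [this, map_add, hΩ, ← d_tau, hAA']
  have key : ∃ P : Form E κ, (∀ l, tau (b l) P = P) ∧ d b A ^ k - d b A' ^ k = d b P := by
    induction k with
    | zero => exact ⟨0, fun l => map_zero _, by simp⟩
    | succ k ih =>
      obtain ⟨P, hP, h⟩ := ih
      refine ⟨d b A ^ k * (A - A') + P * d b A', fun l => ?_, ?_⟩
      · rw [map_add, map_mul, map_mul, map_pow, hτ, hAA', hP, hΩ]
      · rw [map_add, d_mul, d_mul, hclosed hA, hpar hA, d_d, ← h, map_sub, pow_succ, pow_succ]
        simp only [mul_sub, sub_mul, zero_mul, mul_zero]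
        abel
  obtain ⟨P, hP, h⟩ := key
  have := I_d b z hP
  rwa [← h, map_sub, sub_eq_zero] at this

end Form

theorem IntPeriodic.of_single {κ : Type} {X : Type*} [Fintype κ] [DecidableEq κ] {f : (κ → ℝ) → X}
    (h : ∀ x l, f (x + Pi.single l 1) = f x) : IntPeriodic f := by
  have h1 : ∀ x l, ∀ m : ℤ, f (x + Pi.single l (m : ℝ)) = f x := by
    intro x l m
    induction m using Int.induction_on with
    | zero => simp
    | succ m ih => 
      rw [Int.cast_add, Pi.single_add, ← add_assoc, Int.cast_one, h, ih]
    | pred m ih =>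
      rw [← ih, ← h]
      rw [add_assoc, ← Pi.single_add]
      simp
  intro x m
  have h2 : ∀ s : Finset κ, f (x + ∑ l ∈ s, Pi.single l (m l : ℝ)) = f x := by
    intro s
    induction s using Finset.induction_on with
    | empty => simp
    | insert l s hl ih => rw [Finset.sum_insert hl, add_comm (Pi.single l _), ← add_assoc, h1, ih]
  rw [← h2 Finset.univ, Finset.univ_sum_single]

/-- Coordinate functions. -/
def Smo.coord {κ : Type*} [Fintype κ] (l : κ) : Smo (κ → ℝ) :=
  ⟨fun x => (x l : ℂ), show ContDiff ℝ ∞ fun x : κ → ℝ => (x l : ℂ) from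
    Complex.ofRealCLM.contDiff.comp (contDiff_apply ℝ ℝ l)⟩

theorem Smo.D_coord {κ : Type*} [Fintype κ] [DecidableEq κ] (v : κ → ℝ) (l : κ) :
    Smo.D v (Smo.coord l) = (v l : ℂ) • 1 := by
  ext x
  have : (fun x : κ → ℝ => (x l : ℂ)) = (Complex.ofRealCLM ∘L
    (ContinuousLinearMap.proj l : (κ → ℝ) →L[ℝ] ℝ) :) := rfl
  rw [Smo.D_apply]
  change fderiv ℝ (fun x : κ → ℝ => (x l : ℂ)) x v = _
  rw [this, ContinuousLinearMap.fderiv]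
  simp

section Line
variable {κ : Type} [Fintype κ] [DecidableEq κ] {r : Type} [Fintype r] [DecidableEq r]
variable {K : ℕ} (ε : Fin K × Bool ≃ κ) (deg : Fin K → ℤ)

/-- The standard symplectic form with given degrees. -/
noncomputable def lineForm : Lam κ :=
  ∑ i, (2 * Real.pi * Complex.I * deg i : ℂ) • (Lam.θ (ε (i, false)) * Lam.θ (ε (i, true)))

/-- The transition function of the line bundle with given degrees. -/
noncomputable def lineMult (i : Fin K) (x : κ → ℝ) : ℂ :=
  Complex.exp (2 * Real.pi * Complex.I * deg i * x (ε (i, true)))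

theorem Form.I_tmul_one_pow (z : κ → ℝ) (y : Lam κ) (k : ℕ) :
    Form.I (stdDir κ) z (((1 : Smo (κ → ℝ)) ⊗ₜ y : Form (κ → ℝ) κ) ^ k) = y ^ k := by
  rw [Algebra.TensorProduct.tmul_pow, one_pow, Form.I_tmul, Smo.J_apply]
  simp

theorem smo_exp_D {a g g' : Smo (κ → ℝ)} (hg : ∀ x, g.1 x = Complex.exp (a.1 x))
    (hg' : g' * g = 1) (v : κ → ℝ) : g' * Smo.D v g = Smo.D v a := by
  have : Smo.D v g = g * Smo.D v a := by
    ext x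
    rw [Smo.mul_apply, Smo.D_apply, Smo.D_apply, hg]
    have h1 : g.1 = fun x => Complex.exp (a.1 x) := funext hg
    rw [h1, ((Smo.differentiable a x).hasFDerivAt.cexp).fderiv]
    simp
  rw [this, ← mul_assoc, hg', one_mul]

theorem ch_line {v u : r → Smo (κ → ℝ)} (h : ∑ j, u j * v j = 1)
    (hvt : ∀ i x j, (v j).1 (x + Pi.single (ε (i, false)) 1) = lineMult ε deg i x * (v j).1 x)
    (hvθ : ∀ i x j, (v j).1 (x + Pi.single (ε (i, true)) 1) = (v j).1 x)
    (hut : ∀ i x j, (u j).1 (x + Pi.single (ε (i, false)) 1) = (lineMult ε deg i x)⁻¹ * (u j).1 x)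
    (huθ : ∀ i x j, (u j).1 (x + Pi.single (ε (i, true)) 1) = (u j).1 x) (k : ℕ) :
    ch (fun x => Matrix.vecMulVec (fun j => (v j).1 x) (fun j => (u j).1 x)) k
      = lineForm ε deg ^ k := by
  have hcid : CIdem fun x => Matrix.vecMulVec (fun j => (v j).1 x) (fun j => (u j).1 x) := by
    refine ⟨?_, fun x => ?_, IntPeriodic.of_single fun x l => ?_⟩
    · exact continuous_matrix fun i j => (Smo.continuous _).mul (Smo.continuous _)
    · rw [Matrix.vecMulVec_mul_vecMulVec]
      have : (fun j => (u j).1 x) ⬝ᵥ (fun j => (v j).1 x) = 1 := by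
        have := congrArg (Smo.ev x) h
        rw [map_sum, map_one] at this
        simpa [dotProduct] using this
      rw [this, one_smul]
    · obtain ⟨⟨i, s⟩, rfl⟩ := ε.surjective l
      ext j j'
      cases s
      · simp only [Matrix.vecMulVec_apply, hvt, hut]
        have : lineMult ε deg i x ≠ 0 := Complex.exp_ne_zero _
        field_simp
      · simp only [Matrix.vecMulVec_apply, hvθ, huθ]
  rw [hcid.ch_eq k (a := Matrix.vecMulVec v u) fun x => by
    ext i j; simp [Matrix.vecMulVec_apply], chernNumber, Form.chern_line _ h]
  set A' : Form (κ → ℝ) κ := ∑ i, (2 * Real.pi * Complex.I * deg i : ℂ) •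
    (Smo.coord (ε (i, false)) ⊗ₜ Lam.θ (ε (i, true))) with hA'
  have hd : Form.d (stdDir κ) A' = (1 : Smo (κ → ℝ)) ⊗ₜ lineForm ε deg := by
    simp only [hA', map_sum, map_smul, Form.d_tmul, Smo.D_coord, lineForm, TensorProduct.tmul_sum,
      TensorProduct.tmul_smul]
    refine Finset.sum_congr rfl fun i _ => ?_
    congr 1
    rw [Finset.sum_eq_single (ε (i, false))]
    · simp [stdDir]
    · intro l _ hl
      simp [stdDir, Pi.single_eq_of_ne hl.symm]
    · simp
  rw [← Form.I_tmul_one_pow 0 (lineForm ε deg), ← hd]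
  refine Form.I_pow_eq _ _ (Form.par_conn _ _ _) (fun l => ?_) (fun l => ?_) k
  · obtain ⟨⟨i, s⟩, rfl⟩ := ε.surjective l
    rw [map_sub]
    have hτ : ∀ l, Form.tau (stdDir κ l) (Form.conn (stdDir κ) v u) = Form.conn (stdDir κ)
        (fun j => Smo.tau (stdDir κ l) (v j)) (fun j => Smo.tau (stdDir κ l) (u j)) := by
      intro l
      simp only [Form.conn, map_sum, map_mul, ← Form.d_tau]
      rfl
    rw [hτ]
    cases s
    · set a : Smo (κ → ℝ) := (2 * Real.pi * Complex.I * deg i : ℂ) • Smo.coord (ε (i, true))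
      have hC : ∀ a : Smo (κ → ℝ), ContDiff ℝ ∞ fun x => Complex.exp (a.1 x) :=
        fun a => (Smo.contDiff a).cexp
      set g : Smo (κ → ℝ) := ⟨_, hC a⟩ with hg
      set g' : Smo (κ → ℝ) := ⟨_, hC (-a)⟩ with hg'
      have hgg : g' * g = 1 := by
        ext x
        change Complex.exp (-a.1 x) * Complex.exp (a.1 x) = 1
        rw [← Complex.exp_add, neg_add_cancel, Complex.exp_zero]
      have hv : (fun j => Smo.tau (stdDir κ (ε (i, false))) (v j)) = fun j => g * v j := by
        ext j x; exact hvt i x j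
      have hu : (fun j => Smo.tau (stdDir κ (ε (i, false))) (u j)) = fun j => g' * u j := by
        ext j x
        refine (hut i x j).trans ?_
        rw [lineMult, ← Complex.exp_neg]
        rfl
      rw [hv, hu, Form.conn_mul _ h hgg]
      have h1 : (Form.incl g' : Form (κ → ℝ) κ) * Form.d (stdDir κ) (Form.incl g)
          = (2 * Real.pi * Complex.I * deg i : ℂ) • ((1 : Smo (κ → ℝ)) ⊗ₜ Lam.θ (ε (i, true))) := by
        rw [Form.d_incl, Finset.mul_sum]
        simp only [Form.incl_eq, Algebra.TensorProduct.tmul_mul_tmul, one_mul]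
        have hD : ∀ l, g' * Smo.D (stdDir κ l) g
            = (2 * Real.pi * Complex.I * deg i * (stdDir κ l (ε (i, true)) : ℂ)) • 1 := by
          intro l
          rw [smo_exp_D (a := a) (fun x => rfl) hgg, map_smul, Smo.D_coord, smul_smul]
        simp only [hD]
        rw [Finset.sum_eq_single (ε (i, true))]
        · simp [stdDir, TensorProduct.smul_tmul']
        · intro l _ hl
          simp [stdDir, Pi.single_eq_of_ne hl.symm]
        · simp
      have h2 : Form.tau (stdDir κ (ε (i, false))) A' = A' +
          (2 * Real.pi * Complex.I * deg i : ℂ) • ((1 : Smo (κ → ℝ)) ⊗ₜ Lam.θ (ε (i, true))) := by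
        have h3 : ∀ i', Smo.tau (stdDir κ (ε (i, false))) (Smo.coord (ε (i', false)))
            = Smo.coord (ε (i', false)) + if i' = i then 1 else 0 := by
          intro i'
          ext x
          by_cases hi : i' = i <;> simp [Smo.coord, stdDir, hi]
        simp only [hA', map_sum, map_smul, Form.tau_tmul, h3, TensorProduct.add_tmul, smul_add,
          Finset.sum_add_distrib]
        congr 1
        rw [Finset.sum_eq_single i]
        · simp
        · intro i' _ hi; simp [hi]
        · simp
      rw [h1, h2]
      abel
    · have hv : (fun j => Smo.tau (stdDir κ (ε (i, true))) (v j)) = v := by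
        ext j x; exact hvθ i x j
      have hu : (fun j => Smo.tau (stdDir κ (ε (i, true))) (u j)) = u := by
        ext j x; exact huθ i x j
      have h2 : Form.tau (stdDir κ (ε (i, true))) A' = A' := by
        have h3 : ∀ i', Smo.tau (stdDir κ (ε (i, true))) (Smo.coord (ε (i', false)))
            = Smo.coord (ε (i', false)) := by
          intro i'
          ext x
          simp [Smo.coord, stdDir]
        simp only [hA', map_sum, map_smul, Form.tau_tmul, h3]
      rw [hv, hu, h2]
  · rw [hd]
    simp
end Line

section
open Topology Filter

/-- A function with multiplier `exp (2πi d θ)` under `t ↦ t + 1`. -/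
noncomputable def secFactor (d : ℤ) (p : ℝ × ℝ) : ℂ :=
  (expNegInvGlue (1 / 2 - Real.cos (2 * Real.pi * p.1)) : ℝ) *
    Complex.exp (2 * Real.pi * Complex.I * d * p.2 * ⌊p.1⌋)

theorem contDiff_secFactor (d : ℤ) : ContDiff ℝ ∞ (secFactor d) := by
  rw [contDiff_iff_contDiffAt]
  intro p
  rcases lt_or_ge (1 / 2) (Real.cos (2 * Real.pi * p.1)) with h | h
  · have h0 : secFactor d =ᶠ[𝓝 p] fun _ => 0 := by
      have hc : Continuous fun q : ℝ × ℝ => Real.cos (2 * Real.pi * q.1) := by fun_prop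
      filter_upwards [hc.continuousAt.eventually (lt_mem_nhds h)] with q hq
      rw [secFactor, expNegInvGlue.zero_of_nonpos (by linarith)]
      simp
    exact contDiffAt_const.congr_of_eventuallyEq h0
  · have hn : (⌊p.1⌋ : ℝ) < p.1 := by
      refine lt_of_le_of_ne (Int.floor_le _) fun h1 => ?_
      rw [← h1, mul_comm, Real.cos_int_mul_two_pi] at h
      norm_num at h
    have h0 : secFactor d =ᶠ[𝓝 p] fun q =>
        (expNegInvGlue (1 / 2 - Real.cos (2 * Real.pi * q.1)) : ℝ) *
          Complex.exp (2 * Real.pi * Complex.I * d * q.2 * ⌊p.1⌋) := by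
      filter_upwards [continuous_fst.continuousAt.eventually (lt_mem_nhds hn),
        continuous_fst.continuousAt.eventually (gt_mem_nhds (Int.lt_floor_add_one p.1))] with q h1 h2
      rw [secFactor, Int.floor_eq_iff.2 ⟨h1.le, h2⟩]
    refine ContDiffAt.congr_of_eventuallyEq (ContDiff.contDiffAt ?_) h0
    have hr : ∀ {f : ℝ × ℝ → ℝ}, ContDiff ℝ ∞ f → ContDiff ℝ ∞ fun q => (f q : ℂ) :=
      fun hf => Complex.ofRealCLM.contDiff.comp hf
    refine (hr ?_).mul ?_
    · exact expNegInvGlue.contDiff.comp (by fun_prop)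
    · refine ContDiff.cexp ?_
      have : ContDiff ℝ ∞ fun q : ℝ × ℝ => (q.2 : ℂ) := hr contDiff_snd
      fun_prop

theorem secFactor_add_one (d : ℤ) (t θ : ℝ) :
    secFactor d (t + 1, θ) = Complex.exp (2 * Real.pi * Complex.I * d * θ) * secFactor d (t, θ) := by
  simp only [secFactor, Int.floor_add_one]
  rw [mul_add, mul_one, Real.cos_add_two_pi, mul_left_comm, ← Complex.exp_add]
  congr 2
  push_cast
  ring

theorem secFactor_add_one' (d : ℤ) (t θ : ℝ) : secFactor d (t, θ + 1) = secFactor d (t, θ) := by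
  simp only [secFactor]
  congr 1
  rw [Complex.exp_eq_exp_iff_exists_int]
  refine ⟨d * ⌊t⌋, ?_⟩
  push_cast
  ring

theorem exists_secFactor_ne_zero (d : ℤ) (t θ : ℝ) :
    ∃ s : Bool, secFactor d (t + (if s then 1 / 2 else 0), θ) ≠ 0 := by
  have h : ∀ t, Real.cos (2 * Real.pi * t) < 1 / 2 → secFactor d (t, θ) ≠ 0 := by
    intro t ht
    refine mul_ne_zero ?_ (Complex.exp_ne_zero _)
    exact_mod_cast (expNegInvGlue.pos_of_pos (by linarith)).ne'
  rcases lt_or_ge (Real.cos (2 * Real.pi * t)) (1 / 2) with h1 | h1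
  · exact ⟨false, by simpa using h t h1⟩
  · refine ⟨true, ?_⟩
    rw [if_pos rfl]
    refine h _ ?_
    have : 2 * Real.pi * (t + 1 / 2) = 2 * Real.pi * t + Real.pi := by ring
    rw [this, Real.cos_add_pi]
    linarith

end

section Line
variable {κ : Type} [Fintype κ] [DecidableEq κ] {K : ℕ} (ε : Fin K × Bool ≃ κ) (deg : Fin K → ℤ)

theorem conj_lineMult (i : Fin K) (x : κ → ℝ) :
    (starRingEnd ℂ) (lineMult ε deg i x) = (lineMult ε deg i x)⁻¹ := by
  rw [lineMult, ← Complex.exp_conj, ← Complex.exp_neg]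
  congr 1
  simp [Complex.conj_ofNat]

theorem lineMult_ne_zero (i : Fin K) (x : κ → ℝ) : lineMult ε deg i x ≠ 0 := Complex.exp_ne_zero _

theorem exists_smooth_sections : ∃ v u : (Fin K → Bool) → Smo (κ → ℝ), ∑ j, u j * v j = 1 ∧
    (∀ i x j, (v j).1 (x + Pi.single (ε (i, false)) 1) = lineMult ε deg i x * (v j).1 x) ∧
    (∀ i x j, (v j).1 (x + Pi.single (ε (i, true)) 1) = (v j).1 x) ∧
    (∀ i x j, (u j).1 (x + Pi.single (ε (i, false)) 1) = (lineMult ε deg i x)⁻¹ * (u j).1 x) ∧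
    (∀ i x j, (u j).1 (x + Pi.single (ε (i, true)) 1) = (u j).1 x) := by
  set w : (Fin K → Bool) → (κ → ℝ) → ℂ := fun σ x => ∏ i,
    secFactor (deg i) (x (ε (i, false)) + (if σ i then 1 / 2 else 0), x (ε (i, true))) with hw
  have hws : ∀ σ, ContDiff ℝ ∞ (w σ) := by
    intro σ
    refine contDiff_prod fun i _ => (contDiff_secFactor _).comp ?_
    exact ((contDiff_apply ℝ ℝ _).add contDiff_const).prodMk (contDiff_apply ℝ ℝ _)
  have hwt : ∀ i x σ, w σ (x + Pi.single (ε (i, false)) 1) = lineMult ε deg i x * w σ x := by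
    intro i x σ
    have : ∀ i', secFactor (deg i') ((x + Pi.single (ε (i, false)) (1 : ℝ) : κ → ℝ) (ε (i', false)) +
        (if σ i' then 1 / 2 else 0), (x + Pi.single (ε (i, false)) (1 : ℝ) : κ → ℝ) (ε (i', true)))
        = (if i' = i then lineMult ε deg i x else 1) * secFactor (deg i')
          (x (ε (i', false)) + (if σ i' then 1 / 2 else 0), x (ε (i', true))) := by
      intro i'
      by_cases h : i' = i
      · subst h
        simp only [Pi.add_apply, Pi.single_eq_same, if_true]
        rw [add_right_comm, secFactor_add_one, Pi.single_eq_of_ne (by simp), add_zero, lineMult]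
      · simp [h]
    simp only [hw, this, Finset.prod_mul_distrib]
    simp
  have hwθ : ∀ i x σ, w σ (x + Pi.single (ε (i, true)) 1) = w σ x := by
    intro i x σ
    refine Finset.prod_congr rfl fun i' _ => ?_
    by_cases h : i' = i
    · subst h
      simp only [Pi.add_apply, Pi.single_eq_same]
      rw [secFactor_add_one', Pi.single_eq_of_ne (by simp), add_zero]
    · simp [h]
  set s : (κ → ℝ) → ℂ := fun x => ∑ σ, (starRingEnd ℂ) (w σ x) * w σ x with hs
  have hcs : ∀ σ, ContDiff ℝ ∞ fun x => (starRingEnd ℂ) (w σ x) := fun σ =>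
    Complex.conjCLE.contDiff.comp (hws σ)
  have hss : ContDiff ℝ ∞ s := ContDiff.sum fun σ _ => (hcs σ).mul (hws σ)
  have hs0 : ∀ x, s x ≠ 0 := by
    intro x
    choose σ hσ using fun i => exists_secFactor_ne_zero (deg i) (x (ε (i, false))) (x (ε (i, true)))
    have h1 : s x = ((∑ σ, Complex.normSq (w σ x) : ℝ) : ℂ) := by
      simp [hs, Complex.normSq_eq_conj_mul_self]
    rw [h1]
    have h2 : 0 < ∑ σ, Complex.normSq (w σ x) :=
      Finset.sum_pos' (fun _ _ => Complex.normSq_nonneg _) ⟨σ, Finset.mem_univ _,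
        Complex.normSq_pos.2 (Finset.prod_ne_zero_iff.2 fun i _ => hσ i)⟩
    exact_mod_cast h2.ne'
  have hst : ∀ i x, s (x + Pi.single (ε (i, false)) 1) = s x := by
    intro i x
    refine Finset.sum_congr rfl fun σ _ => ?_
    rw [hwt, map_mul, conj_lineMult]
    have := lineMult_ne_zero ε deg i x
    field_simp
  have hsθ : ∀ i x, s (x + Pi.single (ε (i, true)) 1) = s x := by
    intro i x
    simp only [hs, hwθ]
  refine ⟨fun σ => ⟨w σ, hws σ⟩, fun σ => ⟨fun x => (starRingEnd ℂ) (w σ x) * (s x)⁻¹,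
    (hcs σ).mul (hss.inv hs0)⟩, ?_, hwt, hwθ, ?_, ?_⟩
  · apply Subtype.ext
    funext x
    have h1 : ∀ F : (Fin K → Bool) → Smo (κ → ℝ), (∑ σ, F σ).1 x = ∑ σ, (F σ).1 x :=
      fun F => map_sum (Smo.ev x) F _
    rw [h1]
    simp only [Smo.mul_apply, mul_right_comm]
    rw [← Finset.sum_mul]
    exact mul_inv_cancel₀ (hs0 x)
  · intro i x σ
    change (starRingEnd ℂ) (w σ _) * (s _)⁻¹ = _ * ((starRingEnd ℂ) (w σ x) * (s x)⁻¹)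
    rw [hst, hwt, map_mul, conj_lineMult, mul_assoc]
  · intro i x σ
    change (starRingEnd ℂ) (w σ _) * (s _)⁻¹ = ((starRingEnd ℂ) (w σ x) * (s x)⁻¹)
    rw [hsθ, hwθ]

/-- A line bundle with given transition functions as a subbundle of a trivial bundle. -/
structure LineFrame {r : Type} [Fintype r] (v u : (κ → ℝ) → r → ℂ) : Prop where
  cont : ContinuousOn v (Set.Icc 0 1)
  cont' : ContinuousOn u (Set.Icc 0 1)
  mul : ∀ x ∈ Set.Icc (0 : κ → ℝ) 1, u x ⬝ᵥ v x = 1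
  face : ∀ i, ∀ x ∈ Set.Icc (0 : κ → ℝ) 1, x (ε (i, true)) = 1 →
    v (Function.update x (ε (i, true)) 0) = v x ∧ u (Function.update x (ε (i, true)) 0) = u x
  glue : ∀ i, ∀ x ∈ Set.Icc (0 : κ → ℝ) 1, x (ε (i, false)) = 1 →
    v x = lineMult ε deg i x • v (Function.update x (ε (i, false)) 0) ∧
    u x = (lineMult ε deg i x)⁻¹ • u (Function.update x (ε (i, false)) 0)

variable {ε deg} {r s : Type} [Fintype r] [Fintype s] [DecidableEq r] [DecidableEq s]

theorem LineFrame.faceCompatible {v u : (κ → ℝ) → r → ℂ} {v' u' : (κ → ℝ) → s → ℂ}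
    (h : LineFrame ε deg v u) (h' : LineFrame ε deg v' u') :
    FaceCompatible fun x => Matrix.vecMulVec (v x) (u' x) := by
  intro x hx l hl
  obtain ⟨⟨i, b⟩, rfl⟩ := ε.surjective l
  beta_reduce
  cases b
  · rw [(h.glue i x hx hl).1, (h'.glue i x hx hl).2, Matrix.smul_vecMulVec, Matrix.vecMulVec_smul,
      smul_smul, mul_inv_cancel₀ (lineMult_ne_zero ε deg i x), one_smul]
  · rw [(h.face i x hx hl).1, (h'.face i x hx hl).2]

theorem LineFrame.continuousOn {v u : (κ → ℝ) → r → ℂ} {v' u' : (κ → ℝ) → s → ℂ}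
    (h : LineFrame ε deg v u) (h' : LineFrame ε deg v' u') :
    ContinuousOn (fun x => Matrix.vecMulVec (v x) (u' x)) (Set.Icc 0 1) := by
  have h1 := h.cont
  have h2 := h'.cont'
  simp only [continuousOn_iff_continuous_domRestrict] at *
  exact h1.matrix_vecMulVec h2

theorem LineFrame.cidem {v u : (κ → ℝ) → r → ℂ} (h : LineFrame ε deg v u) :
    CIdem (periodize fun x => Matrix.vecMulVec (v x) (u x)) := by
  refine ⟨(h.faceCompatible h).continuous_periodize (h.continuousOn h), fun x => ?_,
    periodize_intPeriodic _⟩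
  simp only [periodize]
  rw [Matrix.vecMulVec_mul_vecMulVec, h.mul _ (fract_mem_cube x), one_smul]

theorem LineFrame.ch_eq {v u : (κ → ℝ) → r → ℂ} {v' u' : (κ → ℝ) → s → ℂ}
    (h : LineFrame ε deg v u) (h' : LineFrame ε deg v' u') (k : ℕ) :
    ch (periodize fun x => Matrix.vecMulVec (v x) (u x)) k
      = ch (periodize fun x => Matrix.vecMulVec (v' x) (u' x)) k := by
  have h1 : ∀ x, periodize (fun x => Matrix.vecMulVec (v x) (u x)) x
      = periodize (fun x => Matrix.vecMulVec (v x) (u' x)) x *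
        periodize (fun x => Matrix.vecMulVec (v' x) (u x)) x := by
    intro x
    simp only [periodize]
    rw [Matrix.vecMulVec_mul_vecMulVec, h'.mul _ (fract_mem_cube x), one_smul]
  have h2 : ∀ x, periodize (fun x => Matrix.vecMulVec (v' x) (u' x)) x
      = periodize (fun x => Matrix.vecMulVec (v' x) (u x)) x *
        periodize (fun x => Matrix.vecMulVec (v x) (u' x)) x := by
    intro x
    simp only [periodize]
    rw [Matrix.vecMulVec_mul_vecMulVec, h.mul _ (fract_mem_cube x), one_smul]
  have c1 := h.cidem
  have c2 := h'.cidem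
  rw [funext h1] at c1 ⊢
  rw [funext h2] at c2 ⊢
  exact ch_eq_of_equiv ((h.faceCompatible h').continuous_periodize (h.continuousOn h'))
    ((h'.faceCompatible h).continuous_periodize (h'.continuousOn h)) c1 c2
    (periodize_intPeriodic _) (periodize_intPeriodic _) k

theorem LineFrame.ch_eq_lineForm {v u : (κ → ℝ) → r → ℂ} (h : LineFrame ε deg v u) (k : ℕ) :
    ch (periodize fun x => Matrix.vecMulVec (v x) (u x)) k = lineForm ε deg ^ k := by
  obtain ⟨v', u', huv, hvt, hvθ, hut, huθ⟩ := exists_smooth_sections ε deg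
  have hupd : ∀ (x : κ → ℝ) l, x l = 1 → Function.update x l 0 + Pi.single l 1 = x := by
    intro x l hl
    ext j
    rcases eq_or_ne j l with rfl | hj
    · simp [hl]
    · simp [hj]
  have hf : LineFrame ε deg (fun x j => (v' j).1 x) (fun x j => (u' j).1 x) := by
    refine ⟨?_, ?_, fun x _ => ?_, fun i x _ hi => ⟨?_, ?_⟩, fun i x _ hi => ⟨?_, ?_⟩⟩
    · exact (continuous_pi fun j => Smo.continuous _).continuousOn
    · exact (continuous_pi fun j => Smo.continuous _).continuousOn
    · have := congrArg (Smo.ev x) huv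
      rw [map_sum, map_one] at this
      simpa [dotProduct] using this
    · ext j
      have := hvθ i (Function.update x (ε (i, true)) 0) j
      rw [hupd x _ hi] at this
      exact this.symm
    · ext j
      have := huθ i (Function.update x (ε (i, true)) 0) j
      rw [hupd x _ hi] at this
      exact this.symm
    · ext j
      have := hvt i (Function.update x (ε (i, false)) 0) j
      rw [hupd x _ hi] at this
      simpa [lineMult] using this
    · ext j
      have := hut i (Function.update x (ε (i, false)) 0) j
      rw [hupd x _ hi] at this
      simpa [lineMult] using this
  rw [h.ch_eq hf, ← ch_line ε deg huv hvt hvθ hut huθ]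
  congr 1
  refine funext fun x => ?_
  refine IntPeriodic.fract (f := fun x => Matrix.vecMulVec (fun j => (v' j).1 x) fun j => (u' j).1 x)
    (IntPeriodic.of_single fun x l => ?_) x
  obtain ⟨⟨i, b⟩, rfl⟩ := ε.surjective l
  ext j j'
  cases b
  · simp only [Matrix.vecMulVec_apply, hvt, hut]
    have := lineMult_ne_zero ε deg i x
    field_simp
  · simp only [Matrix.vecMulVec_apply, hvθ, huθ]

end Line

theorem continuous_coeff_prod_linear {X ι : Type*} [TopologicalSpace X] {a b : ι → X → ℂ}
    (ha : ∀ i, Continuous (a i)) (hb : ∀ i, Continuous (b i)) (s : Finset ι) (k : ℕ) :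
    Continuous fun x => (∏ i ∈ s, (Polynomial.C (a i x) + Polynomial.C (b i x) * Polynomial.X)).coeff k := by
  classical
  induction s using Finset.induction_on generalizing k with
  | empty => simpa using continuous_const
  | insert i s hi ih =>
    simp only [Finset.prod_insert hi, Polynomial.coeff_mul]
    refine continuous_finsetSum _ fun p _ => Continuous.mul ?_ (ih _)
    simp only [Polynomial.coeff_add, Polynomial.coeff_C, Polynomial.coeff_C_mul, Polynomial.coeff_X]
    split_ifs <;> fun_prop

/-- The isotropic vectors in `ℂ³`, parametrized by `ℂ²`. -/
noncomputable def isotropicVec (p q : ℂ) : Fin 3 → ℂ :=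
  ![p ^ 2 - q ^ 2, Complex.I * (p ^ 2 + q ^ 2), 2 * p * q]

theorem isotropicVec_dot (p q : ℂ) : ∑ k, isotropicVec p q k * isotropicVec p q k = 0 := by
  simp only [isotropicVec, Fin.sum_univ_three, Matrix.cons_val]
  linear_combination (p ^ 2 + q ^ 2) ^ 2 * Complex.I_sq

theorem isotropicVec_eq_zero {p q : ℂ} (h : isotropicVec p q = 0) : p = 0 ∧ q = 0 := by
  have h0 := congrFun h 0
  have h1 := congrFun h 1
  simp only [isotropicVec, Matrix.cons_val, Pi.zero_apply] at h0 h1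
  have h2 := (mul_eq_zero.1 h1).resolve_left Complex.I_ne_zero
  constructor
  · exact pow_eq_zero_iff two_ne_zero |>.1 (by linear_combination (h0 + h2) / 2)
  · exact pow_eq_zero_iff two_ne_zero |>.1 (by linear_combination (h2 - h0) / 2)

section Isotropic
variable {κ : Type} [Fintype κ] [DecidableEq κ] {K : ℕ} (ε : Fin K × Bool ≃ κ) (deg : Fin K → ℤ)

/-- Replace the `i`-th pair of coordinates by zero. -/
def zeroPair (i : Fin K) (x : κ → ℝ) : κ → ℝ := fun l => if (ε.symm l).1 = i then 0 else x l

/-- A unit isotropic frame of a line bundle pulled back from the torus omitting one pair of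
coordinates. -/
structure IsotropicFrame (i₀ : Fin K) {r : Type} [Fintype r] (w : (κ → ℝ) → r → ℂ) : Prop where
  cont : Continuous w
  unit : ∀ x, star (w x) ⬝ᵥ w x = 1
  iso : ∀ x, w x ⬝ᵥ w x = 0
  indep : ∀ x b s, w (Function.update x (ε (i₀, b)) s) = w x
  face : ∀ i ≠ i₀, ∀ x, x (ε (i, true)) = 1 → w (Function.update x (ε (i, true)) 0) = w x
  glue : ∀ i ≠ i₀, ∀ x, x (ε (i, false)) = 1 →
    w x = lineMult ε deg i x • w (Function.update x (ε (i, false)) 0)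
  collapse : ∀ i ≠ i₀, ∀ x b, x (ε (i, b)) = 0 → w x = w (zeroPair ε i x)

theorem ramp_phase_ne_zero (t : ℝ) {z : ℂ} (hz : z ≠ 0) :
    rampCos t ^ 2 + z * rampSin t ^ 2 ≠ 0 ∨ rampCos t * rampSin t * (z - 1) ≠ 0 := by
  by_contra! h
  obtain ⟨h1, h2⟩ := h
  have h3 := ramp_sq t
  rcases mul_eq_zero.1 h2 with h4 | h4
  · rcases mul_eq_zero.1 h4 with h5 | h5
    · have h6 : rampSin t ^ 2 = 1 := by simpa [h5] using h3
      rw [h5, h6] at h1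
      exact hz (by simpa using h1)
    · rw [h5] at h1 h3
      simp_all
  · rw [sub_eq_zero.1 h4, one_mul, h3] at h1
    exact one_ne_zero h1

set_option maxHeartbeats 1000000 in
theorem exists_isotropicFrame (i₀ : Fin K) {j : ℕ} (hj : K = 2 * j) (r : Type) [Fintype r]
    (hr : 3 * j ≤ Fintype.card r) : ∃ w : (κ → ℝ) → r → ℂ, IsotropicFrame ε (fun _ => 2) i₀ w := by
  set ph : Fin K → (κ → ℝ) → ℂ := lineMult ε (fun _ => 1) with hph
  have hphc : ∀ i, Continuous (ph i) := fun i => by simp only [hph]; unfold lineMult; fun_prop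
  set a : Fin K → (κ → ℝ) → ℂ := fun i x => rampCos (x (ε (i, false))) ^ 2 +
    ph i x * rampSin (x (ε (i, false))) ^ 2 with ha
  set b : Fin K → (κ → ℝ) → ℂ := fun i x => rampCos (x (ε (i, false))) *
    rampSin (x (ε (i, false))) * (ph i x - 1) with hb
  have hrc := continuous_rampCos
  have hrs := continuous_rampSin
  have hac : ∀ i, Continuous (a i) := fun i => by fun_prop
  have hbc : ∀ i, Continuous (b i) := fun i => by fun_prop
  set P : (κ → ℝ) → Polynomial ℂ := fun x => ∏ i ∈ Finset.univ.erase i₀,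
    (Polynomial.C (a i x) + Polynomial.C (b i x) * Polynomial.X) with hP
  have hPc : ∀ k, Continuous fun x => (P x).coeff k := continuous_coeff_prod_linear hac hbc _
  have hP0 : ∀ x, P x ≠ 0 := by
    intro x
    refine Finset.prod_ne_zero_iff.2 fun i _ h => ?_
    have h0 := congrArg (fun p => p.coeff 0) h
    have h1 := congrArg (fun p => p.coeff 1) h
    simp at h0 h1
    exact (ramp_phase_ne_zero (x (ε (i, false))) (lineMult_ne_zero ε (fun _ => 1) i x)).elim (fun h => h h0) fun h => h (by simpa [hb] using h1)
  have hPdeg : ∀ x, (P x).natDegree < K := by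
    intro x
    have h1 : (P x).natDegree ≤ ∑ i ∈ Finset.univ.erase i₀, 1 :=
      (Polynomial.natDegree_prod_le _ _).trans (Finset.sum_le_sum fun i _ => by
        rw [add_comm]; exact Polynomial.natDegree_linear_le)
    simp at h1
    have := i₀.pos
    omega
  have hPindep : ∀ x c s, P (Function.update x (ε (i₀, c)) s) = P x := by
    intro x c s
    refine Finset.prod_congr rfl fun i hi => ?_
    have hi' := Finset.ne_of_mem_erase hi
    simp [ha, hb, hph, lineMult, Function.update_of_ne, hi']
  have hPface : ∀ i ≠ i₀, ∀ x, x (ε (i, true)) = 1 → P (Function.update x (ε (i, true)) 0) = P x := by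
    intro i _ x hx
    have hphi : ∀ i', ph i' (Function.update x (ε (i, true)) 0) = ph i' x := by
      intro i'
      simp only [hph, lineMult]
      rcases eq_or_ne i' i with rfl | h
      · simp [hx]
      · rw [Function.update_of_ne (by simp [h])]
    refine Finset.prod_congr rfl fun i' _ => ?_
    simp [ha, hb, hphi]
  have hPglue : ∀ i ≠ i₀, ∀ x, x (ε (i, false)) = 1 →
      P x = Polynomial.C (ph i x) * P (Function.update x (ε (i, false)) 0) := by
    intro i hi x hx
    have h1 : ∀ i', Polynomial.C (a i' x) + Polynomial.C (b i' x) * Polynomial.X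
        = (if i' = i then Polynomial.C (ph i x) else 1) *
          (Polynomial.C (a i' (Function.update x (ε (i, false)) 0)) +
            Polynomial.C (b i' (Function.update x (ε (i, false)) 0)) * Polynomial.X) := by
      intro i'
      rcases eq_or_ne i' i with rfl | h
      · simp [ha, hb, hx]
      · simp [ha, hb, hph, lineMult, h]
    simp only [hP]
    rw [Finset.prod_congr rfl fun i' _ => h1 i', Finset.prod_mul_distrib]
    congr 1
    simp [hi]
  have hPcollapse : ∀ i ≠ i₀, ∀ x c, x (ε (i, c)) = 0 → P x = P (zeroPair ε i x) := by
    intro i _ x c hx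
    refine Finset.prod_congr rfl fun i' _ => ?_
    rcases eq_or_ne i' i with rfl | h
    · have hc0 : rampCos 0 = 1 := by simp [rampCos]
      have hs0 : rampSin 0 = 0 := by simp [rampSin]
      have h1 : a i' (zeroPair ε i' x) = 1 ∧ b i' (zeroPair ε i' x) = 0 := by
        simp [ha, hb, zeroPair, hc0, hs0]
      have h2 : a i' x = 1 ∧ b i' x = 0 := by
        cases c
        · simp [ha, hb, hx, hc0, hs0]
        · have : ph i' x = 1 := by simp [hph, lineMult, hx]
          simp [ha, hb, this, ramp_sq]
      rw [h1.1, h1.2, h2.1, h2.2]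
    · simp [ha, hb, hph, lineMult, zeroPair, h]
  set w₀ : (κ → ℝ) → Fin j × Fin 3 → ℂ := fun x k =>
    isotropicVec ((P x).coeff (2 * k.1)) ((P x).coeff (2 * k.1 + 1)) k.2 with hw₀
  have hw₀c : Continuous w₀ := by
    refine continuous_pi fun ⟨l, k⟩ => ?_
    have h1 := hPc (2 * l)
    have h2 := hPc (2 * l + 1)
    simp only [hw₀, isotropicVec]
    fin_cases k <;> simp <;> fun_prop
  have hw₀0 : ∀ x, w₀ x ≠ 0 := by
    intro x h
    refine hP0 x (Polynomial.ext fun k => ?_)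
    rw [Polynomial.coeff_zero]
    by_cases hk : k < K
    · have h1 := isotropicVec_eq_zero (p := (P x).coeff (2 * (k / 2))) (q := (P x).coeff (2 * (k / 2) + 1))
        (funext fun m => congrFun h (⟨k / 2, by omega⟩, m))
      rcases Nat.even_or_odd' k with ⟨c, rfl | rfl⟩
      · simpa using h1.1
      · have : (2 * c + 1) / 2 = c := by omega
        rw [this] at h1; exact h1.2
    · exact Polynomial.coeff_eq_zero_of_natDegree_lt ((hPdeg x).trans_le (not_lt.1 hk))
  have hw₀iso : ∀ x, w₀ x ⬝ᵥ w₀ x = 0 := by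
    intro x
    simp only [dotProduct, Fintype.sum_prod_type, hw₀, isotropicVec_dot, Finset.sum_const_zero]
  have hscale : ∀ x y (c : ℂ), P x = Polynomial.C c * P y → w₀ x = c ^ 2 • w₀ y := by
    intro x y c h
    ext ⟨l, k⟩
    simp only [hw₀, h, Polynomial.coeff_C_mul, isotropicVec, Pi.smul_apply, smul_eq_mul]
    fin_cases k <;> simp <;> ring
  set ρ : (κ → ℝ) → ℝ := fun x => Real.sqrt (∑ k, Complex.normSq (w₀ x k)) with hρ
  have hρc : Continuous ρ := Real.continuous_sqrt.comp (continuous_finsetSum _ fun k _ =>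
    Complex.continuous_normSq.comp ((continuous_apply k).comp hw₀c))
  have hpos : ∀ x, 0 < ∑ k, Complex.normSq (w₀ x k) := by
    intro x
    obtain ⟨k, hk⟩ := Function.ne_iff.1 (hw₀0 x)
    exact Finset.sum_pos' (fun _ _ => Complex.normSq_nonneg _) ⟨k, Finset.mem_univ _,
        Complex.normSq_pos.2 hk⟩
  have hρ0 : ∀ x, ρ x ≠ 0 := fun x => (Real.sqrt_pos.2 (hpos x)).ne'
  have hρeq : ∀ x y (c : ℂ), ‖c‖ = 1 → w₀ x = c • w₀ y → ρ x = ρ y := by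
    intro x y c hc h
    simp [hρ, h, Complex.normSq_eq_norm_sq, hc]
  obtain ⟨e⟩ : Nonempty (r ≃ (Fin j × Fin 3) ⊕ Fin (Fintype.card r - 3 * j)) :=
    Fintype.card_eq.1 (by simp; omega)
  have hunitph : ∀ i x, ‖ph i x‖ = 1 := by
    intro i x
    simp [hph, lineMult, Complex.norm_exp]
  refine ⟨fun x k => ((ρ x)⁻¹ : ℂ) * Sum.elim (w₀ x) 0 (e k), ?_, fun x => ?_, fun x => ?_,
    fun x c s => ?_, fun i hi x hx => ?_, fun i hi x hx => ?_, fun i hi x c hx => ?_⟩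
  · refine continuous_pi fun k => ?_
    have h1 : Continuous fun x => ((ρ x : ℂ))⁻¹ :=
      (Complex.continuous_ofReal.comp hρc).inv₀ fun x => Complex.ofReal_ne_zero.2 (hρ0 x)
    refine h1.mul ?_
    rcases e k with k | k
    · exact (continuous_apply k).comp hw₀c
    · exact continuous_const
  · simp only [dotProduct, Pi.star_apply]
    rw [e.sum_comp (fun k => star ((ρ x : ℂ)⁻¹ * Sum.elim (w₀ x) 0 k) * ((ρ x : ℂ)⁻¹ * Sum.elim (w₀ x) 0 k)),
      Fintype.sum_sum_type]
    simp only [Sum.elim_inl, Sum.elim_inr, Pi.zero_apply, mul_zero, Finset.sum_const_zero, add_zero]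
    have h1 : ∀ k, star ((ρ x : ℂ)⁻¹ * w₀ x k) * ((ρ x : ℂ)⁻¹ * w₀ x k)
        = ((ρ x : ℂ)⁻¹) ^ 2 * (Complex.normSq (w₀ x k) : ℂ) := by
      intro k
      rw [Complex.normSq_eq_conj_mul_self, star_mul']
      simp
      ring
    simp only [h1]
    rw [← Finset.mul_sum, ← Complex.ofReal_sum, inv_pow, ← Complex.ofReal_pow, hρ,
      Real.sq_sqrt (hpos x).le]
    exact inv_mul_cancel₀ (by exact_mod_cast (hpos x).ne')
  · simp only [dotProduct]
    rw [e.sum_comp (fun k => ((ρ x : ℂ)⁻¹ * Sum.elim (w₀ x) 0 k) * ((ρ x : ℂ)⁻¹ * Sum.elim (w₀ x) 0 k)),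
      Fintype.sum_sum_type]
    have h1 : ∀ k, ((ρ x : ℂ)⁻¹ * w₀ x k) * ((ρ x : ℂ)⁻¹ * w₀ x k)
        = ((ρ x : ℂ)⁻¹) ^ 2 * (w₀ x k * w₀ x k) := fun k => by ring
    simp only [Sum.elim_inl, Sum.elim_inr, Pi.zero_apply, mul_zero, Finset.sum_const_zero, add_zero, h1]
    rw [← Finset.mul_sum]
    exact mul_eq_zero_of_right _ (hw₀iso x)
  · have h : w₀ (Function.update x (ε (i₀, c)) s) = w₀ x := by simp only [hw₀, hPindep]
    simp only [hρ, h]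
  · have h : w₀ (Function.update x (ε (i, true)) 0) = w₀ x := by simp only [hw₀, hPface i hi x hx]
    simp only [hρ, h]
  · have h := hscale _ _ _ (hPglue i hi x hx)
    have h2 := hρeq _ _ _ (by rw [norm_pow, hunitph, one_pow]) h
    have h3 : ph i x ^ 2 = lineMult ε (fun _ => 2) i x := by
      simp only [hph, lineMult]
      rw [← Complex.exp_nat_mul]
      congr 1
      push_cast
      ring
    ext k
    rw [h2, h, h3]
    simp only [Pi.smul_apply, smul_eq_mul]
    rcases e k with k | k
    · simp; ring
    · simp
  · have h : w₀ x = w₀ (zeroPair ε i x) := by simp only [hw₀, ← hPcollapse i hi x c hx]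
    simp only [hρ, h]
end Isotropic

section Twist
variable {κ : Type} [Fintype κ] [DecidableEq κ] {K : ℕ} {ε : Fin K × Bool ≃ κ}
  {deg deg' : Fin K → ℤ} {r : Type} [Fintype r] [DecidableEq r] {v u : (κ → ℝ) → r → ℂ} {i₀ : Fin K}

theorem continuous_lineMult (ε : Fin K × Bool ≃ κ) (deg : Fin K → ℤ) (i : Fin K) :
    Continuous (lineMult ε deg i) := by unfold lineMult; fun_prop

theorem lineMult_update_false (ε : Fin K × Bool ≃ κ) (deg : Fin K → ℤ) (i j : Fin K) (x : κ → ℝ)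
    (t : ℝ) : lineMult ε deg i (Function.update x (ε (j, false)) t) = lineMult ε deg i x := by
  simp [lineMult]

theorem lineMult_update_true (ε : Fin K × Bool ≃ κ) (deg : Fin K → ℤ) (i j : Fin K) {x : κ → ℝ}
    (hx : x (ε (j, true)) = 1) :
    lineMult ε deg i (Function.update x (ε (j, true)) 0) = lineMult ε deg i x := by
  rcases eq_or_ne i j with rfl | h
  · simp only [lineMult, Function.update_self, hx, Complex.ofReal_zero, Complex.ofReal_one, mul_zero,
      mul_one, Complex.exp_zero]
    rw [← Complex.exp_int_mul_two_pi_mul_I (deg i)]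
    congr 1
    ring
  · simp [lineMult, h]

/-- The transport of a section of a line bundle through the clutching embedding. -/
noncomputable def twistVec (t : ℝ) (z : ℂ) (v : r → ℂ) : r ⊕ r → ℂ :=
  Sum.elim ((rampCos t ^ 2 + rampSin t ^ 2 * z) • v) ((rampCos t * rampSin t * (z⁻¹ - 1)) • v)

theorem continuousOn_twistVec {S : Set (κ → ℝ)} {v : (κ → ℝ) → r → ℂ} {z : (κ → ℝ) → ℂ} (l : κ)
    (hz : Continuous z) (hz0 : ∀ x, z x ≠ 0) (hv : ContinuousOn v S) :
    ContinuousOn (fun x => twistVec (x l) (z x) (v x)) S := by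
  have hc : Continuous fun x : κ → ℝ => rampCos (x l) := continuous_rampCos.comp (continuous_apply l)
  have hs : Continuous fun x : κ → ℝ => rampSin (x l) := continuous_rampSin.comp (continuous_apply l)
  have hz' : Continuous fun x => (z x)⁻¹ := hz.inv₀ hz0
  have hv' := continuousOn_pi.1 hv
  refine continuousOn_pi.2 fun k => ?_
  rcases k with k | k
  · exact ((hc.pow 2).add ((hs.pow 2).mul hz)).continuousOn.mul (hv' k)
  · exact ((hc.mul hs).mul (hz'.sub continuous_const)).continuousOn.mul (hv' k)

theorem clutchV_mulVec {a a' : Matrix r r ℂ} {v : r → ℂ} {z : ℂ} (h : a.mulVec v = z • v)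
    (h' : a'.mulVec v = z⁻¹ • v) (t : ℝ) : (clutchV t a a').mulVec v = twistVec t z v := by
  rw [clutchV, Matrix.fromRows_mulVec, twistVec]
  simp only [Matrix.add_mulVec, Matrix.sub_mulVec, Matrix.smul_mulVec, Matrix.one_mulVec, h, h']
  congr 1 <;> module

theorem vecMul_clutchV' {a a' : Matrix r r ℂ} {u : r → ℂ} {z : ℂ}
    (h : Matrix.vecMul u a = z • u) (h' : Matrix.vecMul u a' = z⁻¹ • u) (t : ℝ) :
    Matrix.vecMul u (clutchV' t a a') = twistVec t z⁻¹ u := by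
  rw [clutchV', Matrix.vecMul_fromCols, twistVec]
  simp only [Matrix.vecMul_add, Matrix.vecMul_sub, Matrix.vecMul_smul, Matrix.vecMul_one, h, h',
    inv_inv]
  congr 1 <;> module

theorem LineFrame.twist (h : LineFrame ε deg v u) (h0 : deg i₀ = 0)
    (hdeg : ∀ i ≠ i₀, deg' i = deg i) :
    LineFrame ε deg' (fun x => twistVec (x (ε (i₀, false))) (lineMult ε deg' i₀ x) (v x))
      (fun x => twistVec (x (ε (i₀, false))) (lineMult ε deg' i₀ x)⁻¹ (u x)) := by
  have hm := continuous_lineMult ε deg' i₀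
  have hm0 := lineMult_ne_zero ε deg' i₀
  refine ⟨continuousOn_twistVec _ hm hm0 h.cont,
    continuousOn_twistVec _ (hm.inv₀ hm0) (fun x => inv_ne_zero (hm0 x)) h.cont', fun x hx => ?_,
    fun i x hx hi => ?_, fun i x hx hi => ?_⟩
  · have h1 := h.mul x hx
    have h2 := ramp_sq (x (ε (i₀, false)))
    have h3 := mul_inv_cancel₀ (hm0 x)
    simp only [twistVec, sumElim_dotProduct_sumElim, smul_dotProduct, dotProduct_smul, h1,
      smul_eq_mul, mul_one, inv_inv]
    set c := rampCos (x (ε (i₀, false)))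
    set s := rampSin (x (ε (i₀, false)))
    linear_combination (c ^ 2 + s ^ 2 + 1) * h2 + (s ^ 4 + c ^ 2 * s ^ 2) * h3
  · have h1 := h.face i x hx hi
    have h2 : Function.update x (ε (i, true)) 0 (ε (i₀, false)) = x (ε (i₀, false)) := by simp
    simp only [h1, h2, lineMult_update_true ε deg' i₀ i hi, and_self]
  · have h1 := h.glue i x hx hi
    rcases eq_or_ne i i₀ with rfl | hne
    · have h2 : lineMult ε deg i x = 1 := by simp [lineMult, h0]
      have hc0 : rampCos 0 = 1 := by simp [rampCos]
      have hs0 : rampSin 0 = 0 := by simp [rampSin]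
      have hc1 := rampCos_of_le (t := 1) (by norm_num)
      have hs1 := rampSin_of_le (t := 1) (by norm_num)
      rw [h2, inv_one, one_smul, one_smul] at h1
      simp only [Function.update_self, hi, twistVec, hc0, hs0, hc1, hs1, h1.1, h1.2]
      constructor <;> ext (k | k) <;> simp
    · have h2 : Function.update x (ε (i, false)) 0 (ε (i₀, false)) = x (ε (i₀, false)) := by
        rw [Function.update_of_ne (by simpa using hne.symm)]
      have h3 : lineMult ε deg i x = lineMult ε deg' i x := by simp [lineMult, hdeg i hne]
      simp only [h2, lineMult_update_false, twistVec]
      constructor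
      · rw [h1.1, h3]
        ext (k | k) <;> simp <;> ring
      · rw [h1.2, h3]
        ext (k | k) <;> simp <;> ring

/-- `v` and `u` are eigenvectors of `a`, with eigenvalue the transition function of a line bundle
of degree `deg i₀` over the `i₀`-th torus. -/
structure EigenFrame (ε : Fin K × Bool ≃ κ) (deg : Fin K → ℤ) (i₀ : Fin K)
    (a a' : (κ → ℝ) → Matrix r r ℂ) (v u : (κ → ℝ) → r → ℂ) : Prop where
  right : ∀ x ∈ Set.Icc (0 : κ → ℝ) 1, (a x).mulVec (v x) = lineMult ε deg i₀ x • v x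
  right' : ∀ x ∈ Set.Icc (0 : κ → ℝ) 1, (a' x).mulVec (v x) = (lineMult ε deg i₀ x)⁻¹ • v x
  left : ∀ x ∈ Set.Icc (0 : κ → ℝ) 1, Matrix.vecMul (u x) (a x) = lineMult ε deg i₀ x • u x
  left' : ∀ x ∈ Set.Icc (0 : κ → ℝ) 1, Matrix.vecMul (u x) (a' x) = (lineMult ε deg i₀ x)⁻¹ • u x

theorem EigenFrame.clutchIdem {a a' : (κ → ℝ) → Matrix r r ℂ} (h : LineFrame ε deg v u)
    (g : EigenFrame ε deg' i₀ a a' v u) :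
    ClutchIdem (ε (i₀, false)) a a' fun x => Matrix.vecMulVec (v x) (u x) := by
  refine ⟨h.continuousOn h, fun x hx => ?_, fun x hx i _ hi => h.faceCompatible h x hx i hi,
    fun x hx hi => ?_⟩
  · rw [Matrix.vecMulVec_mul_vecMulVec, h.mul x hx, one_smul]
  · have h1 := h.faceCompatible h x hx _ hi
    beta_reduce at h1 ⊢
    rw [h1, Matrix.mul_vecMulVec, Matrix.vecMulVec_mul, g.right x hx, g.left' x hx,
      Matrix.smul_vecMulVec, Matrix.vecMulVec_smul, smul_smul,
      mul_inv_cancel₀ (lineMult_ne_zero ε deg' i₀ x), one_smul]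

theorem EigenFrame.ch_clutchIdem {a a' : (κ → ℝ) → Matrix r r ℂ} (h : LineFrame ε deg v u)
    (h0 : deg i₀ = 0) (hdeg : ∀ i ≠ i₀, deg' i = deg i)
    (g : EigenFrame ε deg' i₀ a a' v u) (k : ℕ) :
    ch (_root_.clutchIdem (ε (i₀, false)) a a' fun x => Matrix.vecMulVec (v x) (u x)) k
      = lineForm ε deg' ^ k := by
  rw [← (h.twist h0 hdeg).ch_eq_lineForm]
  congr 1
  funext x
  have hx := fract_mem_cube x
  simp only [_root_.clutchIdem, periodize, clutchCube]
  rw [Matrix.mul_vecMulVec, Matrix.vecMulVec_mul, clutchV_mulVec (g.right _ hx) (g.right' _ hx),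
    vecMul_clutchV' (g.left _ hx) (g.left' _ hx)]

end Twist

section Rotation
variable {r : Type} [Fintype r] [DecidableEq r]

/-- The matrix with eigenvalue `z` on `w`, eigenvalue `z⁻¹` on `star w`, and `1` on the orthogonal
complement. -/
noncomputable def rotAbout (z : ℂ) (w : r → ℂ) : Matrix r r ℂ :=
  1 + (z - 1) • Matrix.vecMulVec w (star w) + (z⁻¹ - 1) • Matrix.vecMulVec (star w) w

variable {w : r → ℂ}

theorem star_dot_star (h0 : w ⬝ᵥ w = 0) : star w ⬝ᵥ star w = 0 := by
  rw [Matrix.star_dotProduct_star, h0, star_zero]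

theorem rotAbout_mulVec (h1 : star w ⬝ᵥ w = 1) (h0 : w ⬝ᵥ w = 0) (z : ℂ) :
    (rotAbout z w).mulVec w = z • w := by
  simp only [rotAbout, Matrix.add_mulVec, Matrix.smul_mulVec, Matrix.one_mulVec,
    Matrix.vecMulVec_mulVec, h1, h0]
  simp
  module

theorem rotAbout_mulVec_star (h1 : star w ⬝ᵥ w = 1) (h0 : w ⬝ᵥ w = 0) (z : ℂ) :
    (rotAbout z w).mulVec (star w) = z⁻¹ • star w := by
  simp only [rotAbout, Matrix.add_mulVec, Matrix.smul_mulVec, Matrix.one_mulVec,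
    Matrix.vecMulVec_mulVec, dotProduct_comm w, h1, star_dot_star h0]
  simp
  module

theorem rotAbout_transpose (z : ℂ) (w : r → ℂ) : (rotAbout z w).transpose = rotAbout z⁻¹ w := by
  simp only [rotAbout, Matrix.transpose_add, Matrix.transpose_smul, Matrix.transpose_vecMulVec,
    Matrix.transpose_one, inv_inv]
  abel

theorem vecMul_rotAbout (h1 : star w ⬝ᵥ w = 1) (h0 : w ⬝ᵥ w = 0) (z : ℂ) :
    Matrix.vecMul w (rotAbout z w) = z⁻¹ • w := by
  rw [← Matrix.mulVec_transpose, rotAbout_transpose, rotAbout_mulVec h1 h0]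

theorem star_vecMul_rotAbout (h1 : star w ⬝ᵥ w = 1) (h0 : w ⬝ᵥ w = 0) (z : ℂ) :
    Matrix.vecMul (star w) (rotAbout z w) = z • star w := by
  rw [← Matrix.mulVec_transpose, rotAbout_transpose, rotAbout_mulVec_star h1 h0, inv_inv]

theorem rotAbout_mul (h1 : star w ⬝ᵥ w = 1) (h0 : w ⬝ᵥ w = 0) {z : ℂ} (hz : z ≠ 0) :
    rotAbout z w * rotAbout z⁻¹ w = 1 := by
  conv_lhs => enter [2]; rw [rotAbout]
  simp only [mul_add, mul_one, Matrix.mul_smul, Matrix.mul_vecMulVec, rotAbout_mulVec h1 h0,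
    rotAbout_mulVec_star h1 h0, Matrix.smul_vecMulVec, smul_smul, inv_inv, sub_mul, one_mul,
    inv_mul_cancel₀ hz, mul_inv_cancel₀ hz]
  rw [rotAbout]
  module

theorem rotAbout_one (w : r → ℂ) : rotAbout 1 w = 1 := by simp [rotAbout]

theorem conj_rotAbout {z : ℂ} (hz : (starRingEnd ℂ) z = z⁻¹) (w : r → ℂ) :
    (rotAbout z w).map (starRingEnd ℂ) = rotAbout z w := by
  ext i j
  have hz' : (starRingEnd ℂ) z⁻¹ = z := by rw [map_inv₀, hz, inv_inv]
  have h1 : (starRingEnd ℂ) ((1 : Matrix r r ℂ) i j) = (1 : Matrix r r ℂ) i j := by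
    rw [Matrix.one_apply]; split_ifs <;> simp
  simp only [rotAbout, Matrix.map_apply, Matrix.add_apply, Matrix.smul_apply, Matrix.vecMulVec_apply,
    Pi.star_apply, map_add, map_mul, map_sub, map_one, smul_eq_mul, hz, hz', h1]
  simp
  ring

/-- The projection onto the orthogonal complement of `w` and `star w`. -/
def complIdem (w : r → ℂ) : Matrix r r ℂ :=
  1 - Matrix.vecMulVec w (star w) - Matrix.vecMulVec (star w) w

theorem rotAbout_mul_complIdem (h1 : star w ⬝ᵥ w = 1) (h0 : w ⬝ᵥ w = 0) (z : ℂ) :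
    rotAbout z w * complIdem w = complIdem w := by
  simp only [complIdem, mul_sub, mul_one, Matrix.mul_vecMulVec, rotAbout_mulVec h1 h0,
    rotAbout_mulVec_star h1 h0, Matrix.smul_vecMulVec]
  rw [rotAbout]
  module

theorem complIdem_transpose (w : r → ℂ) : (complIdem w).transpose = complIdem w := by
  simp only [complIdem, Matrix.transpose_sub, Matrix.transpose_vecMulVec, Matrix.transpose_one]
  abel

theorem complIdem_mul_rotAbout (h1 : star w ⬝ᵥ w = 1) (h0 : w ⬝ᵥ w = 0) (z : ℂ) :
    complIdem w * rotAbout z w = complIdem w := by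
  have h := congrArg Matrix.transpose (rotAbout_mul_complIdem h1 h0 z⁻¹)
  rwa [Matrix.transpose_mul, complIdem_transpose, rotAbout_transpose, inv_inv] at h

theorem complIdem_mulVec (h1 : star w ⬝ᵥ w = 1) (h0 : w ⬝ᵥ w = 0) : (complIdem w).mulVec w = 0 := by
  simp only [complIdem, Matrix.sub_mulVec, Matrix.one_mulVec, Matrix.vecMulVec_mulVec, h1, h0]
  simp

theorem complIdem_mulVec_star (h1 : star w ⬝ᵥ w = 1) (h0 : w ⬝ᵥ w = 0) :
    (complIdem w).mulVec (star w) = 0 := by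
  simp only [complIdem, Matrix.sub_mulVec, Matrix.one_mulVec, Matrix.vecMulVec_mulVec,
    dotProduct_comm w, h1, star_dot_star h0]
  simp

theorem complIdem_mul_self (h1 : star w ⬝ᵥ w = 1) (h0 : w ⬝ᵥ w = 0) :
    complIdem w * complIdem w = complIdem w := by
  conv_lhs => enter [2]; rw [complIdem]
  simp [mul_sub, Matrix.mul_vecMulVec, complIdem_mulVec h1 h0, complIdem_mulVec_star h1 h0]

end Rotation

section Orth
variable {κ : Type} [Fintype κ] [DecidableEq κ] {r : Type} [Fintype r] [DecidableEq r]

/-- Continuous periodic real orthogonal matrices. -/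
structure OrthUnit (a : (κ → ℝ) → Matrix r r ℝ) : Prop where
  cont : Continuous a
  per : IntPeriodic a
  orth : ∀ x, a x * (a x).transpose = 1

theorem OrthUnit.cunit {a : (κ → ℝ) → Matrix r r ℝ} (h : OrthUnit a) :
    CUnit (fun x => (a x).map Complex.ofReal) fun x => (a x).transpose.map Complex.ofReal := by
  have e : ∀ A B : Matrix r r ℝ, A.map Complex.ofReal * B.map Complex.ofReal
      = (A * B).map Complex.ofReal := fun A B => (Matrix.map_mul (f := Complex.ofRealHom)).symm
  have e1 : (1 : Matrix r r ℝ).map Complex.ofReal = 1 :=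
    Matrix.map_one _ Complex.ofReal_zero Complex.ofReal_one
  refine ⟨h.cont.matrix_map Complex.continuous_ofReal,
    h.cont.matrix_transpose.matrix_map Complex.continuous_ofReal, fun x m => by simp only [h.per x m],
    fun x m => by simp only [h.per x m], fun x => ?_, fun x => ?_⟩
  · rw [e, h.orth, e1]
  · rw [e, mul_eq_one_comm.1 (h.orth x), e1]

end Orth

section Frames
variable {κ : Type} [Fintype κ] [DecidableEq κ] {K : ℕ} {ε : Fin K × Bool ≃ κ}
  {deg : Fin K → ℤ} {r : Type} [Fintype r] [DecidableEq r] {v u w : (κ → ℝ) → r → ℂ} {i₀ : Fin K}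

theorem lineMult_neg (ε : Fin K × Bool ≃ κ) (deg : Fin K → ℤ) (i : Fin K) (x : κ → ℝ) :
    lineMult ε (-deg) i x = (lineMult ε deg i x)⁻¹ := by
  simp only [lineMult, ← Complex.exp_neg, Pi.neg_apply]
  push_cast
  congr 1
  ring

theorem lineForm_neg (ε : Fin K × Bool ≃ κ) (deg : Fin K → ℤ) :
    lineForm ε (-deg) = -lineForm ε deg := by
  simp [lineForm]

theorem LineFrame.swap (h : LineFrame ε deg v u) : LineFrame ε (-deg) u v := by
  refine ⟨h.cont', h.cont, fun x hx => by rw [dotProduct_comm, h.mul x hx],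
    fun i x hx hi => (h.face i x hx hi).symm, fun i x hx hi => ?_⟩
  rw [lineMult_neg, inv_inv]
  exact (h.glue i x hx hi).symm

theorem IsotropicFrame.lineFrame (h : IsotropicFrame ε deg i₀ w) :
    LineFrame ε (Function.update deg i₀ 0) w fun x => star (w x) := by
  refine ⟨h.cont.continuousOn, h.cont.star.continuousOn, fun x _ => h.unit x, fun i x _ hi => ?_,
    fun i x _ hi => ?_⟩
  · have h1 : w (Function.update x (ε (i, true)) 0) = w x := by
      rcases eq_or_ne i i₀ with rfl | hne
      · exact h.indep ..
      · exact h.face i hne x hi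
    simp [h1]
  · have h1 : w x = lineMult ε (Function.update deg i₀ 0) i x • w (Function.update x (ε (i, false)) 0) := by
      rcases eq_or_ne i i₀ with rfl | hne
      · simp [lineMult, h.indep]
      · rw [h.glue i hne x hi]
        simp [lineMult, hne]
    refine ⟨h1, ?_⟩
    rw [h1, star_smul, ← conj_lineMult]
    rfl

end Frames

section Main
variable {κ : Type} [Fintype κ] [DecidableEq κ] {K : ℕ} {ε : Fin K × Bool ≃ κ}
  {r : Type} [Fintype r] [DecidableEq r] {w : (κ → ℝ) → r → ℂ} {i₀ : Fin K} {deg : Fin K → ℤ}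

theorem lineForm_pow_ne_zero (hdeg : ∀ i, deg i ≠ 0) : lineForm ε deg ^ K ≠ 0 := by
  refine Lam.sum_pow_ne_zero (fun i => ε (i, false)) (fun i => ε (i, true)) ?_ _ fun i => ?_
  · refine List.nodup_flatMap.2 ⟨fun i _ => by simp, ?_⟩
    refine (List.nodup_finRange K).imp fun {i j} hij => ?_
    simp [Function.onFun, List.disjoint_left, hij]
  · have := Complex.two_pi_I_ne_zero
    exact mul_ne_zero this (by exact_mod_cast hdeg i)

theorem CUnit.ch_clutchIdem_eq_zero {l : κ} {a a' Q : (κ → ℝ) → Matrix r r ℂ} (h : CUnit a a')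
    (hQ : ClutchIdem l a a' Q) (hQl : ∀ x t, Q (Function.update x l t) = Q x)
    (h1 : ∀ x ∈ Set.Icc (0 : κ → ℝ) 1, a x * Q x = Q x)
    (h2 : ∀ x ∈ Set.Icc (0 : κ → ℝ) 1, Q x * a x = Q x) {k : ℕ}
    (hk : Fintype.card κ = 2 * k) : ch (clutchIdem l a a' Q) k = 0 := by
  have hx : ∀ x, clutchIdem l a a' Q x
      = Matrix.fromBlocks (Q fun i => Int.fract (x i)) 0 0 0 := by
    intro x
    have hy := fract_mem_cube x
    simp only [clutchIdem, periodize, clutchCube]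
    set y : κ → ℝ := fun i => Int.fract (x i)
    have h3 : a' y * Q y = Q y := by rw [← h1 y hy, ← mul_assoc, h.mul', one_mul, h1 y hy]
    have h4 : Q y * a' y = Q y := by rw [← h2 y hy, mul_assoc, h.mul, mul_one, h2 y hy]
    have h5 : clutchV (y l) (a y) (a' y) * Q y = Matrix.fromRows (Q y) 0 := by
      rw [clutchV, Matrix.fromRows_mul]
      simp only [add_mul, sub_mul, Matrix.smul_mul, one_mul, h1 y hy, h3, sub_self, smul_zero,
        ← add_smul, ramp_sq, one_smul]
    have h6 : Q y * clutchV' (y l) (a y) (a' y) = Matrix.fromCols (Q y) 0 := by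
      rw [clutchV', Matrix.mul_fromCols]
      simp only [mul_add, mul_sub, Matrix.mul_smul, mul_one, h2 y hy, h4, sub_self, smul_zero,
        ← add_smul, ramp_sq, one_smul]
    rw [← hQ.idem y hy, ← Matrix.mul_assoc, Matrix.mul_assoc, h5, h6, Matrix.fromRows_mul_fromCols]
    simp
  refine (hQ.cidem h).ch_eq_zero hk (l := l) fun x t => ?_
  rw [hx, hx]
  congr 1
  rw [← hQl _ (Int.fract (x l))]
  congr 1
  funext i
  rcases eq_or_ne i l with rfl | hi
  · simp
  · simp [hi]

theorem ClutchIdem.add {l : κ} {a a' Q R : (κ → ℝ) → Matrix r r ℂ} (hQ : ClutchIdem l a a' Q)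
    (hR : ClutchIdem l a a' R) (hQR : ∀ x ∈ Set.Icc (0 : κ → ℝ) 1, Q x * R x = 0)
    (hRQ : ∀ x ∈ Set.Icc (0 : κ → ℝ) 1, R x * Q x = 0) : ClutchIdem l a a' fun x => Q x + R x :=
  ⟨hQ.cont.add hR.cont, fun x hx => by simp [mul_add, add_mul, hQ.idem x hx, hR.idem x hx,
    hQR x hx, hRQ x hx], fun x hx i hi h => by rw [hQ.face x hx i hi h, hR.face x hx i hi h],
    fun x hx h => by rw [mul_add, add_mul, hQ.glue x hx h, hR.glue x hx h]⟩

set_option maxHeartbeats 1000000 in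
theorem IsotropicFrame.exists_orthUnit (h : IsotropicFrame ε (fun _ => 2) i₀ w) (hK : Even K) :
    ∃ a : (κ → ℝ) → Matrix r r ℝ, OrthUnit a ∧
      (∀ x t, a (Function.update x (ε (i₀, false)) t) = a x) ∧
      (∀ x, (∃ m : ℤ, x (ε (i₀, true)) = (m : ℝ)) → a x = 1) ∧
      (∀ i ≠ i₀, ∀ x b, (∃ m : ℤ, x (ε (i, b)) = (m : ℝ)) → a x = a (zeroPair ε i x)) ∧
      ch (clutch (ε (i₀, false)) (fun x => (a x).map Complex.ofReal)
        fun x => (a x).transpose.map Complex.ofReal) K ≠ 0 := by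
  have hcard : Fintype.card κ = 2 * K := by
    rw [← Fintype.card_congr ε]; simp [mul_comm]
  set d : Fin K → ℤ := Function.update (fun _ => 2) i₀ 1 with hd
  set z := lineMult ε d i₀ with hz
  have hzc : Continuous z := continuous_lineMult ..
  have hz0 : ∀ x, z x ≠ 0 := lineMult_ne_zero ε d i₀
  have hf := h.lineFrame
  have hf' := hf.swap
  set Φ : (κ → ℝ) → Matrix r r ℂ := fun x => rotAbout (z x) (w x) with hΦ
  have hzface : FaceCompatible z := by
    intro x _ l hl
    obtain ⟨⟨i, b⟩, rfl⟩ := ε.surjective l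
    cases b
    · exact lineMult_update_false ..
    · exact lineMult_update_true ε d i₀ i hl
  have hp : FaceCompatible fun x => Matrix.vecMulVec (w x) (star (w x)) := hf.faceCompatible hf
  have hp' : FaceCompatible fun x => Matrix.vecMulVec (star (w x)) (w x) := hf'.faceCompatible hf'
  have hΦface : FaceCompatible Φ := by
    intro x hx l hl
    have e1 := hp x hx l hl
    have e2 := hp' x hx l hl
    have e3 := hzface x hx l hl
    beta_reduce at e1 e2
    simp only [hΦ, rotAbout, e1, e2, e3]
  have hpc : Continuous fun x => Matrix.vecMulVec (w x) (star (w x)) := h.cont.matrix_vecMulVec h.cont.star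
  have hpc' : Continuous fun x => Matrix.vecMulVec (star (w x)) (w x) := h.cont.star.matrix_vecMulVec h.cont
  have hΦc : Continuous Φ := by
    have h3 := hzc.inv₀ hz0
    exact (continuous_const.add ((hzc.sub continuous_const).smul hpc)).add
      ((h3.sub continuous_const).smul hpc')
  set a : (κ → ℝ) → Matrix r r ℝ := fun x => (periodize Φ x).map Complex.re with ha
  have hof : ∀ x, (a x).map Complex.ofReal = periodize Φ x := by
    intro x
    have h1 := conj_rotAbout (conj_lineMult ε d i₀ fun l => Int.fract (x l))
      (w fun l => Int.fract (x l))
    ext i j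
    exact Complex.conj_eq_iff_re.1 (congrFun (congrFun h1 i) j)
  have hofT : ∀ x, (a x).transpose.map Complex.ofReal = (periodize Φ x).transpose := by
    intro x
    rw [← hof, Matrix.transpose_map]
  have hinj : ∀ A B : Matrix r r ℝ, A.map Complex.ofReal = B.map Complex.ofReal → A = B :=
    fun A B hAB => Matrix.map_injective Complex.ofReal_injective hAB
  have e1 : (1 : Matrix r r ℝ).map Complex.ofReal = 1 :=
    Matrix.map_one _ Complex.ofReal_zero Complex.ofReal_one
  have horth : OrthUnit a := by
    refine ⟨(hΦface.continuous_periodize hΦc.continuousOn).matrix_map Complex.continuous_re,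
      fun x m => by simp only [ha, periodize_intPeriodic Φ x m], fun x => hinj _ _ ?_⟩
    have e : (a x * (a x).transpose).map Complex.ofReal
        = (a x).map Complex.ofReal * (a x).transpose.map Complex.ofReal :=
      Matrix.map_mul (f := Complex.ofRealHom)
    rw [e, hof, hofT, e1]
    simp only [periodize, hΦ, rotAbout_transpose]
    exact rotAbout_mul (h.unit _) (h.iso _) (hz0 _)
  have hindep : ∀ x t, Φ (Function.update x (ε (i₀, false)) t) = Φ x := by
    intro x t
    simp only [hΦ, h.indep, hz, lineMult_update_false]
  refine ⟨a, horth, fun x t => ?_, fun x hx => ?_, fun i hi x b ⟨m, hm⟩ => ?_, ?_⟩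
  · simp only [ha, periodize]
    rw [← hindep (fun l => Int.fract (x l)) (Int.fract t)]
    congr 2
    funext i
    by_cases hi : i = ε (i₀, false)
    · subst hi; simp
    · simp [hi]
  · refine hinj _ _ ?_
    obtain ⟨m, hm⟩ := hx
    rw [hof, e1]
    have : z (fun l => Int.fract (x l)) = 1 := by simp [hz, lineMult, hm]
    simp only [periodize, hΦ, this, rotAbout_one]
  · have h1 : (fun l => Int.fract (zeroPair ε i x l)) = zeroPair ε i fun l => Int.fract (x l) := by
      funext l
      simp only [zeroPair]
      split_ifs <;> simp
    have h2 : Φ (fun l => Int.fract (x l)) = Φ (zeroPair ε i fun l => Int.fract (x l)) := by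
      simp only [hΦ]
      rw [← h.collapse i hi (fun l => Int.fract (x l)) b (by simp [hm])]
      congr 1
      simp [hz, lineMult, zeroPair, hi.symm]
    simp only [ha, periodize, h1, h2]
  · have hcu := horth.cunit
    set A : (κ → ℝ) → Matrix r r ℂ := fun x => (a x).map Complex.ofReal with hA
    set A' : (κ → ℝ) → Matrix r r ℂ := fun x => (a x).transpose.map Complex.ofReal with hA'
    have hAx : ∀ x ∈ Set.Icc (0 : κ → ℝ) 1, A x = rotAbout (z x) (w x) := by
      intro x hx
      simp only [hA, hof]
      exact hΦface.periodize_eq hx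
    have hAx' : ∀ x ∈ Set.Icc (0 : κ → ℝ) 1, A' x = rotAbout (z x)⁻¹ (w x) := by
      intro x hx
      have : A' x = (A x).transpose := by simp only [hA, hA', hof, hofT]
      rw [this, hAx x hx, rotAbout_transpose]
    have g : EigenFrame ε d i₀ A A' w (fun x => star (w x)) := by
      refine ⟨fun x hx => ?_, fun x hx => ?_, fun x hx => ?_, fun x hx => ?_⟩
      · rw [hAx x hx, rotAbout_mulVec (h.unit x) (h.iso x)]
      · rw [hAx' x hx, rotAbout_mulVec (h.unit x) (h.iso x)]
      · rw [hAx x hx, star_vecMul_rotAbout (h.unit x) (h.iso x)]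
      · rw [hAx' x hx, star_vecMul_rotAbout (h.unit x) (h.iso x)]
    have g' : EigenFrame ε (-d) i₀ A A' (fun x => star (w x)) w := by
      refine ⟨fun x hx => ?_, fun x hx => ?_, fun x hx => ?_, fun x hx => ?_⟩ <;>
        rw [lineMult_neg]
      · rw [hAx x hx, rotAbout_mulVec_star (h.unit x) (h.iso x)]
      · rw [hAx' x hx, rotAbout_mulVec_star (h.unit x) (h.iso x)]
      · rw [hAx x hx, vecMul_rotAbout (h.unit x) (h.iso x)]
      · rw [hAx' x hx, vecMul_rotAbout (h.unit x) (h.iso x)]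
    have c1 := g.clutchIdem hf
    have c2 := g'.clutchIdem hf'
    have c3 : ClutchIdem (ε (i₀, false)) A A' fun x => complIdem (w x) := by
      refine ⟨(((continuous_const.sub hpc).sub hpc')).continuousOn,
        fun x _ => complIdem_mul_self (h.unit x) (h.iso x), fun x hx l _ hl => ?_, fun x hx hl => ?_⟩
      · have e1 := hp x hx l hl
        have e2 := hp' x hx l hl
        beta_reduce at e1 e2
        simp only [complIdem, e1, e2]
      · rw [hAx x hx, rotAbout_mul_complIdem (h.unit x) (h.iso x), hAx' x hx,
          complIdem_mul_rotAbout (h.unit x) (h.iso x), h.indep]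
    have s1 : ch (clutch (ε (i₀, false)) A A') K
        = ch (clutchIdem (ε (i₀, false)) A A' fun x => complIdem (w x)) K +
          (lineForm ε d ^ K + lineForm ε (-d) ^ K) := by
      have o1 : ∀ x, complIdem (w x) * Matrix.vecMulVec (w x) (star (w x)) = 0 := fun x => by
        rw [Matrix.mul_vecMulVec, complIdem_mulVec (h.unit x) (h.iso x), Matrix.zero_vecMulVec]
      have o2 : ∀ x, complIdem (w x) * Matrix.vecMulVec (star (w x)) (w x) = 0 := fun x => by
        rw [Matrix.mul_vecMulVec, complIdem_mulVec_star (h.unit x) (h.iso x), Matrix.zero_vecMulVec]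
      have o1' : ∀ x, Matrix.vecMulVec (star (w x)) (w x) * complIdem (w x) = 0 := fun x => by
        have := congrArg Matrix.transpose (o1 x)
        rwa [Matrix.transpose_mul, complIdem_transpose, Matrix.transpose_vecMulVec,
          Matrix.transpose_zero] at this
      have o2' : ∀ x, Matrix.vecMulVec (w x) (star (w x)) * complIdem (w x) = 0 := fun x => by
        have := congrArg Matrix.transpose (o2 x)
        rwa [Matrix.transpose_mul, complIdem_transpose, Matrix.transpose_vecMulVec,
          Matrix.transpose_zero] at this
      have o3 : ∀ x, Matrix.vecMulVec (w x) (star (w x)) * Matrix.vecMulVec (star (w x)) (w x) = 0 :=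
        fun x => by rw [Matrix.vecMulVec_mul_vecMulVec, star_dot_star (h.iso x)]; simp
      have o4 : ∀ x, Matrix.vecMulVec (star (w x)) (w x) * Matrix.vecMulVec (w x) (star (w x)) = 0 :=
        fun x => by rw [Matrix.vecMulVec_mul_vecMulVec, h.iso x]; simp
      have o5 : (1 : (κ → ℝ) → Matrix r r ℂ) = fun x => complIdem (w x) +
          (Matrix.vecMulVec (w x) (star (w x)) + Matrix.vecMulVec (star (w x)) (w x)) := by
        funext x
        rw [complIdem, Pi.one_apply]
        abel
      rw [clutch, o5, ← g.ch_clutchIdem hf (by simp) (fun i hi => by simp [hd, hi]),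
        ← g'.ch_clutchIdem hf' (by simp) (fun i hi => by simp [hd, hi]),
        ← ch_clutchIdem_add hcu c1 c2 (fun x _ => o3 x) (fun x _ => o4 x),
        ← ch_clutchIdem_add hcu c3 (c1.add c2 (fun x _ => o3 x) (fun x _ => o4 x))
          (fun x _ => by rw [mul_add, o1, o2, add_zero]) (fun x _ => by rw [add_mul, o1', o2', add_zero])]
    have s2 : ch (clutchIdem (ε (i₀, false)) A A' fun x => complIdem (w x)) K = 0 := by
      refine hcu.ch_clutchIdem_eq_zero c3 (fun x t => by rw [h.indep]) (fun x hx => ?_)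
        (fun x hx => ?_) hcard
      · rw [hAx x hx, rotAbout_mul_complIdem (h.unit x) (h.iso x)]
      · rw [hAx x hx, complIdem_mul_rotAbout (h.unit x) (h.iso x)]
    rw [s1, s2, lineForm_neg, hK.neg_pow, zero_add, ← two_smul ℂ]
    refine smul_ne_zero two_ne_zero (lineForm_pow_ne_zero fun i => ?_)
    rcases eq_or_ne i i₀ with rfl | hi
    · simp [hd]
    · simp [hd, hi]

end Main

section Delta
variable {κ : Type} [Fintype κ] [DecidableEq κ] {K : ℕ} {ε : Fin K × Bool ≃ κ}
  {r : Type} [Fintype r] [DecidableEq r] {i₀ : Fin K}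

/-- Families of orthogonal matrices that are compatible with collapsing each pair of coordinates,
and trivial on the faces belonging to `S`. -/
structure PairCollapse (ε : Fin K × Bool ≃ κ) (i₀ : Fin K) (S : Finset (Fin K))
    (a : (κ → ℝ) → Matrix r r ℝ) : Prop where
  unit : OrthUnit a
  indep : ∀ x t, a (Function.update x (ε (i₀, false)) t) = a x
  one₀ : ∀ x, (∃ m : ℤ, x (ε (i₀, true)) = (m : ℝ)) → a x = 1
  collapse : ∀ i ≠ i₀, ∀ x b, (∃ m : ℤ, x (ε (i, b)) = (m : ℝ)) → a x = a (zeroPair ε i x)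
  one : ∀ i ∈ S, ∀ x b, (∃ m : ℤ, x (ε (i, b)) = (m : ℝ)) → a x = 1

theorem zeroPair_zeroPair (i : Fin K) (x : κ → ℝ) :
    zeroPair ε i (zeroPair ε i x) = zeroPair ε i x := by
  funext l
  simp only [zeroPair]
  split_ifs <;> rfl

theorem zeroPair_comm (i j : Fin K) (x : κ → ℝ) :
    zeroPair ε i (zeroPair ε j x) = zeroPair ε j (zeroPair ε i x) := by
  funext l
  simp only [zeroPair]
  split_ifs <;> rfl

theorem OrthUnit.mul_transpose {a b : (κ → ℝ) → Matrix r r ℝ} (ha : OrthUnit a) (hb : OrthUnit b) :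
    OrthUnit fun x => a x * (b x).transpose := by
  refine ⟨ha.cont.matrix_mul hb.cont.matrix_transpose, fun x m => by
    simp only [ha.per x m, hb.per x m], fun x => ?_⟩
  rw [Matrix.transpose_mul, Matrix.transpose_transpose, mul_assoc, ← mul_assoc _ (b x),
    mul_eq_one_comm.1 (hb.orth x), one_mul, ha.orth]

theorem OrthUnit.zeroPair {a : (κ → ℝ) → Matrix r r ℝ} (ha : OrthUnit a) (i : Fin K) :
    OrthUnit fun x => a (_root_.zeroPair ε i x) := by
  refine ⟨ha.cont.comp (continuous_pi fun l => ?_), fun x m => ?_, fun x => ha.orth _⟩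
  · unfold _root_.zeroPair
    split_ifs <;> fun_prop
  · rw [← ha.per (_root_.zeroPair ε i x) fun l => if (ε.symm l).1 = i then 0 else m l]
    congr 1
    funext l
    by_cases hl : (ε.symm l).1 = i <;> simp [_root_.zeroPair, hl]

theorem PairCollapse.insert {S : Finset (Fin K)} {a : (κ → ℝ) → Matrix r r ℝ}
    (h : PairCollapse ε i₀ S a) {i : Fin K} (hi : i ≠ i₀) :
    PairCollapse ε i₀ (insert i S) fun x => a x * (a (zeroPair ε i x)).transpose := by
  have hii : ∀ x b, (∃ m : ℤ, x (ε (i, b)) = (m : ℝ)) → a x * (a (zeroPair ε i x)).transpose = 1 := by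
    intro x b hx
    rw [← h.collapse i hi x b hx, h.unit.orth]
  have hz : ∀ x j, j ≠ i → ∀ b, zeroPair ε i x (ε (j, b)) = x (ε (j, b)) := fun x j hj b => by
    simp [zeroPair, hj]
  refine ⟨h.unit.mul_transpose (h.unit.zeroPair i), fun x t => ?_, fun x hx => ?_,
    fun j hj x b hx => ?_, fun j hj x b hx => ?_⟩
  · have : zeroPair ε i (Function.update x (ε (i₀, false)) t)
        = Function.update (zeroPair ε i x) (ε (i₀, false)) t := by
      funext l
      rcases eq_or_ne l (ε (i₀, false)) with rfl | hl
      · simp [zeroPair, hi.symm]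
      · simp [zeroPair, hl]
    rw [this, h.indep, h.indep]
  · rw [h.one₀ x hx, h.one₀ _ (by rwa [hz x i₀ hi.symm])]
    simp
  · rcases eq_or_ne j i with rfl | hji
    · rw [hii x b hx, zeroPair_zeroPair, h.unit.orth]
    · rw [← h.collapse j hj x b hx, zeroPair_comm, ← h.collapse j hj (zeroPair ε i x) b]
      rwa [hz x j hji]
  · rcases eq_or_ne j i with rfl | hji
    · exact hii x b hx
    · have hjS := Finset.mem_of_mem_insert_of_ne hj hji
      rw [h.one j hjS x b hx, h.one j hjS (zeroPair ε i x) b (by rwa [hz x j hji])]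
      simp

theorem PairCollapse.ch_insert {S : Finset (Fin K)} {a : (κ → ℝ) → Matrix r r ℝ}
    (h : PairCollapse ε i₀ S a) {i : Fin K} (hi : i ≠ i₀) :
    ch (clutch (ε (i₀, false)) (fun x => (a x * (a (zeroPair ε i x)).transpose).map Complex.ofReal)
      fun x => (a x * (a (zeroPair ε i x)).transpose).transpose.map Complex.ofReal) K
      = ch (clutch (ε (i₀, false)) (fun x => (a x).map Complex.ofReal)
        fun x => (a x).transpose.map Complex.ofReal) K := by
  have hcard : Fintype.card κ = 2 * K := by
    rw [← Fintype.card_congr ε]; simp [mul_comm]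
  have hj : ε (i, false) ≠ ε (i₀, false) := by simp [hi]
  have hb := (h.unit.zeroPair (ε := ε) i).cunit
  have hb' : CUnit (fun x => (a (zeroPair ε i x)).transpose.map Complex.ofReal)
      fun x => (a (zeroPair ε i x)).map Complex.ofReal :=
    ⟨hb.cont', hb.cont, hb.per', hb.per, hb.mul', hb.mul⟩
  have e : ∀ A B : Matrix r r ℝ, (A * B).map Complex.ofReal
      = A.map Complex.ofReal * B.map Complex.ofReal := fun A B => Matrix.map_mul (f := Complex.ofRealHom)
  have key := ch_clutch_mul hj h.unit.cunit hb' hcard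
  rw [ch_clutch_eq_zero hj hb' (fun x t => ?_) hcard, add_zero] at key
  · simpa only [e, Matrix.transpose_mul, Matrix.transpose_transpose] using key
  · have : zeroPair ε i (x + Pi.single (ε (i, false)) t) = zeroPair ε i x := by
      funext l
      simp only [zeroPair, Pi.add_apply]
      split_ifs with hl
      · rfl
      · rw [Pi.single_eq_of_ne, add_zero]
        rintro rfl
        simp at hl
    rw [this]

theorem PairCollapse.exists_insert {a : (κ → ℝ) → Matrix r r ℝ} (h : PairCollapse ε i₀ ∅ a)
    (S : Finset (Fin K)) (hS : i₀ ∉ S) : ∃ b : (κ → ℝ) → Matrix r r ℝ, PairCollapse ε i₀ S b ∧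
      ch (clutch (ε (i₀, false)) (fun x => (b x).map Complex.ofReal)
        fun x => (b x).transpose.map Complex.ofReal) K
      = ch (clutch (ε (i₀, false)) (fun x => (a x).map Complex.ofReal)
        fun x => (a x).transpose.map Complex.ofReal) K := by
  induction S using Finset.induction_on with
  | empty => exact ⟨a, h, rfl⟩
  | insert i S _ ih =>
    rw [Finset.mem_insert, not_or] at hS
    obtain ⟨b, hb, hbc⟩ := ih hS.2
    exact ⟨_, hb.insert (Ne.symm hS.1), (hb.ch_insert (Ne.symm hS.1)).trans hbc⟩

/-- A family of orthogonal matrices, trivial on all faces of the cube, with nonzero top Chern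
character. -/
theorem exists_orthUnit (ε : Fin K × Bool ≃ κ) (i₀ : Fin K) {j : ℕ} (hj : K = 2 * j) (r : Type)
    [Fintype r] [DecidableEq r] (hr : 3 * j ≤ Fintype.card r) :
    ∃ a : (κ → ℝ) → Matrix r r ℝ, OrthUnit a ∧
      (∀ x t, a (Function.update x (ε (i₀, false)) t) = a x) ∧
      (∀ x, (∃ l ≠ ε (i₀, false), ∃ m : ℤ, x l = (m : ℝ)) → a x = 1) ∧
      ch (clutch (ε (i₀, false)) (fun x => (a x).map Complex.ofReal)
        fun x => (a x).transpose.map Complex.ofReal) K ≠ 0 := by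
  obtain ⟨w, hw⟩ := exists_isotropicFrame ε i₀ hj r hr
  obtain ⟨a, h1, h2, h3, h4, h5⟩ := hw.exists_orthUnit ⟨j, by omega⟩
  have h : PairCollapse ε i₀ ∅ a := ⟨h1, h2, h3, h4, fun i hi => absurd hi (Finset.notMem_empty i)⟩
  obtain ⟨b, hb, hbc⟩ := h.exists_insert (Finset.univ.erase i₀) (Finset.notMem_erase _ _)
  refine ⟨b, hb.unit, hb.indep, fun x ⟨l, hl, hm⟩ => ?_, by rwa [hbc]⟩
  obtain ⟨⟨i, c⟩, rfl⟩ := ε.surjective l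
  rcases eq_or_ne i i₀ with rfl | hi
  · cases c
    · exact absurd rfl hl
    · exact hb.one₀ x hm
  · exact hb.one i (by simp [hi]) x c hm

end Delta

section ConjLoop
open Topology Filter unitInterval
open scoped Topology.Homotopy

variable {M : ℕ} {S : Type*} [TopologicalSpace S] {N : Type*}

theorem conj_mem_Gamma {A J : Matrix (Fin M ⊕ Fin M) (Fin M ⊕ Fin M) ℝ}
    (hA : A * A.transpose = 1) (hJ : J ∈ Gamma M) : A * J * A.transpose ∈ Gamma M := by
  have hA' : A.transpose * A = 1 := mul_eq_one_comm.mp hA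
  refine ⟨?_, ?_⟩
  · have : (A * J * A.transpose).transpose * (A * J * A.transpose)
        = A * (J.transpose * ((A.transpose * A) * (J * A.transpose))) := by
      simp only [Matrix.transpose_mul, Matrix.transpose_transpose, Matrix.mul_assoc]
    rw [this, hA', one_mul, ← Matrix.mul_assoc J.transpose, hJ.1, one_mul, hA]
  · have : (A * J * A.transpose) * (A * J * A.transpose)
        = A * (J * ((A.transpose * A) * (J * A.transpose))) := by
      simp only [Matrix.mul_assoc]
    rw [this, hA', one_mul, ← Matrix.mul_assoc J, hJ.2, neg_one_mul, mul_neg, hA]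

/-- Continuous families of orthogonal matrices parametrized by a cube and a further space, which
are trivial over the boundary of the cube. -/
structure RelOrth (T : Type*) [TopologicalSpace T]
    (u : T → (N → I) → S → Matrix (Fin M ⊕ Fin M) (Fin M ⊕ Fin M) ℝ) : Prop where
  cont : Continuous fun p : (T × (N → I)) × S => u p.1.1 p.1.2 p.2
  orth : ∀ t s x, u t s x * (u t s x).transpose = 1
  boundary : ∀ t, ∀ s ∈ Cube.boundary N, ∀ x, u t s x = 1

variable {T : Type*} [TopologicalSpace T]
  {u : T → (N → I) → S → Matrix (Fin M ⊕ Fin M) (Fin M ⊕ Fin M) ℝ}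

theorem RelOrth.conj_mem [Nonempty N] (h : RelOrth T u) (f : C(S, GammaPlus M))
    (p : (T × (N → I)) × S) :
    (⟨_, conj_mem_Gamma (h.orth p.1.1 p.1.2 p.2) (f p.2).1.2⟩ : Gamma M) ∈ GammaPlus M := by
  have hc : Continuous fun w : I => u p.1.1 (fun j => w * p.1.2 j) p.2 :=
    h.cont.comp (f := fun w : I => ((p.1.1, fun j => w * p.1.2 j), p.2)) (by fun_prop)
  refine Joined.trans (f p.2).2 ⟨⟨⟨fun w => ⟨_, conj_mem_Gamma
    (h.orth p.1.1 (fun j => w * p.1.2 j) p.2) (f p.2).1.2⟩, Continuous.subtype_mk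
      ((hc.matrix_mul continuous_const).matrix_mul hc.matrix_transpose) _⟩, ?_, ?_⟩⟩
  · refine Subtype.ext ?_
    have : u p.1.1 (fun j => (0 : I) * p.1.2 j) p.2 = 1 :=
      h.boundary _ _ ⟨Classical.arbitrary N, Or.inl (zero_mul _)⟩ _
    simp only [this, Matrix.transpose_one, one_mul, mul_one]
  · refine Subtype.ext ?_
    simp

/-- The family of conjugates of a map to `Γ⁺` by a family of orthogonal matrices. -/
def RelOrth.conjMap [Nonempty N] (h : RelOrth T u) (f : C(S, GammaPlus M)) :
    C(T × (N → I), C(S, GammaPlus M)) :=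
  ContinuousMap.curry ⟨fun p => ⟨⟨_, conj_mem_Gamma (h.orth p.1.1 p.1.2 p.2) (f p.2).1.2⟩,
    h.conj_mem f p⟩, by
      have hf : Continuous fun p : (T × (N → I)) × S =>
          ((f p.2).1.1 : Matrix (Fin M ⊕ Fin M) (Fin M ⊕ Fin M) ℝ) :=
        continuous_subtype_val.comp (continuous_subtype_val.comp (f.continuous.comp continuous_snd))
      exact Continuous.subtype_mk (Continuous.subtype_mk
        ((h.cont.matrix_mul hf).matrix_mul h.cont.matrix_transpose) _) _⟩

theorem RelOrth.conjMap_coe [Nonempty N] (h : RelOrth T u) (f : C(S, GammaPlus M)) (t s x) :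
    (h.conjMap f (t, s) x).1.1 = u t s x * (f x).1.1 * (u t s x).transpose := rfl

theorem RelOrth.conjMap_boundary [Nonempty N] (h : RelOrth T u) (f : C(S, GammaPlus M)) (t)
    (s) (hs : s ∈ Cube.boundary N) : h.conjMap f (t, s) = f := by
  ext x : 3
  rw [h.conjMap_coe, h.boundary t s hs, Matrix.transpose_one, one_mul, mul_one]

variable {a b : (N → I) → S → Matrix (Fin M ⊕ Fin M) (Fin M ⊕ Fin M) ℝ}

/-- The loop of conjugates of a map to `Γ⁺` by a family of orthogonal matrices. -/
def RelOrth.loop [Nonempty N] (h : RelOrth Unit fun _ => a) (f : C(S, GammaPlus M)) :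
    Ω^ N C(S, GammaPlus M) f :=
  ⟨(h.conjMap f).comp ⟨fun s => ((), s), by fun_prop⟩, fun s hs => h.conjMap_boundary f () s hs⟩

theorem RelOrth.loop_coe [Nonempty N] (h : RelOrth Unit fun _ => a) (f : C(S, GammaPlus M)) (s x) :
    (h.loop f s x).1.1 = a s x * (f x).1.1 * (a s x).transpose := rfl

theorem RelOrth.loop_homotopic [Nonempty N]
    {u : I → (N → I) → S → Matrix (Fin M ⊕ Fin M) (Fin M ⊕ Fin M) ℝ}
    (h : RelOrth I u) (ha : RelOrth Unit fun _ => a) (hb : RelOrth Unit fun _ => b)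
    (h0 : u 0 = a) (h1 : u 1 = b) (f : C(S, GammaPlus M)) :
    GenLoop.Homotopic (ha.loop f) (hb.loop f) := by
  subst h0 h1
  refine ⟨⟨⟨h.conjMap f, fun s => rfl, fun s => rfl⟩, fun t s hs => ?_⟩⟩
  refine (h.conjMap_boundary f t s hs).trans ?_
  exact (ha.conjMap_boundary f () s hs).symm

theorem RelOrth.mul (h : RelOrth Unit fun _ => a) (h' : RelOrth Unit fun _ => b) :
    RelOrth Unit fun _ s x => a s x * b s x where
  cont := h.cont.matrix_mul h'.cont
  orth t s x := by
    rw [Matrix.transpose_mul, Matrix.mul_assoc, ← Matrix.mul_assoc (b s x), h'.orth t, one_mul,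
      h.orth t]
  boundary t s hs x := by rw [h.boundary t s hs, h'.boundary t s hs, one_mul]

theorem RelOrth.one : RelOrth Unit fun (_ : Unit) (_ : N → I) (_ : S) =>
    (1 : Matrix (Fin M ⊕ Fin M) (Fin M ⊕ Fin M) ℝ) where
  cont := continuous_const
  orth t s x := by simp
  boundary t s hs x := rfl

theorem RelOrth.pow (h : RelOrth Unit fun _ => a) (k : ℕ) :
    RelOrth Unit fun _ s x => a s x ^ k := by
  induction k with
  | zero => simpa using RelOrth.one
  | succ k ih => simpa only [pow_succ] using ih.mul h

/-- A homotopy from a pointwise product of families to their concatenation. -/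
noncomputable def concatFamily [DecidableEq N] (i : N)
    (a b : (N → I) → S → Matrix (Fin M ⊕ Fin M) (Fin M ⊕ Fin M) ℝ) (t : I) (s : N → I) (x : S) :
    Matrix (Fin M ⊕ Fin M) (Fin M ⊕ Fin M) ℝ :=
  a (Function.update s i (Set.projIcc 0 1 zero_le_one ((1 + t : ℝ) * s i))) x
    * b (Function.update s i (Set.projIcc 0 1 zero_le_one ((1 + t : ℝ) * s i - t))) x

theorem RelOrth.concat [DecidableEq N] (i : N) (h : RelOrth Unit fun _ => a)
    (h' : RelOrth Unit fun _ => b) : RelOrth I (concatFamily i a b) where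
  cont := by
    refine Continuous.matrix_mul ?_ ?_
    · refine h.cont.comp (f := fun p : (I × (N → I)) × S => (((), Function.update p.1.2 i
        (Set.projIcc 0 1 zero_le_one ((1 + p.1.1 : ℝ) * p.1.2 i))), p.2)) ?_
      refine Continuous.prodMk (Continuous.prodMk continuous_const ?_) continuous_snd
      refine Continuous.update (by fun_prop) _ (continuous_projIcc.comp (by fun_prop))
    · refine h'.cont.comp (f := fun p : (I × (N → I)) × S => (((), Function.update p.1.2 i
        (Set.projIcc 0 1 zero_le_one ((1 + p.1.1 : ℝ) * p.1.2 i - p.1.1))), p.2)) ?_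
      refine Continuous.prodMk (Continuous.prodMk continuous_const ?_) continuous_snd
      refine Continuous.update (by fun_prop) _ (continuous_projIcc.comp (by fun_prop))
  orth t s x := by
    rw [concatFamily, Matrix.transpose_mul, Matrix.mul_assoc, ← Matrix.mul_assoc (b _ x),
      h'.orth (), one_mul, h.orth ()]
  boundary t s hs x := by
    have key : ∀ w : I, (s i = 0 → w = 0) → (s i = 1 → w = 1) →
        Function.update s i w ∈ Cube.boundary N := by
      intro w h0 h1
      obtain ⟨j, hj⟩ := hs
      refine ⟨j, ?_⟩
      by_cases hji : j = i
      · subst hji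
        rw [Function.update_self]
        exact hj.imp h0 h1
      · rwa [Function.update_of_ne hji]
    rw [concatFamily, h.boundary () _ (key _ ?_ ?_), h'.boundary () _ (key _ ?_ ?_), one_mul]
    · intro h0
      exact Set.projIcc_of_le_left _ (by rw [h0]; simpa using t.2.1)
    · intro h0
      exact Set.projIcc_of_right_le _ (by rw [h0]; simp)
    · intro h0
      exact Set.projIcc_of_le_left _ (by rw [h0]; simp)
    · intro h0
      exact Set.projIcc_of_right_le _ (by rw [h0]; simpa using t.2.1)

theorem RelOrth.loop_mul [DecidableEq N] [Nonempty N] (h : RelOrth Unit fun _ => a)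
    (h' : RelOrth Unit fun _ => b) (f : C(S, GammaPlus M)) (i : N) :
    GenLoop.Homotopic ((h.mul h').loop f) (GenLoop.transAt i (h.loop f) (h'.loop f)) := by
  have h1 : RelOrth Unit fun _ => concatFamily i a b 1 :=
    ⟨(h.concat i h').cont.comp (f := fun p : (Unit × (N → I)) × S => ((1, p.1.2), p.2))
      (by fun_prop), fun _ => (h.concat i h').orth 1, fun _ => (h.concat i h').boundary 1⟩
  have e : GenLoop.transAt i (h.loop f) (h'.loop f) = h1.loop f := by
    ext s x : 4
    rw [h1.loop_coe, concatFamily, GenLoop.transAt, GenLoop.coe_copy]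
    have hs0 := (s i).2.1
    have hs1 := (s i).2.2
    split_ifs with hs
    · have : (Set.projIcc 0 1 zero_le_one ((1 + (1 : I) : ℝ) * s i - (1 : I)) : I) = 0 :=
        Set.projIcc_of_le_left _ (by push_cast; linarith)
      rw [this, h'.boundary () _ ⟨i, Or.inl (Function.update_self ..)⟩, mul_one, h.loop_coe]
      norm_num
    · have : (Set.projIcc 0 1 zero_le_one ((1 + (1 : I) : ℝ) * s i) : I) = 1 :=
        Set.projIcc_of_right_le _ (by push_cast; linarith)
      rw [this, h.boundary () _ ⟨i, Or.inr (Function.update_self ..)⟩, one_mul, h'.loop_coe]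
      norm_num
  rw [e]
  refine (h.concat i h').loop_homotopic _ _ ?_ rfl f
  funext s x
  simp [concatFamily]

theorem RelOrth.loop_pow [DecidableEq N] [Nonempty N] (h : RelOrth Unit fun _ => a)
    (f : C(S, GammaPlus M)) (k : ℕ) :
    ((show HomotopyGroup N C(S, GammaPlus M) f from ⟦h.loop f⟧) ^ k :
      HomotopyGroup N C(S, GammaPlus M) f) = ⟦(h.pow k).loop f⟧ := by
  induction k with
  | zero =>
    rw [pow_zero, HomotopyGroup.one_def]
    congr 1
    ext s x : 4
    rw [RelOrth.loop_coe]
    simp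
  | succ k ih =>
    rw [pow_succ, ih]
    have i : N := Classical.arbitrary N
    refine (HomotopyGroup.mul_spec (i := i)).trans ?_
    refine (Quotient.sound (h.loop_mul (h.pow k) f i)).symm.trans ?_
    congr 2
    funext s x
    rw [pow_succ']

end ConjLoop

section SphereCollapse
open Topology Filter unitInterval

variable {V : Type*} [NormedAddCommGroup V] [NormedSpace ℝ V]

open Classical in
/-- The map to the one-point compactification collapsing the complement of the open unit ball. -/
noncomputable def ballCollapse (y : V) : OnePoint V :=
  if ‖y‖ < 1 then (((1 - ‖y‖)⁻¹ • y : V) : OnePoint V) else OnePoint.infty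

theorem ballCollapse_of_lt {y : V} (h : ‖y‖ < 1) :
    ballCollapse y = (((1 - ‖y‖)⁻¹ • y : V) : OnePoint V) := if_pos h

theorem ballCollapse_of_le {y : V} (h : 1 ≤ ‖y‖) : ballCollapse y = OnePoint.infty :=
  if_neg h.not_gt

theorem continuous_ballCollapse : Continuous (ballCollapse (V := V)) := by
  refine continuous_iff_continuousAt.mpr fun y₀ => ?_
  rcases lt_or_ge ‖y₀‖ 1 with h | h
  · have h0 : ContinuousAt (fun y : V => (((1 - ‖y‖)⁻¹ • y : V) : OnePoint V)) y₀ := by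
      refine OnePoint.continuous_coe.continuousAt.comp ?_
      refine ContinuousAt.smul (ContinuousAt.inv₀ (by fun_prop) ?_) continuousAt_id
      linarith
    refine h0.congr ?_
    filter_upwards [continuous_norm.continuousAt.eventually (gt_mem_nhds h)] with y hy
    exact (ballCollapse_of_lt hy).symm
  · rw [ContinuousAt, ballCollapse_of_le h]
    refine (OnePoint.hasBasis_nhds_infty.tendsto_right_iff).mpr ?_
    rintro K ⟨-, hK⟩
    obtain ⟨C, hC⟩ := hK.isBounded.exists_norm_le
    set c := max C 0
    have hc0 : 0 ≤ c := le_max_right ..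
    have h1 : c / (1 + c) < ‖y₀‖ := by
      refine lt_of_lt_of_le ?_ h
      rw [div_lt_one (by linarith)]
      linarith
    filter_upwards [continuous_norm.continuousAt.eventually (lt_mem_nhds h1)] with y hy
    rcases lt_or_ge ‖y‖ 1 with h2 | h2
    · rw [ballCollapse_of_lt h2]
      refine Or.inl ⟨_, ?_, rfl⟩
      intro hmem
      have h3 := (hC _ hmem).trans (le_max_left C 0)
      rw [norm_smul, norm_inv, Real.norm_of_nonneg (by linarith : (0 : ℝ) ≤ 1 - ‖y‖),
        inv_mul_le_iff₀ (by linarith)] at h3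
      rw [div_lt_iff₀ (by linarith)] at hy
      change ‖y‖ ≤ (1 - ‖y‖) * c at h3
      nlinarith
    · rw [ballCollapse_of_le h2]
      exact Or.inr rfl

theorem exists_ballCollapse_eq [Nontrivial V] (z : OnePoint V) :
    ∃ y : V, ‖y‖ ≤ 1 ∧ ballCollapse y = z := by
  induction z using OnePoint.rec with
  | infty =>
    obtain ⟨y, hy⟩ := exists_norm_eq V (zero_le_one (α := ℝ))
    exact ⟨y, hy.le, ballCollapse_of_le hy.ge⟩
  | coe w =>
    have hw : 0 < 1 + ‖w‖ := by positivity
    have hn : ‖(1 + ‖w‖)⁻¹ • w‖ = (1 + ‖w‖)⁻¹ * ‖w‖ := by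
      rw [norm_smul, norm_inv, Real.norm_of_nonneg hw.le]
    have h1 : (1 + ‖w‖)⁻¹ * ‖w‖ < 1 := by
      rw [inv_mul_lt_iff₀ hw]; linarith
    refine ⟨(1 + ‖w‖)⁻¹ • w, hn ▸ h1.le, ?_⟩
    rw [ballCollapse_of_lt (hn ▸ h1), hn, smul_smul]
    have : (1 - (1 + ‖w‖)⁻¹ * ‖w‖)⁻¹ * (1 + ‖w‖)⁻¹ = 1 := by
      have : 1 - (1 + ‖w‖)⁻¹ * ‖w‖ = (1 + ‖w‖)⁻¹ := by field_simp; ring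
      rw [this, inv_inv, mul_inv_cancel₀ hw.ne']
    rw [this, one_smul]

theorem ballCollapse_eq_iff {y z : V} (h : ballCollapse y = ballCollapse z) :
    y = z ∨ 1 ≤ ‖y‖ ∧ 1 ≤ ‖z‖ := by
  rcases lt_or_ge ‖y‖ 1 with hy | hy <;> rcases lt_or_ge ‖z‖ 1 with hz | hz
  · left
    rw [ballCollapse_of_lt hy, ballCollapse_of_lt hz, OnePoint.coe_eq_coe] at h
    have hy' : 0 < 1 - ‖y‖ := by linarith
    have hz' : 0 < 1 - ‖z‖ := by linarith
    have hn := congrArg norm h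
    rw [norm_smul, norm_smul, norm_inv, norm_inv, Real.norm_of_nonneg hy'.le,
      Real.norm_of_nonneg hz'.le, inv_mul_eq_div, inv_mul_eq_div,
      div_eq_div_iff hy'.ne' hz'.ne'] at hn
    have : ‖y‖ = ‖z‖ := by linarith
    rw [this] at h
    exact smul_right_injective V (inv_ne_zero hz'.ne') h
  · rw [ballCollapse_of_lt hy, ballCollapse_of_le hz] at h
    exact absurd h (OnePoint.coe_ne_infty _)
  · rw [ballCollapse_of_le hy, ballCollapse_of_lt hz] at h
    exact absurd h.symm (OnePoint.coe_ne_infty _)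
  · exact Or.inr ⟨hy, hz⟩

/-- Every positive-dimensional sphere is obtained from a cube by collapsing the boundary. -/
theorem exists_cube_collapse {m : ℕ} (hm : 0 < m) : ∃ q : C(Fin m → I, Sph m),
    Function.Surjective q ∧
    (∀ s ∈ Cube.boundary (Fin m), ∀ t ∈ Cube.boundary (Fin m), q s = q t) ∧
    ∀ s t, q s = q t → s = t ∨ s ∈ Cube.boundary (Fin m) ∧ t ∈ Cube.boundary (Fin m) := by
  have : Nonempty (Fin m) := ⟨⟨0, hm⟩⟩
  let e : OnePoint (Fin m → ℝ) ≃ₜ Sph m :=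
    onePointEquivSphereOfFinrankEq (ι := Fin (m + 1)) (V := Fin m → ℝ) (by simp)
  let c : (Fin m → I) → (Fin m → ℝ) := fun s i => 2 * (s i : ℝ) - 1
  have hc : Continuous c := by fun_prop
  have hb : ∀ s, s ∈ Cube.boundary (Fin m) ↔ 1 ≤ ‖c s‖ := by
    intro s
    constructor
    · rintro ⟨i, hi⟩
      refine le_trans (le_of_eq ?_) (norm_le_pi_norm (c s) i)
      rcases hi with hi | hi
      · simp [c, hi]
      · simp [c, hi]
        norm_num
    · intro h
      by_contra hs
      refine absurd h (not_le.mpr ((pi_norm_lt_iff one_pos).mpr fun i => ?_))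
      have h0 : s i ≠ 0 := fun h => hs ⟨i, Or.inl h⟩
      have h1 : s i ≠ 1 := fun h => hs ⟨i, Or.inr h⟩
      have h0' : 0 < (s i : ℝ) := unitInterval.pos_iff_ne_zero.mpr h0
      have h1' : (s i : ℝ) < 1 := unitInterval.lt_one_iff_ne_one.mpr h1
      rw [Real.norm_eq_abs, abs_lt]
      constructor <;> simp only [c] <;> linarith
  refine ⟨⟨fun s => e (ballCollapse (c s)), e.continuous.comp (continuous_ballCollapse.comp hc)⟩,
    ?_, ?_, ?_⟩
  · intro z
    obtain ⟨y, hy, hyz⟩ := exists_ballCollapse_eq (e.symm z)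
    have hy' : ∀ i, |y i| ≤ 1 := fun i => (norm_le_pi_norm y i).trans hy
    refine ⟨fun i => ⟨(y i + 1) / 2, ?_, ?_⟩, ?_⟩
    · linarith [(abs_le.mp (hy' i)).1]
    · linarith [(abs_le.mp (hy' i)).2]
    · have : (c fun i => ⟨(y i + 1) / 2, by linarith [(abs_le.mp (hy' i)).1],
          by linarith [(abs_le.mp (hy' i)).2]⟩) = y := by
        funext i
        simp only [c]
        ring
      simp only [ContinuousMap.coe_mk]
      rw [this, hyz, e.apply_symm_apply]
  · intro s hs t ht
    simp only [ContinuousMap.coe_mk]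
    rw [ballCollapse_of_le ((hb s).mp hs), ballCollapse_of_le ((hb t).mp ht)]
  · intro s t hst
    refine (ballCollapse_eq_iff (e.injective hst)).imp (fun h => ?_)
      fun h => ⟨(hb s).mpr h.1, (hb t).mpr h.2⟩
    funext i
    refine Subtype.ext ?_
    have := congrFun h i
    simp only [c] at this
    linarith

end SphereCollapse

section Final
open Topology Filter unitInterval
open scoped Topology.Homotopy

section CproJ
variable {M : ℕ}

theorem transpose_of_mem_Gamma {J : Matrix (Fin M ⊕ Fin M) (Fin M ⊕ Fin M) ℝ}
    (hJ : J ∈ Gamma M) : J.transpose = -J := by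
  have : J.transpose * (J * J) = J := by rw [← Matrix.mul_assoc, hJ.1, one_mul]
  rw [hJ.2, mul_neg, mul_one] at this
  rw [← this, neg_neg, this]

/-- The projection onto the `i`-eigenspace of a complex structure. -/
noncomputable def eigenProj (J : Matrix (Fin M ⊕ Fin M) (Fin M ⊕ Fin M) ℝ) :
    Matrix (Fin M ⊕ Fin M) (Fin M ⊕ Fin M) ℂ :=
  (2⁻¹ : ℂ) • (1 - Complex.I • J.map Complex.ofReal)

theorem continuous_eigenProj : Continuous (eigenProj (M := M)) := by
  have h : Continuous fun J : Matrix (Fin M ⊕ Fin M) (Fin M ⊕ Fin M) ℝ =>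
      J.map Complex.ofReal := continuous_id.matrix_map Complex.continuous_ofReal
  unfold eigenProj
  fun_prop

theorem eigenProj_mul_self {J : Matrix (Fin M ⊕ Fin M) (Fin M ⊕ Fin M) ℝ} (hJ : J ∈ Gamma M) :
    eigenProj J * eigenProj J = eigenProj J := by
  have h : J.map Complex.ofReal * J.map Complex.ofReal = -1 := by
    refine (Matrix.map_mul (f := Complex.ofRealHom)).symm.trans ?_
    rw [hJ.2]
    ext i j
    by_cases hij : i = j <;> simp [hij]
  simp only [eigenProj, smul_mul_assoc, mul_smul_comm, sub_mul, mul_sub, one_mul, mul_one, h,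
    smul_sub, smul_smul, smul_neg]
  match_scalars
  · linear_combination (-1 / 4 : ℂ) * Complex.I_sq
  · ring

theorem trace_eigenProj {J : Matrix (Fin M ⊕ Fin M) (Fin M ⊕ Fin M) ℝ} (hJ : J ∈ Gamma M) :
    (eigenProj J).trace = M := by
  have h : J.trace = 0 := by
    have := congrArg Matrix.trace (transpose_of_mem_Gamma hJ)
    rw [Matrix.trace_transpose, Matrix.trace_neg] at this
    linarith
  have h' : (J.map Complex.ofReal).trace = 0 := by
    have := congrArg Complex.ofReal h
    simpa [Matrix.trace] using this
  rw [eigenProj, Matrix.trace_smul, Matrix.trace_sub, Matrix.trace_smul, h', Matrix.trace_one]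
  simp
  ring

theorem eigenProj_conj {A J : Matrix (Fin M ⊕ Fin M) (Fin M ⊕ Fin M) ℝ}
    (hA : A * A.transpose = 1) : eigenProj (A * J * A.transpose)
      = A.map Complex.ofReal * eigenProj J * A.transpose.map Complex.ofReal := by
  have e : ∀ A B : Matrix (Fin M ⊕ Fin M) (Fin M ⊕ Fin M) ℝ,
      (A * B).map Complex.ofReal = A.map Complex.ofReal * B.map Complex.ofReal :=
    fun A B => Matrix.map_mul (f := Complex.ofRealHom)
  have h1 : A.map Complex.ofReal * A.transpose.map Complex.ofReal = 1 := by
    rw [← e, hA, Matrix.map_one _ Complex.ofReal_zero Complex.ofReal_one]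
  simp only [eigenProj, e, mul_smul_comm, smul_mul_assoc, mul_sub, sub_mul, mul_one, h1]

end CproJ

variable {M m : ℕ}

/-- The point of the cube with vanishing first coordinate and prescribed other coordinates. -/
def zeroSlice {d : ℕ} (s : Fin d → I) (y : Fin m → I) : Option (Fin d) ⊕ Fin m → ℝ :=
  Sum.elim (fun o => o.elim 0 fun i => (s i : ℝ)) fun j => (y j : ℝ)

theorem continuous_zeroSlice {d : ℕ} :
    Continuous fun p : (Fin d → I) × (Fin m → I) => zeroSlice p.1 p.2 := by
  refine continuous_pi fun l => ?_
  rcases l with (_ | i) | j <;> simp only [zeroSlice, Sum.elim_inl, Sum.elim_inr, Option.elim]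
    <;> fun_prop

theorem exists_relOrth {d : ℕ} {q : C(Fin m → I, Sph m)} (hq : Function.Surjective q)
    (hq' : ∀ s t, q s = q t → s = t ∨ s ∈ Cube.boundary (Fin m) ∧ t ∈ Cube.boundary (Fin m))
    {a : (Option (Fin d) ⊕ Fin m → ℝ) → Matrix (Fin M ⊕ Fin M) (Fin M ⊕ Fin M) ℝ}
    (ha : OrthUnit a)
    (ha1 : ∀ x, (∃ l ≠ Sum.inl none, ∃ k : ℤ, x l = (k : ℝ)) → a x = 1) :
    ∃ A : (Fin d → I) → Sph m → Matrix (Fin M ⊕ Fin M) (Fin M ⊕ Fin M) ℝ,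
      RelOrth Unit (fun _ => A) ∧ ∀ s y, A s (q y) = a (zeroSlice s y) := by
  have hbd : ∀ s, ∀ y ∈ Cube.boundary (Fin m), a (zeroSlice (d := d) s y) = 1 := by
    rintro s y ⟨j, hj⟩
    refine ha1 _ ⟨Sum.inr j, by simp, ?_⟩
    rcases hj with hj | hj
    · exact ⟨0, by simp [zeroSlice, hj]⟩
    · exact ⟨1, by simp [zeroSlice, hj]⟩
  let A : (Fin d → I) → Sph m → Matrix (Fin M ⊕ Fin M) (Fin M ⊕ Fin M) ℝ :=
    fun s z => a (zeroSlice s (Function.surjInv hq z))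
  have hA : ∀ s y, A s (q y) = a (zeroSlice s y) := by
    intro s y
    rcases hq' _ _ (Function.surjInv_eq hq (q y)) with h | ⟨h, h'⟩
    · simp only [A, h]
    · rw [hbd s y h']
      exact hbd s _ h
  refine ⟨A, ⟨?_, fun _ s z => ha.orth _, ?_⟩, hA⟩
  · have hquot : IsQuotientMap (Prod.map id q : (Fin d → I) × (Fin m → I) → (Fin d → I) × Sph m) :=
      IsClosedMap.isQuotientMap (continuous_id.prodMap q.continuous).isClosedMap
        (continuous_id.prodMap q.continuous) (Function.surjective_id.prodMap hq)
    have hc : Continuous fun p : (Fin d → I) × Sph m => A p.1 p.2 := by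
      rw [hquot.continuous_iff]
      refine (ha.cont.comp continuous_zeroSlice).congr fun p => ?_
      exact (hA p.1 p.2).symm
    exact hc.comp (f := fun p : (Unit × (Fin d → I)) × Sph m => (p.1.2, p.2)) (by fun_prop)
  · rintro _ s ⟨i, hi⟩ z
    refine ha1 _ ⟨Sum.inl (some i), by simp, ?_⟩
    rcases hi with hi | hi
    · exact ⟨0, by simp [zeroSlice, hi]⟩
    · exact ⟨1, by simp [zeroSlice, hi]⟩

theorem conjHomotopy_of_homotopic {d : ℕ} [Nonempty (Fin d)] {q : C(Fin m → I, Sph m)}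
    (hq : ∀ s ∈ Cube.boundary (Fin m), ∀ t ∈ Cube.boundary (Fin m), q s = q t)
    {a : (Option (Fin d) ⊕ Fin m → ℝ) → Matrix (Fin M ⊕ Fin M) (Fin M ⊕ Fin M) ℝ}
    {A : (Fin d → I) → Sph m → Matrix (Fin M ⊕ Fin M) (Fin M ⊕ Fin M) ℝ}
    (hA : RelOrth Unit fun _ => A) (haA : ∀ s y, A s (q y) = a (zeroSlice s y))
    (f : C(Sph m, GammaPlus M)) (h : GenLoop.Homotopic (hA.loop f) GenLoop.const) :
    ∃ G F, ConjHomotopy (p := Fin d) (R := Fin m) M (fun x => (a x).map Complex.ofReal)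
      (fun x => (a x).transpose.map Complex.ofReal) G F := by
  obtain ⟨H⟩ := h
  let P : ℝ → I := Set.projIcc 0 1 zero_le_one
  have hP : Continuous P := continuous_projIcc
  have hPc : ∀ x ∈ Set.Icc (0 : Option (Fin d) ⊕ Fin m → ℝ) 1, ∀ l, (P (x l) : ℝ) = x l :=
    fun x hx l => congrArg Subtype.val
      (Set.projIcc_of_mem zero_le_one (⟨hx.1 l, hx.2 l⟩ : x l ∈ Set.Icc (0 : ℝ) 1))
  have hP0 : P 0 = 0 := Set.projIcc_left ..
  have hP1 : P 1 = 1 := Set.projIcc_right ..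
  let y : (Option (Fin d) ⊕ Fin m → ℝ) → Fin m → I := fun x j => P (x (Sum.inr j))
  let s : (Option (Fin d) ⊕ Fin m → ℝ) → Fin d → I := fun x i => P (x (Sum.inl (some i)))
  let F : (Option (Fin d) ⊕ Fin m → ℝ) → Matrix (Fin M ⊕ Fin M) (Fin M ⊕ Fin M) ℂ :=
    fun x => eigenProj (f (q (y x))).1.1
  let G : (Option (Fin d) ⊕ Fin m → ℝ) → Matrix (Fin M ⊕ Fin M) (Fin M ⊕ Fin M) ℂ :=
    fun x => eigenProj (H (P (x (Sum.inl none)), s x) (q (y x))).1.1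
  have : CompactSpace (Sph m) := isCompact_iff_compactSpace.mp (isCompact_sphere _ _)
  refine ⟨G, F, ?_, fun x _ => eigenProj_mul_self (H _ _).1.2,
    fun x _ => trace_eigenProj (H _ _).1.2, ?_, ?_, ?_, ?_, ?_⟩
  · refine Continuous.continuousOn ?_
    refine continuous_eigenProj.comp (continuous_subtype_val.comp (continuous_subtype_val.comp ?_))
    have hs : Continuous s := by fun_prop
    have hy : Continuous y := by fun_prop
    have h1 : Continuous fun x : Option (Fin d) ⊕ Fin m → ℝ => H (P (x (Sum.inl none)), s x) :=
      H.continuous.comp (by fun_prop)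
    exact h1.eval (q.continuous.comp hy)
  · intro x hx h0
    have e : zeroSlice (s x) (y x) = x := by
      funext l
      rcases l with (_ | i) | j
      · exact h0.symm
      · exact hPc x hx _
      · exact hPc x hx _
    simp only [G, F]
    rw [h0, hP0, H.apply_zero]
    change eigenProj (A (s x) (q (y x)) * _ * (A (s x) (q (y x))).transpose) = _
    rw [eigenProj_conj (hA.orth () _ _), haA, e]
  · intro x hx h1
    simp only [G, F]
    rw [h1, hP1, H.apply_one]
    rfl
  · rintro x hx ⟨i, hi⟩
    have hs : s x ∈ Cube.boundary (Fin d) := ⟨i, by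
      refine hi.imp (fun h => ?_) fun h => ?_
      · simp only [s, h, hP0]
      · simp only [s, h, hP1]⟩
    simp only [G, F]
    rw [H.eq_fst _ hs]
    exact congrArg (fun g : C(Sph m, GammaPlus M) => eigenProj (g (q (y x))).1.1)
      ((hA.loop f).2 _ hs)
  · intro x x' h
    have : y x = y x' := funext fun j => by simp only [y, h j]
    simp only [F, this]
  · intro x hx x' hx' hb hb' h
    have hy : ∀ x : Option (Fin d) ⊕ Fin m → ℝ, (∃ i, x (Sum.inr i) = 0 ∨ x (Sum.inr i) = 1) →
        y x ∈ Cube.boundary (Fin m) := by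
      rintro x ⟨i, hi⟩
      refine ⟨i, hi.imp (fun h => ?_) fun h => ?_⟩
      · simp only [y, h, hP0]
      · simp only [y, h, hP1]
    have hs : s x = s x' := funext fun i => by simp only [s, h]
    simp only [G]
    rw [hs, h none, hq _ (hy x hb) _ (hy x' hb')]

end Final

end Auxiliary

/-- For `n ≥ 4` and every `f ∈ C(S^{4n+3}, Γ_{2n+2}⁺)`, the homotopy group
`π₄(C(S^{4n+3}, Γ_{2n+2}⁺), f)` contains an element of infinite order. -/
theorem stmt13 (n : ℕ) (hn : 4 ≤ n) (f : C(Sph (4 * n + 3), GammaPlus (2 * n + 2))) :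
    ∃ γ : π_ 4 C(Sph (4 * n + 3), GammaPlus (2 * n + 2)) f, ¬ IsOfFinOrder γ := by
  obtain ⟨q, hq, hqb, hq'⟩ := exists_cube_collapse (m := 4 * n + 3) (by omega)
  let κ := Option (Fin 4) ⊕ Fin (4 * n + 3)
  have hκ : Fintype.card κ = 2 * (2 * n + 4) := by
    simp [κ]
    ring
  let i₀ : Fin (2 * n + 4) := ⟨0, by omega⟩
  let e : Fin (2 * n + 4) × Bool ≃ κ := Fintype.equivOfCardEq (by rw [hκ]; simp [mul_comm])
  let ε : Fin (2 * n + 4) × Bool ≃ κ := e.trans (Equiv.swap (e (i₀, false)) (Sum.inl none))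
  have hε : ε (i₀, false) = Sum.inl none := by simp [ε]
  obtain ⟨a, ha, -, ha1, hch⟩ := exists_orthUnit ε i₀ (j := n + 2) (by ring)
    (Fin (2 * n + 2) ⊕ Fin (2 * n + 2)) (by simp; omega)
  rw [hε] at ha1 hch
  obtain ⟨A, hA, haA⟩ := exists_relOrth hq hq' ha ha1
  refine ⟨Quotient.mk _ (hA.loop f), fun hfin => ?_⟩
  obtain ⟨k, hk, hpow⟩ := isOfFinOrder_iff_pow_eq_one.mp hfin
  have hpow' := (hA.loop_pow f k).symm.trans hpow
  rw [HomotopyGroup.one_def] at hpow'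
  have hhom : GenLoop.Homotopic ((hA.pow k).loop f) GenLoop.const := Quotient.exact hpow'
  obtain ⟨G, F, hGF⟩ := conjHomotopy_of_homotopic (a := fun x => a x ^ k) hqb (hA.pow k)
    (fun s y => by rw [haA]) f hhom
  have e1 : (fun x => (a x ^ k).map Complex.ofReal) = fun x => ((a x).map Complex.ofReal) ^ k :=
    funext fun x => map_pow Complex.ofRealHom.mapMatrix (a x) k
  have e2 : (fun x => (a x ^ k).transpose.map Complex.ofReal)
      = fun x => ((a x).transpose.map Complex.ofReal) ^ k :=
    funext fun x => by
      rw [Matrix.transpose_pow]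
      exact map_pow Complex.ofRealHom.mapMatrix _ k
  rw [e1, e2] at hGF
  have hz := hGF.ch_clutch_eq_zero (ha.cunit.pow k) (fun x hx => by
      rw [ha1 x hx, Matrix.map_one _ Complex.ofReal_zero Complex.ofReal_one, one_pow])
    (by simp; ring) (by decide) (by simp; exact ⟨2 * n + 1, by ring⟩) (K := 2 * n + 4)
    (by simp; ring) (by omega)
  rw [ch_clutch_pow (j := Sum.inl (some 0)) (by simp) ha.cunit hκ k] at hz
  rw [← Nat.cast_smul_eq_nsmul ℂ, smul_eq_zero] at hz
  exact hz.elim (Nat.cast_ne_zero.mpr hk.ne') hch
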